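/- (Theorem 4.2: sharp transfer of regularity in Sobolev spaces, Bouchut–Hörmander estimate.) Let p ∈ (Q/(Q−1), ∞) and define q ∈ (1,∞) by 1/q = 1/p + 1/Q. There exists a constant C = C(d,p) > 0 such that for every f ∈ 𝒮(ℝ^{1+2d}) satisfying (∂_t + v·∇_x) f = ∇_v · S_0 + S_1 pointwise on ℝ^{1+2d}, with S_0 ∈ 𝒮(ℝ^{1+2d}; ℝ^d) and S_1 ∈ 𝒮(ℝ^{1+2d}), one has ‖𝔇_x f‖_{L^p(ℝ^{1+2d})} ≤ C ( ‖S_0‖_{L^p(ℝ^{1+2d})} + ‖∇_v f‖_{L^p(ℝ^{1+2d})} + ‖S_1‖_{L^q(ℝ^{1+2d})} ). -/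

import Mathlib

open MeasureTheory Real ENNReal
open scoped RealInnerProductSpace

noncomputable section

/-- Euclidean space `ℝ^d`. -/
abbrev V (d : ℕ) : Type := EuclideanSpace ℝ (Fin d)

/-- The kinetic phase space `ℝ^{1+2d}`, with points `(t, x, v)`. -/
abbrev Pt (d : ℕ) : Type := ℝ × V d × V d

/-- Kinetic composition `(t,x,v) ∘ (s,y,w) = (t+s, x+y+s v, v+w)`. -/
def kmul {d : ℕ} (a b : Pt d) : Pt d :=
  (a.1 + b.1, a.2.1 + b.2.1 + b.1 • a.2.2, a.2.2 + b.2.2)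

/-- Kinetic inverse `(t,x,v)⁻¹ = (−t, −x+t v, −v)`. -/
def kinv {d : ℕ} (a : Pt d) : Pt d :=
  (-a.1, -a.2.1 + a.1 • a.2.2, -a.2.2)

/-- `g₁(r) = r³ sin(log r)`, extended by `0` at `r = 0`. -/
def g1 (r : ℝ) : ℝ := r ^ 3 * Real.sin (Real.log r)

/-- `g₂(r) = r³ cos(log r)`, extended by `0` at `r = 0`. -/
def g2 (r : ℝ) : ℝ := r ^ 3 * Real.cos (Real.log r)

/-- `ġ₁(r)/(2r) = (r/2)(3 sin(log r) + cos(log r))`, extended by `0` at `r = 0`. -/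
def h1 (r : ℝ) : ℝ := r / 2 * (3 * Real.sin (Real.log r) + Real.cos (Real.log r))

/-- `ġ₂(r)/(2r) = (r/2)(3 cos(log r) − sin(log r))`, extended by `0` at `r = 0`. -/
def h2 (r : ℝ) : ℝ := r / 2 * (3 * Real.cos (Real.log r) - Real.sin (Real.log r))

/-- The matrix `W(r)`, recorded through its scalar block entries as a `2×2` real matrix;
the full `2d×2d` matrix is the blockwise tensor with `Id_d`. -/
def Wm (r : ℝ) : Matrix (Fin 2) (Fin 2) ℝ := !![g1 r, g2 r; h1 r, h2 r]

/-- The matrix `D_δ` (scalar block entries). -/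
def Dm (δ : ℝ) : Matrix (Fin 2) (Fin 2) ℝ := !![δ, 0; 0, 1]

/-- The matrix `E_δ(r)` (scalar block entries). -/
def Em (δ r : ℝ) : Matrix (Fin 2) (Fin 2) ℝ := !![1, δ * r ^ 2; 0, 1]

/-- `A_{m₀}(r) = D_{m₀} W(r) D_{m₀}⁻¹` (scalar block entries). -/
def Am (m0 r : ℝ) : Matrix (Fin 2) (Fin 2) ℝ := Dm m0 * Wm r * (Dm m0)⁻¹

/-- The action on `ℝ^d × ℝ^d` of a `2×2` block matrix whose blocks are the scalar
multiples of `Id_d` given by the entries of `M`. -/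
def act {d : ℕ} (M : Matrix (Fin 2) (Fin 2) ℝ) (p : V d × V d) : V d × V d :=
  (M 0 0 • p.1 + M 0 1 • p.2, M 1 0 • p.1 + M 1 1 • p.2)

/-- The kinetic trajectory `γ^m(r; (t,x,v))`. -/
def gammaK {d : ℕ} (m : Pt d) (z : Pt d) (r : ℝ) : Pt d :=
  (z.1 + m.1 * r ^ 2,
   (act (Em m.1 r) (z.2.1, z.2.2) + act (Am m.1 r) (m.2.1, m.2.2)).1,
   (act (Em m.1 r) (z.2.1, z.2.2) + act (Am m.1 r) (m.2.1, m.2.2)).2)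

/-- Build a vector of `ℝ^d` from components. -/
def mkV {d : ℕ} (f : Fin d → ℝ) : V d := (EuclideanSpace.equiv (Fin d) ℝ).symm f

/-- The argument `(s/r², A_{s/r²}(r)⁻¹ (y,w)ᵀ)` fed into `ψ`. -/
def psiArg {d : ℕ} (r : ℝ) (m : Pt d) : Pt d :=
  (m.1 / r ^ 2,
   (act ((Am (m.1 / r ^ 2) r)⁻¹) (m.2.1, m.2.2)).1,
   (act ((Am (m.1 / r ^ 2) r)⁻¹) (m.2.1, m.2.2)).2)

/-- The mollification kernel `K_r(s,y,w) = 2^d r^{−Q} ψ(s/r², A_{s/r²}(r)⁻¹(y,w)ᵀ)`,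
with `Q = 4d+2`. -/
def Kker {d : ℕ} (ψ : Pt d → ℝ) (r : ℝ) (m : Pt d) : ℝ :=
  2 ^ d * r ^ (-(4 * (d : ℤ) + 2)) * ψ (psiArg r m)

/-- The kernel `K̃_r(s,y,w) = −2^{d+1} s r^{−Q−1} ψ(s/r², A_{s/r²}(r)⁻¹(y,w)ᵀ)`. -/
def Ktil {d : ℕ} (ψ : Pt d → ℝ) (r : ℝ) (m : Pt d) : ℝ :=
  -(2 ^ (d + 1)) * m.1 * r ^ (-(4 * (d : ℤ) + 2) - 1) * ψ (psiArg r m)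

/-- First coefficient of the forcing matrix `F_{m₀}(r)`: `(1/m₀) ∂_r (ġ₁(r)/(2r))`. -/
def F1 (m0 r : ℝ) : ℝ := (1 / m0) * deriv h1 r

/-- Second coefficient of the forcing matrix `F_{m₀}(r)`: `∂_r (ġ₂(r)/(2r))`. -/
def F2 (r : ℝ) : ℝ := deriv h2 r

/-- The kernel `K⃗_r(s,y,w) = −2^d r^{−Q} ψ(⋯) F_{s/r²}(r) A_{s/r²}(r)⁻¹ (y,w)ᵀ ∈ ℝ^d`. -/
def Kvec {d : ℕ} (ψ : Pt d → ℝ) (r : ℝ) (m : Pt d) : V d :=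
  (-(2 ^ d) * r ^ (-(4 * (d : ℤ) + 2)) * ψ (psiArg r m)) •
    (F1 (m.1 / r ^ 2) r • (act ((Am (m.1 / r ^ 2) r)⁻¹) (m.2.1, m.2.2)).1 +
      F2 r • (act ((Am (m.1 / r ^ 2) r)⁻¹) (m.2.1, m.2.2)).2)

/-- The gradient of `u : ℝ^{1+2d} → ℝ` in the `x`-variables (the `m₁` block). -/
def gradX {d : ℕ} (u : Pt d → ℝ) (z : Pt d) : V d :=
  mkV fun i => fderiv ℝ u z (0, EuclideanSpace.single i 1, 0)

/-- The gradient of `u : ℝ^{1+2d} → ℝ` in the `v`-variables (the `m₂` block). -/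
def gradV {d : ℕ} (u : Pt d → ℝ) (z : Pt d) : V d :=
  mkV fun i => fderiv ℝ u z (0, 0, EuclideanSpace.single i 1)

/-- The kernel `K⃗^π_r(s,y,w)
  = 2^{d+1} s r^{−Q−1} [(A_{s/r²}(r)⁻¹)_{·;2}]ᵀ [∇_{(m₁,m₂)}ψ](⋯) ∈ ℝ^d`. -/
def Kpi {d : ℕ} (ψ : Pt d → ℝ) (r : ℝ) (m : Pt d) : V d :=
  (2 ^ (d + 1) * m.1 * r ^ (-(4 * (d : ℤ) + 2) - 1)) •
    ((Am (m.1 / r ^ 2) r)⁻¹ 0 1 • gradX ψ (psiArg r m) +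
      (Am (m.1 / r ^ 2) r)⁻¹ 1 1 • gradV ψ (psiArg r m))

/-- Kinetic convolution operator for scalar kernels:
`[T_J f](z) = ∫ J(z⁻¹ ∘ m) f(m) dm`. -/
def Tsc {d : ℕ} (J : Pt d → ℝ) (f : Pt d → ℝ) (z : Pt d) : ℝ :=
  ∫ m, J (kmul (kinv z) m) * f m

/-- Kinetic convolution operator for `ℝ^d`-valued kernels:
`[T_J f](z) = ∫ J(z⁻¹ ∘ m) · f(m) dm`. -/
def Tvec {d : ℕ} (J : Pt d → V d) (f : Pt d → V d) (z : Pt d) : ℝ :=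
  ∫ m, ⟪J (kmul (kinv z) m), f m⟫

/-- The support and nonnegativity conditions on the bump function `ψ`:
smooth, nonnegative, unit mass, supported in `(−2,−1) × B₁(0) × B₁(0)`. -/
structure IsKineticBump {d : ℕ} (ψ : Pt d → ℝ) : Prop where
  smooth : ContDiff ℝ (⊤ : ℕ∞) ψ
  nonneg : ∀ m, 0 ≤ ψ m
  mass : ∫ m, ψ m = 1
  supp : ∀ m : Pt d, ψ m ≠ 0 →
    m.1 ∈ Set.Ioo (-2 : ℝ) (-1) ∧ ‖m.2.1‖ < 1 ∧ ‖m.2.2‖ < 1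

/-- The kinetic box `B_r^kin = {(s,y,w) : |s| < r², |y| < r³, |w| < r}`. -/
def kinBox (d : ℕ) (r : ℝ) : Set (Pt d) :=
  {m | |m.1| < r ^ 2 ∧ ‖m.2.1‖ < r ^ 3 ∧ ‖m.2.2‖ < r}

/-- The (unnormalised) fractional derivative of order `1/3` in the second (spatial)
variable: `[𝔇_x u](t,x,v) = ∫ (2u(t,x,v) − u(t,x+h,v) − u(t,x−h,v)) |h|^{−d−1/3} dh`.
Applied to a kernel `J(s,y,w)` this is the operator `𝔇_y` acting in the `y` variable. -/
def fracDx {d : ℕ} (u : Pt d → ℝ) (z : Pt d) : ℝ :=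
  ∫ h : V d, (2 * u z - u (z.1, z.2.1 + h, z.2.2) - u (z.1, z.2.1 - h, z.2.2)) *
    ‖h‖ ^ (-(d : ℝ) - 1 / 3)

set_option linter.unusedSectionVars false

section CotlarStein

variable {A ι : Type*} [NormedRing A] [StarRing A] [CStarRing A]

/-- The family `a` or its adjoint, according to a parity. -/
def starFlip (a : ι → A) (b : Bool) (i : ι) : A := if b then a i else star (a i)

/-- The alternating product of `a` and its adjoint along a word, starting with parity `b`. -/
def altWord (a : ι → A) : Bool → List ι → A
  | _, [] => 1
  | b, i :: l => starFlip a b i * altWord a (!b) l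

/-- The product of the weights `c` along the consecutive letters of a word. -/
def chainWeight (c : ι → ι → ℝ) : List ι → ℝ
  | [] => 1
  | [_] => 1
  | i :: j :: l => c i j * chainWeight c (j :: l)

/-- The alternating product of `n` factors `∑ a`, `∑ star a`, with last parity `b`. -/
def altPow (a : ι → A) (s : Finset ι) : ℕ → Bool → A
  | 0, _ => 1
  | n + 1, b => altPow a s n (!b) * ∑ i ∈ s, starFlip a b i

theorem chainWeight_nonneg {c : ι → ι → ℝ} (hc : ∀ i j, 0 ≤ c i j) (l : List ι) :
    0 ≤ chainWeight c l := by
  induction l with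
  | nil => simp [chainWeight]
  | cons i l ih =>
    cases l with
    | nil => simp [chainWeight]
    | cons j l => exact mul_nonneg (hc i j) ih

theorem norm_altWord_mul_le {a : ι → A} {c : ι → ι → ℝ} {K : ℝ}
    (h1 : ∀ i j, ‖star (a i) * a j‖ ≤ c i j ^ 2)
    (h2 : ∀ i j, ‖a i * star (a j)‖ ≤ c i j ^ 2) (hK : ∀ i, ‖a i‖ ≤ K)
    (b : Bool) (i : ι) (l : List ι) :
    ‖altWord a b (i :: l)‖ * ‖altWord a (!b) l‖ ≤ K * ‖(1 : A)‖ ^ 2 * chainWeight c (i :: l) ^ 2 := by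
  have hX : ∀ b i, ‖starFlip a b i‖ ≤ K := by
    intro b i
    cases b <;> simp [starFlip, hK]
  induction l generalizing b i with
  | nil =>
    simp only [altWord, chainWeight]
    calc ‖starFlip a b i * 1‖ * ‖(1 : A)‖ ≤ (‖starFlip a b i‖ * ‖(1 : A)‖) * ‖(1 : A)‖ := by
          gcongr; exact norm_mul_le _ _
      _ ≤ (K * ‖(1 : A)‖) * ‖(1 : A)‖ := by gcongr; exact hX b i
      _ = _ := by ring
  | cons j l ih =>
    have hp : ‖starFlip a b i * starFlip a (!b) j‖ ≤ c i j ^ 2 := by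
      cases b
      · simpa [starFlip] using h1 i j
      · simpa [starFlip] using h2 i j
    calc ‖altWord a b (i :: j :: l)‖ * ‖altWord a (!b) (j :: l)‖
        = ‖(starFlip a b i * starFlip a (!b) j) * altWord a (!(!b)) l‖ *
            ‖altWord a (!b) (j :: l)‖ := by simp [altWord, mul_assoc]
      _ ≤ (‖starFlip a b i * starFlip a (!b) j‖ * ‖altWord a (!(!b)) l‖) *
            ‖altWord a (!b) (j :: l)‖ := by gcongr; exact norm_mul_le _ _
      _ = ‖starFlip a b i * starFlip a (!b) j‖ *
            (‖altWord a (!b) (j :: l)‖ * ‖altWord a (!(!b)) l‖) := by ring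
      _ ≤ c i j ^ 2 * (K * ‖(1 : A)‖ ^ 2 * chainWeight c (j :: l) ^ 2) :=
          mul_le_mul hp (ih (!b) j) (by positivity) (by positivity)
      _ = _ := by simp only [chainWeight]; ring

theorem norm_altWord_le {a : ι → A} {c : ι → ι → ℝ} {K : ℝ} (hK0 : 0 ≤ K)
    (hc : ∀ i j, 0 ≤ c i j) (h1 : ∀ i j, ‖star (a i) * a j‖ ≤ c i j ^ 2)
    (h2 : ∀ i j, ‖a i * star (a j)‖ ≤ c i j ^ 2) (hK : ∀ i, ‖a i‖ ≤ K)
    (b : Bool) (i : ι) (l : List ι) :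
    ‖altWord a b (i :: l)‖ ≤ K * ‖(1 : A)‖ * chainWeight c (i :: l) := by
  have hX : ‖starFlip a b i‖ ≤ K := by
    cases b <;> simp [starFlip, hK]
  refine le_of_sq_le_sq ?_ (by have := chainWeight_nonneg hc (i :: l); positivity)
  calc ‖altWord a b (i :: l)‖ ^ 2 = ‖altWord a b (i :: l)‖ * ‖starFlip a b i * altWord a (!b) l‖ := by
        rw [sq]; rfl
    _ ≤ ‖altWord a b (i :: l)‖ * (‖starFlip a b i‖ * ‖altWord a (!b) l‖) := by
        gcongr; exact norm_mul_le _ _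
    _ = ‖starFlip a b i‖ * (‖altWord a b (i :: l)‖ * ‖altWord a (!b) l‖) := by ring
    _ ≤ K * (K * ‖(1 : A)‖ ^ 2 * chainWeight c (i :: l) ^ 2) :=
        mul_le_mul hX (norm_altWord_mul_le h1 h2 hK b i l) (by positivity) hK0
    _ = _ := by ring

theorem norm_altPow_mul_altWord_le {a : ι → A} {s : Finset ι} {c : ι → ι → ℝ} {K M : ℝ}
    (hK0 : 0 ≤ K) (hM0 : 0 ≤ M)
    (hc : ∀ i j, 0 ≤ c i j) (h1 : ∀ i j, ‖star (a i) * a j‖ ≤ c i j ^ 2)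
    (h2 : ∀ i j, ‖a i * star (a j)‖ ≤ c i j ^ 2) (hK : ∀ i, ‖a i‖ ≤ K)
    (hM : ∀ j, ∑ i ∈ s, c i j ≤ M) (n : ℕ) (b : Bool) (j : ι) (l : List ι) :
    ‖altPow a s n (!b) * altWord a b (j :: l)‖ ≤
      M ^ n * (‖(1 : A)‖ * (K * ‖(1 : A)‖ * chainWeight c (j :: l))) := by
  induction n generalizing b j l with
  | zero =>
    simp only [altPow, pow_zero, one_mul]
    calc ‖altWord a b (j :: l)‖ = ‖1 * altWord a b (j :: l)‖ := by rw [one_mul]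
      _ ≤ ‖(1 : A)‖ * ‖altWord a b (j :: l)‖ := norm_mul_le _ _
      _ ≤ _ := by gcongr; exact norm_altWord_le hK0 hc h1 h2 hK b j l
  | succ n ih =>
    have he : altPow a s (n + 1) (!b) * altWord a b (j :: l) =
        ∑ i ∈ s, altPow a s n (!(!b)) * altWord a (!b) (i :: j :: l) := by
      simp only [altPow]
      rw [Finset.mul_sum, Finset.sum_mul]
      refine Finset.sum_congr rfl fun i _ => ?_
      simp [altWord, mul_assoc]
    rw [he]
    have hw := chainWeight_nonneg hc (j :: l)
    calc _ ≤ ∑ i ∈ s, ‖altPow a s n (!(!b)) * altWord a (!b) (i :: j :: l)‖ := norm_sum_le _ _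
      _ ≤ ∑ i ∈ s, M ^ n * (‖(1 : A)‖ * (K * ‖(1 : A)‖ * chainWeight c (i :: j :: l))) :=
          Finset.sum_le_sum fun i _ => ih (!b) i (j :: l)
      _ = (∑ i ∈ s, c i j) * (M ^ n * (‖(1 : A)‖ * (K * ‖(1 : A)‖ * chainWeight c (j :: l)))) := by
          rw [Finset.sum_mul]
          refine Finset.sum_congr rfl fun i _ => ?_
          simp only [chainWeight]; ring
      _ ≤ M * (M ^ n * (‖(1 : A)‖ * (K * ‖(1 : A)‖ * chainWeight c (j :: l)))) := by
          gcongr; exact hM j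
      _ = _ := by ring

/-- The **Cotlar–Stein lemma** for finite families in a C*-algebra. -/
theorem cotlar_stein (a : ι → A) (s : Finset ι) (c : ι → ι → ℝ) {M : ℝ} (hM0 : 0 < M)
    (hc : ∀ i j, 0 ≤ c i j) (h1 : ∀ i j, ‖star (a i) * a j‖ ≤ c i j ^ 2)
    (h2 : ∀ i j, ‖a i * star (a j)‖ ≤ c i j ^ 2) {K : ℝ} (hK : ∀ i, ‖a i‖ ≤ K)
    (hM : ∀ j, ∑ i ∈ s, c i j ≤ M) : ‖∑ i ∈ s, a i‖ ≤ M := by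
  classical
  set S := ∑ i ∈ s, a i with hS
  rcases s.eq_empty_or_nonempty with rfl | ⟨i₀, -⟩
  · simp [hS, hM0.le]
  have hK0 : 0 ≤ K := (norm_nonneg _).trans (hK i₀)
  have hpow : ∀ n, altPow a s (2 * n) true = (star S * S) ^ n := by
    intro n
    induction n with
    | zero => simp [altPow]
    | succ n ih =>
      rw [pow_succ, ← ih, show 2 * (n + 1) = 2 * n + 1 + 1 by ring]
      simp [altPow, starFlip, hS, star_sum, mul_assoc]
  set B := (s.card : ℝ) * (‖(1 : A)‖ * (K * ‖(1 : A)‖)) with hB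
  have hbound : ∀ n, ‖altPow a s (n + 1) true‖ ≤ B * M ^ n := by
    intro n
    have he : altPow a s (n + 1) true =
        ∑ i ∈ s, altPow a s n (!true) * altWord a true [i] := by
      simp [altPow, altWord, Finset.mul_sum]
    rw [he]
    calc _ ≤ ∑ i ∈ s, ‖altPow a s n (!true) * altWord a true [i]‖ := norm_sum_le _ _
      _ ≤ ∑ i ∈ s, M ^ n * (‖(1 : A)‖ * (K * ‖(1 : A)‖ * chainWeight c [i])) :=
          Finset.sum_le_sum fun i _ =>
            norm_altPow_mul_altWord_le hK0 hM0.le hc h1 h2 hK hM n true i []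
      _ = _ := by simp [chainWeight, hB]; ring
  have hsa : IsSelfAdjoint (star S * S) := IsSelfAdjoint.star_mul_self S
  have hnorm : ∀ k : ℕ, ‖S‖ ^ (2 * 2 ^ k) ≤ B / M * M ^ (2 * 2 ^ k) := by
    intro k
    have e1 : ‖(star S * S) ^ 2 ^ k‖ = ‖star S * S‖ ^ 2 ^ k := by
      have := hsa.nnnorm_pow_two_pow k
      simpa only [coe_nnnorm, NNReal.coe_pow] using congrArg NNReal.toReal this
    have e2 : ‖S‖ ^ (2 * 2 ^ k) = ‖altPow a s (2 * 2 ^ k) true‖ := by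
      rw [hpow, e1, CStarRing.norm_star_mul_self, pow_mul, sq]
    obtain ⟨n, hn⟩ : ∃ n, 2 * 2 ^ k = n + 1 := ⟨2 * 2 ^ k - 1, by have := Nat.two_pow_pos k; omega⟩
    rw [e2, hn]
    refine (hbound n).trans (le_of_eq ?_)
    field_simp
    ring
  by_contra! hlt
  have hr : 1 < ‖S‖ / M := (one_lt_div hM0).2 hlt
  obtain ⟨n, hn⟩ := pow_unbounded_of_one_lt (B / M) hr
  have h3 := hnorm n
  have h4 : (‖S‖ / M) ^ n ≤ (‖S‖ / M) ^ (2 * 2 ^ n) :=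
    pow_le_pow_right₀ hr.le (by have := Nat.lt_two_pow_self (n := n); omega)
  have h5 : (‖S‖ / M) ^ (2 * 2 ^ n) ≤ B / M := by
    rw [div_pow, div_le_iff₀ (by positivity)]; exact h3
  linarith

end CotlarStein

section DyadicKernel

variable {G : Type*} [Group G] [MeasurableSpace G]

/-- A family of kernels `κ j` living at scale `2 ^ j` with respect to the gauge `N`:
uniformly integrable, of mean zero, with a moment of order `ε` and `L¹`-Hölder continuous of
order `ε` under left and right translations, with the natural scaling. -/
structure IsDyadicKernel (μ : Measure G) (N : G → ℝ) (ε C : ℝ) (κ : ℤ → G → ℝ) : Prop where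
  integrable : ∀ j, Integrable (κ j) μ
  lintegral_le : ∀ j, ∫⁻ m, ‖κ j m‖ₑ ∂μ ≤ ENNReal.ofReal C
  integral_eq_zero : ∀ j, ∫ m, κ j m ∂μ = 0
  moment_le : ∀ j, ∫⁻ m, ‖κ j m‖ₑ * ENNReal.ofReal (N m ^ ε) ∂μ ≤
    ENNReal.ofReal (C * ((2 : ℝ) ^ j) ^ ε)
  left_le : ∀ j h, ∫⁻ m, ‖κ j (h * m) - κ j m‖ₑ ∂μ ≤ ENNReal.ofReal (C * (N h / 2 ^ j) ^ ε)
  right_le : ∀ j h, ∫⁻ m, ‖κ j (m * h) - κ j m‖ₑ ∂μ ≤ ENNReal.ofReal (C * (N h / 2 ^ j) ^ ε)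

theorem IsDyadicKernel.comp_inv [MeasurableInv G] {μ : Measure G} [μ.IsInvInvariant] {N : G → ℝ}
    {ε C : ℝ}
    {κ : ℤ → G → ℝ} (hN : ∀ m, N m⁻¹ = N m) (h : IsDyadicKernel μ N ε C κ) :
    IsDyadicKernel μ N ε C (fun j m => κ j m⁻¹) where
  integrable j := (h.integrable j).comp_inv
  lintegral_le j := by
    rw [lintegral_inv_eq_self (μ := μ) (fun m => ‖κ j m‖ₑ)]; exact h.lintegral_le j
  integral_eq_zero j := by
    rw [integral_inv_eq_self (fun m => κ j m) μ]; exact h.integral_eq_zero j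
  moment_le j := by
    have := lintegral_inv_eq_self (μ := μ) (fun m => ‖κ j m‖ₑ * ENNReal.ofReal (N m ^ ε))
    simp only [hN] at this
    rw [this]; exact h.moment_le j
  left_le j a := by
    have := lintegral_inv_eq_self (μ := μ) (fun m => ‖κ j (m * a⁻¹) - κ j m‖ₑ)
    simp only [mul_inv_rev]
    rw [this, ← hN a]
    exact h.right_le j a⁻¹
  right_le j a := by
    have := lintegral_inv_eq_self (μ := μ) (fun m => ‖κ j (a⁻¹ * m) - κ j m‖ₑ)
    simp only [mul_inv_rev]
    rw [this, ← hN a]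
    exact h.left_le j a⁻¹

end DyadicKernel

section UnitaryRep

variable {G : Type*} [Group G] [TopologicalSpace G] [MeasurableSpace G] [BorelSpace G]
  [SecondCountableTopology G] [IsTopologicalGroup G]
  {H : Type*} [NormedAddCommGroup H] [InnerProductSpace ℝ H] [CompleteSpace H]

/-- A strongly continuous isometric representation of `G` on the real Hilbert space `H`. -/
structure IsUnitaryRep (ρ : G → H →L[ℝ] H) : Prop where
  norm_map : ∀ m x, ‖ρ m x‖ = ‖x‖
  map_mul : ∀ m n x, ρ (m * n) x = ρ m (ρ n x)
  map_one : ∀ x, ρ 1 x = x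
  continuous : ∀ x, Continuous fun m => ρ m x

namespace IsUnitaryRep

variable {ρ : G → H →L[ℝ] H} (hρ : IsUnitaryRep ρ) {μ : Measure G}
include hρ

theorem inner_map_map (m : G) (x y : H) : ⟪ρ m x, ρ m y⟫ = ⟪x, y⟫ := by
  rw [real_inner_eq_norm_mul_self_add_norm_mul_self_sub_norm_sub_mul_self_div_two,
    real_inner_eq_norm_mul_self_add_norm_mul_self_sub_norm_sub_mul_self_div_two,
    ← map_sub, hρ.norm_map, hρ.norm_map, hρ.norm_map]

theorem inner_map_left (m : G) (x y : H) : ⟪ρ m x, y⟫ = ⟪x, ρ m⁻¹ y⟫ := by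
  rw [← hρ.inner_map_map m x (ρ m⁻¹ y), ← hρ.map_mul, mul_inv_cancel, hρ.map_one]

theorem integrable_smul {K : G → ℝ} (hK : Integrable K μ) (x : H) :
    Integrable (fun m => K m • ρ m x) μ := by
  refine (hK.norm.mul_const ‖x‖).mono' ?_ (Filter.Eventually.of_forall fun m => ?_)
  · exact hK.aestronglyMeasurable.smul (hρ.continuous x).aestronglyMeasurable
  · rw [norm_smul, hρ.norm_map]

/-- The operator `x ↦ ∫ K m • ρ m x` of an integrable kernel. -/
def integrated {K : G → ℝ} (hK : Integrable K μ) : H →L[ℝ] H :=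
  LinearMap.mkContinuous
    { toFun := fun x => ∫ m, K m • ρ m x ∂μ
      map_add' := fun x y => by
        simp only [map_add, smul_add]
        exact integral_add (hρ.integrable_smul hK x) (hρ.integrable_smul hK y)
      map_smul' := fun c x => by
        simp only [map_smul, smul_comm _ c, RingHom.id_apply]
        exact integral_smul c _ } (∫ m, ‖K m‖ ∂μ) fun x => by
    refine (norm_integral_le_integral_norm _).trans (le_of_eq ?_)
    simp only [norm_smul, hρ.norm_map]
    exact integral_mul_const _ _

theorem integrated_apply {K : G → ℝ} (hK : Integrable K μ) (x : H) :
    hρ.integrated hK x = ∫ m, K m • ρ m x ∂μ := rfl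

theorem enorm_map (m : G) (x : H) : ‖ρ m x‖ₑ = ‖x‖ₑ := by
  rw [← ofReal_norm, ← ofReal_norm, hρ.norm_map]

theorem enorm_integral_le (K : G → ℝ) (x : H) :
    ‖∫ m, K m • ρ m x ∂μ‖ₑ ≤ (∫⁻ m, ‖K m‖ₑ ∂μ) * ‖x‖ₑ := by
  refine (enorm_integral_le_lintegral_enorm _).trans (le_of_eq ?_)
  simp only [enorm_smul, hρ.enorm_map]
  exact lintegral_mul_const' _ _ enorm_ne_top

theorem adjoint_integrated [μ.IsInvInvariant] {K : G → ℝ} (hK : Integrable K μ)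
    (hK' : Integrable (fun m => K m⁻¹) μ) :
    star (hρ.integrated hK) = hρ.integrated hK' := by
  rw [ContinuousLinearMap.star_eq_adjoint, eq_comm, ContinuousLinearMap.eq_adjoint_iff]
  intro x y
  rw [integrated_apply, integrated_apply, real_inner_comm,
    ← integral_inner (hρ.integrable_smul hK' x), ← integral_inner (hρ.integrable_smul hK y),
    ← integral_inv_eq_self _ μ]
  refine integral_congr_ae (Filter.Eventually.of_forall fun m => ?_)
  simp only [inv_inv, inner_smul_right]
  rw [real_inner_comm, hρ.inner_map_left, inv_inv]

theorem enorm_map_integrated_sub_le [μ.IsMulLeftInvariant] {L : G → ℝ} (hL : Integrable L μ)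
    (h : G) (x : H) :
    ‖ρ h (hρ.integrated hL x) - hρ.integrated hL x‖ₑ ≤
      (∫⁻ m, ‖L (h⁻¹ * m) - L m‖ₑ ∂μ) * ‖x‖ₑ := by
  have e : ρ h (hρ.integrated hL x) - hρ.integrated hL x =
      ∫ m, (L (h⁻¹ * m) - L m) • ρ m x ∂μ := by
    have i2 : Integrable (fun m => L (h⁻¹ * m)) μ := hL.comp_mul_left h⁻¹
    simp only [sub_smul]
    rw [integral_sub (hρ.integrable_smul i2 x) (hρ.integrable_smul hL x), integrated_apply,
      ← ContinuousLinearMap.integral_comp_comm _ (hρ.integrable_smul hL x)]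
    congr 1
    rw [← integral_mul_left_eq_self (fun m => L (h⁻¹ * m) • ρ m x) h]
    simp [hρ.map_mul]
  rw [e]
  exact hρ.enorm_integral_le _ x

theorem enorm_integrated_comp_le [μ.IsMulLeftInvariant] [μ.IsInvInvariant] {N : G → ℝ}
    (hN : ∀ m, N m⁻¹ = N m) (hN0 : ∀ m, 0 ≤ N m) {ε C : ℝ} (hC : 0 ≤ C)
    {κ ν : ℤ → G → ℝ} (hκ : IsDyadicKernel μ N ε C κ)
    (hν : IsDyadicKernel μ N ε C ν) (i j : ℤ) (x : H) :
    ‖hρ.integrated (hκ.integrable i) (hρ.integrated (hν.integrable j) x)‖ₑ ≤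
      ENNReal.ofReal (C ^ 2 * ((2 : ℝ) ^ i / 2 ^ j) ^ ε) * ‖x‖ₑ := by
  set y := hρ.integrated (hν.integrable j) x with hy
  have e : hρ.integrated (hκ.integrable i) y = ∫ m, κ i m • (ρ m y - y) ∂μ := by
    simp only [smul_sub]
    rw [integral_sub (hρ.integrable_smul (hκ.integrable i) y) ((hκ.integrable i).smul_const y),
      integral_smul_const, hκ.integral_eq_zero, zero_smul, sub_zero, integrated_apply]
  rw [e]
  calc ‖∫ m, κ i m • (ρ m y - y) ∂μ‖ₑ ≤ ∫⁻ m, ‖κ i m • (ρ m y - y)‖ₑ ∂μ :=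
        enorm_integral_le_lintegral_enorm _
    _ ≤ ∫⁻ m, (‖κ i m‖ₑ * ENNReal.ofReal (N m ^ ε)) *
          (ENNReal.ofReal (C / (2 ^ j) ^ ε) * ‖x‖ₑ) ∂μ := by
        refine lintegral_mono fun m => ?_
        rw [enorm_smul, mul_assoc, ← mul_assoc (ENNReal.ofReal _)]
        gcongr
        refine (hρ.enorm_map_integrated_sub_le (hν.integrable j) m x).trans ?_
        gcongr
        refine (hν.left_le j m⁻¹).trans (le_of_eq ?_)
        rw [hN, ← ENNReal.ofReal_mul (Real.rpow_nonneg (hN0 m) _),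
          Real.div_rpow (hN0 m) (by positivity)]
        congr 1; ring
    _ = (∫⁻ m, ‖κ i m‖ₑ * ENNReal.ofReal (N m ^ ε) ∂μ) *
          (ENNReal.ofReal (C / (2 ^ j) ^ ε) * ‖x‖ₑ) :=
        lintegral_mul_const' _ _ (ENNReal.mul_ne_top ofReal_ne_top enorm_ne_top)
    _ ≤ ENNReal.ofReal (C * ((2 : ℝ) ^ i) ^ ε) * (ENNReal.ofReal (C / (2 ^ j) ^ ε) * ‖x‖ₑ) := by
        gcongr; exact hκ.moment_le i
    _ = _ := by
        rw [← mul_assoc, ← ENNReal.ofReal_mul (by positivity)]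
        congr 2
        rw [Real.div_rpow (by positivity) (by positivity)]
        ring

end IsUnitaryRep
end UnitaryRep

theorem exists_sum_min_rpow_le {ε : ℝ} (hε : 0 < ε) :
    ∃ M : ℝ, 0 < M ∧ ∀ x : ℝ, 0 < x → ∀ s : Finset ℤ,
      ∑ j ∈ s, min ((x / 2 ^ j) ^ ε) ((2 ^ j / x) ^ ε) ≤ M := by
  set r : ℝ := (2 : ℝ) ^ (-ε) with hr
  have hr0 : 0 < r := by positivity
  have hr1 : r < 1 := Real.rpow_lt_one_of_one_lt_of_neg (by norm_num) (by linarith)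
  have hs : Summable fun j : ℤ => r ^ j.natAbs := by
    refine Summable.of_nat_of_neg ?_ ?_ <;>
      simpa using summable_geometric_of_lt_one hr0.le hr1
  have hpos : 0 < ∑' j : ℤ, r ^ j.natAbs :=
    hs.tsum_pos (fun j => by positivity) 0 (by positivity)
  refine ⟨2 ^ ε * ∑' j : ℤ, r ^ j.natAbs, by positivity, fun x hx s => ?_⟩
  obtain ⟨n, hn1, hn2⟩ := exists_mem_Ico_zpow hx (by norm_num : (1 : ℝ) < 2)
  have key : ∀ j : ℤ, min ((x / 2 ^ j) ^ ε) ((2 ^ j / x) ^ ε) ≤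
      2 ^ ε * r ^ (j - n).natAbs := by
    intro j
    have hz : ∀ k : ℕ, r ^ k = ((2 : ℝ) ^ (-(k : ℤ))) ^ ε := by
      intro k
      rw [hr, ← Real.rpow_natCast, ← Real.rpow_mul (by norm_num), ← Real.rpow_intCast,
        ← Real.rpow_mul (by norm_num)]
      congr 1; push_cast; ring
    rw [hz, ← Real.mul_rpow (by norm_num) (by positivity)]
    rcases le_total j n with h | h
    · refine (min_le_right _ _).trans (Real.rpow_le_rpow (by positivity) ?_ hε.le)
      have : (-((j - n).natAbs : ℤ)) = j - n := by omega
      rw [this, div_le_iff₀ hx]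
      calc (2 : ℝ) ^ j = 2 ^ (j - n) * 2 ^ n := by rw [← zpow_add₀ (by norm_num)]; simp
        _ ≤ 2 ^ (j - n) * x := by gcongr
        _ ≤ 2 * 2 ^ (j - n) * x := by
          have : (0 : ℝ) < 2 ^ (j - n) * x := by positivity
          linarith
    · refine (min_le_left _ _).trans (Real.rpow_le_rpow (by positivity) ?_ hε.le)
      have : (-((j - n).natAbs : ℤ)) = n - j := by omega
      rw [this, div_le_iff₀ (by positivity)]
      calc x ≤ 2 ^ (n + 1) := hn2.le
        _ = 2 * 2 ^ (n - j) * 2 ^ j := by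
          rw [mul_assoc, ← zpow_add₀ (by norm_num), zpow_add_one₀ (by norm_num)]; simp; ring
  calc ∑ j ∈ s, min ((x / 2 ^ j) ^ ε) ((2 ^ j / x) ^ ε)
      ≤ ∑ j ∈ s, 2 ^ ε * r ^ (j - n).natAbs := Finset.sum_le_sum fun j _ => key j
    _ = 2 ^ ε * ∑ j ∈ s, r ^ (j - n).natAbs := by rw [Finset.mul_sum]
    _ ≤ 2 ^ ε * ∑' j : ℤ, r ^ (j - n).natAbs := by
        gcongr
        exact ((Equiv.subRight n).summable_iff.mpr hs).sum_le_tsum s (fun j _ => by positivity)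
    _ = _ := by
        congr 1
        exact (Equiv.subRight n).tsum_eq (fun j => r ^ j.natAbs)

section UnitaryRep

variable {G : Type*} [Group G] [TopologicalSpace G] [MeasurableSpace G] [BorelSpace G]
  [SecondCountableTopology G] [IsTopologicalGroup G]
  {H : Type*} [NormedAddCommGroup H] [InnerProductSpace ℝ H] [CompleteSpace H]
  {ρ : G → H →L[ℝ] H} (hρ : IsUnitaryRep ρ) {μ : Measure G}
  [μ.IsMulLeftInvariant] [μ.IsInvInvariant]
include hρ

theorem IsUnitaryRep.norm_integrated_mul_le {N : G → ℝ}
    (hN : ∀ m, N m⁻¹ = N m) (hN0 : ∀ m, 0 ≤ N m) {ε C : ℝ} (hC : 0 ≤ C)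
    {κ ν : ℤ → G → ℝ} (hκ : IsDyadicKernel μ N ε C κ)
    (hν : IsDyadicKernel μ N ε C ν) (i j : ℤ) :
    ‖hρ.integrated (hκ.integrable i) * hρ.integrated (hν.integrable j)‖ ≤
      C ^ 2 * ((2 : ℝ) ^ i / 2 ^ j) ^ ε := by
  refine ContinuousLinearMap.opNorm_le_bound _ (by positivity) fun x => ?_
  have := hρ.enorm_integrated_comp_le hN hN0 hC hκ hν i j x
  rw [← ofReal_norm (E := H), ← ofReal_norm (E := H), ← ENNReal.ofReal_mul (by positivity)] at this
  exact (ENNReal.ofReal_le_ofReal_iff (by positivity)).mp this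

theorem IsUnitaryRep.norm_sum_integrated_le {ε : ℝ} {M : ℝ} (hM0 : 0 < M)
    (hM : ∀ x : ℝ, 0 < x → ∀ s : Finset ℤ,
      ∑ j ∈ s, min ((x / 2 ^ j) ^ (ε / 2)) ((2 ^ j / x) ^ (ε / 2)) ≤ M) {N : G → ℝ}
    (hN : ∀ m, N m⁻¹ = N m) (hN0 : ∀ m, 0 ≤ N m) {C : ℝ} (hC : 0 < C)
    {κ : ℤ → G → ℝ} (hκ : IsDyadicKernel μ N ε C κ) (s : Finset ℤ) :
    ‖∑ j ∈ s, hρ.integrated (hκ.integrable j)‖ ≤ C * M := by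
  have hκ' := hκ.comp_inv hN
  have hstar : ∀ j, star (hρ.integrated (hκ.integrable j)) =
      hρ.integrated (hκ'.integrable j) := fun j => hρ.adjoint_integrated _ _
  have hsq : ∀ a : ℝ, 0 ≤ a → (a ^ (ε / 2)) ^ 2 = a ^ ε := fun a ha => by
    rw [← Real.rpow_natCast, ← Real.rpow_mul ha]; congr 1; push_cast; ring
  have hmin : ∀ i j : ℤ, ∀ t : ℝ, t ≤ C ^ 2 * ((2 : ℝ) ^ i / 2 ^ j) ^ ε →
      t ≤ C ^ 2 * ((2 : ℝ) ^ j / 2 ^ i) ^ ε →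
      t ≤ (C * min (((2 : ℝ) ^ j / 2 ^ i) ^ (ε / 2)) ((2 ^ i / 2 ^ j) ^ (ε / 2))) ^ 2 := by
    intro i j t h1 h2
    rcases min_choice (((2 : ℝ) ^ j / 2 ^ i) ^ (ε / 2)) ((2 ^ i / 2 ^ j) ^ (ε / 2)) with h | h <;>
    · rw [h, mul_pow, hsq _ (by positivity)]; assumption
  refine cotlar_stein (fun j => hρ.integrated (hκ.integrable j)) s
    (fun i j => C * min (((2 : ℝ) ^ j / 2 ^ i) ^ (ε / 2)) ((2 ^ i / 2 ^ j) ^ (ε / 2)))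
    (by positivity) (fun i j => by positivity) (fun i j => hmin i j _ ?_ ?_)
    (fun i j => hmin i j _ ?_ ?_) (K := C) (fun i => ?_) (fun j => ?_)
  · rw [hstar]; exact hρ.norm_integrated_mul_le hN hN0 hC.le hκ' hκ i j
  · rw [← norm_star, star_mul, star_star, hstar]
    exact hρ.norm_integrated_mul_le hN hN0 hC.le hκ' hκ j i
  · rw [hstar]; exact hρ.norm_integrated_mul_le hN hN0 hC.le hκ hκ' i j
  · rw [← norm_star, star_mul, star_star, hstar]
    exact hρ.norm_integrated_mul_le hN hN0 hC.le hκ hκ' j i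
  · refine ContinuousLinearMap.opNorm_le_bound _ hC.le fun x => ?_
    have : ‖hρ.integrated (hκ.integrable i) x‖ₑ ≤ ENNReal.ofReal C * ‖x‖ₑ :=
      (hρ.enorm_integral_le _ x).trans (mul_le_mul_left (hκ.lintegral_le i) _)
    rw [← ofReal_norm (E := H), ← ofReal_norm (E := H), ← ENNReal.ofReal_mul hC.le] at this
    exact (ENNReal.ofReal_le_ofReal_iff (by positivity)).mp this
  · rw [← Finset.mul_sum]
    gcongr
    exact hM (2 ^ j) (by positivity) s

end UnitaryRep

theorem lintegral_mul_rpow_le {α : Type*} [MeasurableSpace α] {μ : Measure α} {p : ℝ} (hp : 1 ≤ p)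
    {k F : α → ℝ≥0∞} (hk : AEMeasurable k μ) (hF : AEMeasurable F μ) :
    (∫⁻ a, k a * F a ∂μ) ^ p ≤ (∫⁻ a, k a ∂μ) ^ (p - 1) * ∫⁻ a, k a * F a ^ p ∂μ := by
  rcases hp.eq_or_lt with rfl | hp
  · simp
  have hp0 : 0 < p := by linarith
  set p' : ℝ := p / (p - 1) with hp'
  have hc : p'.HolderConjugate p := (Real.HolderConjugate.conjExponent hp).symm
  have h := ENNReal.lintegral_mul_le_Lp_mul_Lq μ hc (hk.pow_const (1 / p'))
    ((hk.pow_const (1 / p)).mul hF)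
  have e1 : ∀ a, k a ^ (1 / p') * (k a ^ (1 / p) * F a) = k a * F a := fun a => by
    rw [← mul_assoc, ← ENNReal.rpow_add_of_nonneg _ _ hc.one_div_nonneg hc.symm.one_div_nonneg]
    rw [one_div, one_div, hc.inv_add_inv_eq_one, ENNReal.rpow_one]
  have e2 : ∀ a, (k a ^ (1 / p')) ^ p' = k a := fun a => by
    rw [← ENNReal.rpow_mul, one_div_mul_cancel hc.ne_zero, ENNReal.rpow_one]
  have e3 : ∀ a, (k a ^ (1 / p) * F a) ^ p = k a * F a ^ p := fun a => by
    rw [ENNReal.mul_rpow_of_nonneg _ _ hp0.le, ← ENNReal.rpow_mul,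
      one_div_mul_cancel hp0.ne', ENNReal.rpow_one]
  simp only [Pi.mul_apply, e1, e2, e3] at h
  calc _ ≤ ((∫⁻ a, k a ∂μ) ^ (1 / p') * (∫⁻ a, k a * F a ^ p ∂μ) ^ (1 / p)) ^ p := by gcongr
    _ = _ := by
      rw [ENNReal.mul_rpow_of_nonneg _ _ hp0.le, ← ENNReal.rpow_mul, ← ENNReal.rpow_mul,
        one_div_mul_cancel hp0.ne', ENNReal.rpow_one]
      congr 2
      rw [hp']; field_simp

section GroupConvolution

variable {G : Type*} [Group G] [TopologicalSpace G] [IsTopologicalGroup G] [MeasurableSpace G]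
  [BorelSpace G] [SecondCountableTopology G] {μ : Measure G} [SigmaFinite μ]
  [μ.IsMulLeftInvariant] [μ.IsMulRightInvariant] [μ.IsInvInvariant]

/-- The operator of right translations of `f` averaged against the kernel `K`. -/
def rconv (μ : Measure G) (K f : G → ℝ) (z : G) : ℝ := ∫ m, K m * f (z * m) ∂μ

theorem quasiMeasurePreserving_mul_prod :
    Measure.QuasiMeasurePreserving (fun x : G × G => x.1 * x.2) (μ.prod μ) μ :=
  (Measure.quasiMeasurePreserving_snd (μ := μ) (ν := μ)).comp
    (measurePreserving_prod_mul μ μ).quasiMeasurePreserving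

theorem aestronglyMeasurable_kernel_mul {K f : G → ℝ} (hK : AEStronglyMeasurable K μ)
    (hf : AEStronglyMeasurable f μ) :
    AEStronglyMeasurable (fun x : G × G => K x.2 * f (x.1 * x.2)) (μ.prod μ) :=
  hK.comp_snd.mul (hf.comp_quasiMeasurePreserving quasiMeasurePreserving_mul_prod)

theorem aestronglyMeasurable_rconv {K f : G → ℝ} (hK : AEStronglyMeasurable K μ)
    (hf : AEStronglyMeasurable f μ) : AEStronglyMeasurable (rconv μ K f) μ :=
  (aestronglyMeasurable_kernel_mul hK hf).integral_prod_right'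

theorem enorm_rconv_le (K f : G → ℝ) (z : G) :
    ‖rconv μ K f z‖ₑ ≤ ∫⁻ m, ‖K m‖ₑ * ‖f (z * m)‖ₑ ∂μ := by
  refine (enorm_integral_le_lintegral_enorm _).trans (le_of_eq ?_)
  simp only [enorm_mul]

theorem lintegral_kernel_rpow_le {p : ℝ} (hp : 1 ≤ p) {K F : G → ℝ≥0∞}
    (hK : AEMeasurable K μ) (hF : AEMeasurable F μ) :
    ∫⁻ z, (∫⁻ m, K m * F (z * m) ∂μ) ^ p ∂μ ≤ (∫⁻ m, K m ∂μ) ^ p * ∫⁻ z, F z ^ p ∂μ := by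
  have hFt : ∀ z, AEMeasurable (fun m => F (z * m)) μ := fun z =>
    hF.comp_quasiMeasurePreserving (measurePreserving_mul_left μ z).quasiMeasurePreserving
  have hj : AEMeasurable (Function.uncurry fun z m => K m * F (z * m) ^ p) (μ.prod μ) :=
    hK.comp_snd.mul ((hF.comp_quasiMeasurePreserving quasiMeasurePreserving_mul_prod).pow_const p)
  calc _ ≤ ∫⁻ z, (∫⁻ m, K m ∂μ) ^ (p - 1) * ∫⁻ m, K m * F (z * m) ^ p ∂μ ∂μ :=
        lintegral_mono fun z => lintegral_mul_rpow_le hp hK (hFt z)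
    _ = (∫⁻ m, K m ∂μ) ^ (p - 1) * ∫⁻ z, ∫⁻ m, K m * F (z * m) ^ p ∂μ ∂μ :=
        lintegral_const_mul'' _ hj.lintegral_prod_right'
    _ = (∫⁻ m, K m ∂μ) ^ (p - 1) * ∫⁻ m, K m * ∫⁻ z, F z ^ p ∂μ ∂μ := by
        rw [lintegral_lintegral_swap hj]
        congr 1
        refine lintegral_congr fun m => ?_
        rw [lintegral_const_mul'', lintegral_mul_right_eq_self (fun z => F z ^ p) m]
        exact (hF.comp_quasiMeasurePreserving
          (measurePreserving_mul_right μ m).quasiMeasurePreserving).pow_const p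
    _ = _ := by
        rw [lintegral_mul_const'' _ hK, ← mul_assoc]
        congr 1
        conv_lhs => rw [← ENNReal.rpow_one (∫⁻ m, K m ∂μ)]
        rw [← ENNReal.rpow_mul, ← ENNReal.rpow_add_of_nonneg _ _ (by linarith) (by norm_num)]
        congr 1; ring

theorem lintegral_rconv_rpow_le {p : ℝ} (hp : 1 ≤ p) {K f : G → ℝ}
    (hK : AEStronglyMeasurable K μ) (hf : AEStronglyMeasurable f μ) :
    ∫⁻ z, ‖rconv μ K f z‖ₑ ^ p ∂μ ≤ (∫⁻ m, ‖K m‖ₑ ∂μ) ^ p * ∫⁻ z, ‖f z‖ₑ ^ p ∂μ :=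
  (lintegral_mono fun z => ENNReal.rpow_le_rpow (enorm_rconv_le K f z) (by linarith)).trans
    (lintegral_kernel_rpow_le hp hK.enorm hf.enorm)

theorem eLpNorm_ofReal_eq {α E : Type*} [MeasurableSpace α] [NormedAddCommGroup E] {ν : Measure α}
    {p : ℝ} (hp : 0 < p) (f : α → E) :
    eLpNorm f (ENNReal.ofReal p) ν = (∫⁻ x, ‖f x‖ₑ ^ p ∂ν) ^ (1 / p) := by
  rw [eLpNorm_eq_lintegral_rpow_enorm_toReal (by simpa using hp) ofReal_ne_top,
    ENNReal.toReal_ofReal hp.le]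

theorem eLpNorm_rpow_eq {α E : Type*} [MeasurableSpace α] [NormedAddCommGroup E] {ν : Measure α}
    {p : ℝ} (hp : 0 < p) (f : α → E) :
    eLpNorm f (ENNReal.ofReal p) ν ^ p = ∫⁻ x, ‖f x‖ₑ ^ p ∂ν := by
  rw [eLpNorm_ofReal_eq hp, ← ENNReal.rpow_mul, one_div_mul_cancel hp.ne', ENNReal.rpow_one]

theorem eLpNorm_rconv_le {p : ℝ} (hp : 1 ≤ p) {K f : G → ℝ}
    (hK : AEStronglyMeasurable K μ) (hf : AEStronglyMeasurable f μ) :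
    eLpNorm (rconv μ K f) (ENNReal.ofReal p) μ ≤
      (∫⁻ m, ‖K m‖ₑ ∂μ) * eLpNorm f (ENNReal.ofReal p) μ := by
  have hp0 : 0 < p := by linarith
  rw [← ENNReal.rpow_le_rpow_iff hp0, ENNReal.mul_rpow_of_nonneg _ _ hp0.le,
    eLpNorm_rpow_eq hp0, eLpNorm_rpow_eq hp0]
  exact lintegral_rconv_rpow_le hp hK hf

theorem memLp_rconv {p : ℝ} (hp : 1 ≤ p) {K f : G → ℝ} (hK : Integrable K μ)
    (hf : MemLp f (ENNReal.ofReal p) μ) : MemLp (rconv μ K f) (ENNReal.ofReal p) μ :=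
  ⟨aestronglyMeasurable_rconv hK.1 hf.1, (eLpNorm_rconv_le hp hK.1 hf.1).trans_lt
    (ENNReal.mul_lt_top hK.2 hf.2)⟩

theorem ae_integrable_kernel_mul {p : ℝ} (hp : 1 ≤ p) {K f : G → ℝ} (hK : Integrable K μ)
    (hf : MemLp f (ENNReal.ofReal p) μ) : ∀ᵐ z ∂μ, Integrable (fun m => K m * f (z * m)) μ := by
  have hp0 : 0 < p := by linarith
  have h := (lintegral_kernel_rpow_le hp hK.1.enorm hf.1.enorm).trans_lt
    (ENNReal.mul_lt_top (ENNReal.rpow_lt_top_of_nonneg hp0.le hK.2.ne)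
      (by rw [← eLpNorm_rpow_eq hp0]; exact ENNReal.rpow_lt_top_of_nonneg hp0.le hf.2.ne))
  have hj : AEMeasurable (Function.uncurry fun z m => ‖K m‖ₑ * ‖f (z * m)‖ₑ) (μ.prod μ) :=
    hK.1.enorm.comp_snd.mul
      (hf.1.enorm.comp_quasiMeasurePreserving quasiMeasurePreserving_mul_prod)
  filter_upwards [ae_lt_top' (hj.lintegral_prod_right'.pow_const p) h.ne] with z hz
  refine ⟨hK.1.mul (hf.1.comp_quasiMeasurePreserving
    (measurePreserving_mul_left μ z).quasiMeasurePreserving), ?_⟩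
  have : ∫⁻ m, ‖K m‖ₑ * ‖f (z * m)‖ₑ ∂μ < ∞ := by
    by_contra hc
    rw [not_lt_top_iff] at hc
    simp [Function.uncurry, hc, hp0] at hz
  simpa [HasFiniteIntegral, enorm_mul] using this

theorem integrable_kernel_mul_mul {p p' : ℝ} (hpp : p.HolderConjugate p') {K f g : G → ℝ}
    (hK : Integrable K μ) (hf : MemLp f (ENNReal.ofReal p) μ)
    (hg : MemLp g (ENNReal.ofReal p') μ) :
    Integrable (fun x : G × G => K x.2 * f (x.1 * x.2) * g x.1) (μ.prod μ) := by
  have hm : AEStronglyMeasurable (fun x : G × G => K x.2 * f (x.1 * x.2) * g x.1) (μ.prod μ) :=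
    (aestronglyMeasurable_kernel_mul hK.1 hf.1).mul hg.1.comp_fst
  refine ⟨hm, ?_⟩
  rw [HasFiniteIntegral, lintegral_prod_symm _ hm.enorm]
  calc ∫⁻ m, ∫⁻ z, ‖K m * f (z * m) * g z‖ₑ ∂μ ∂μ
      ≤ ∫⁻ m, ‖K m‖ₑ * (eLpNorm f (ENNReal.ofReal p) μ * eLpNorm g (ENNReal.ofReal p') μ) ∂μ := by
        refine lintegral_mono fun m => ?_
        simp only [enorm_mul, mul_assoc]
        have hft : AEStronglyMeasurable (fun z => f (z * m)) μ := hf.1.comp_quasiMeasurePreserving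
          (measurePreserving_mul_right μ m).quasiMeasurePreserving
        rw [lintegral_const_mul' _ _ enorm_ne_top]
        gcongr
        refine (ENNReal.lintegral_mul_le_Lp_mul_Lq μ hpp hft.enorm hg.1.enorm).trans ?_
        rw [eLpNorm_ofReal_eq hpp.pos, eLpNorm_ofReal_eq hpp.symm.pos,
          lintegral_mul_right_eq_self (fun z => ‖f z‖ₑ ^ p) m]
    _ = _ := lintegral_mul_const'' _ hK.1.enorm
    _ < ∞ := ENNReal.mul_lt_top hK.2 (ENNReal.mul_lt_top hf.2 hg.2)

theorem integral_rconv_mul_eq {p p' : ℝ} (hpp : p.HolderConjugate p') {K f g : G → ℝ}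
    (hK : Integrable K μ) (hf : MemLp f (ENNReal.ofReal p) μ)
    (hg : MemLp g (ENNReal.ofReal p') μ) :
    ∫ z, rconv μ K f z * g z ∂μ = ∫ m, K m * ∫ z, f (z * m) * g z ∂μ ∂μ := by
  have := integral_integral_swap (f := fun z m => K m * f (z * m) * g z)
    (integrable_kernel_mul_mul hpp hK hf hg)
  simp only [integral_mul_const] at this
  rw [show (fun z => rconv μ K f z * g z) = fun z => (∫ m, K m * f (z * m) ∂μ) * g z from rfl, this]
  simp only [mul_assoc, integral_const_mul]

theorem integral_rconv_mul_eq_integral_mul_rconv {p p' : ℝ} (hpp : p.HolderConjugate p')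
    {K f g : G → ℝ} (hK : Integrable K μ) (hf : MemLp f (ENNReal.ofReal p) μ)
    (hg : MemLp g (ENNReal.ofReal p') μ) :
    ∫ z, rconv μ K f z * g z ∂μ = ∫ z, f z * rconv μ (fun m => K m⁻¹) g z ∂μ := by
  simp_rw [mul_comm (f _)]
  rw [integral_rconv_mul_eq hpp hK hf hg, integral_rconv_mul_eq hpp.symm hK.comp_inv hg hf,
    ← integral_inv_eq_self _ μ]
  congr 1; ext m; congr 1
  rw [← integral_mul_right_eq_self _ m]
  simp [mul_comm]

end GroupConvolution

section RegularRep

variable {G : Type*} [Group G] [TopologicalSpace G] [IsTopologicalGroup G] [MeasurableSpace G]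
  [BorelSpace G] [SecondCountableTopology G] {μ : Measure G} [SigmaFinite μ]
  [μ.IsMulLeftInvariant] [μ.IsMulRightInvariant] [μ.IsInvInvariant]
  [IsLocallyFiniteMeasure μ] [μ.InnerRegularCompactLTTop]

/-- The right regular representation on `L²`. -/
def rightRegular (μ : Measure G) [μ.IsMulRightInvariant] (m : G) : Lp ℝ 2 μ →L[ℝ] Lp ℝ 2 μ :=
  (Lp.compMeasurePreservingₗᵢ ℝ (· * m) (measurePreserving_mul_right μ m)).toContinuousLinearMap

theorem coeFn_rightRegular (m : G) (F : Lp ℝ 2 μ) :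
    rightRegular μ m F =ᵐ[μ] fun z => F (z * m) :=
  Lp.coeFn_compMeasurePreserving F (measurePreserving_mul_right μ m)

theorem isUnitaryRep_rightRegular : IsUnitaryRep (rightRegular μ) where
  norm_map m F := LinearIsometry.norm_map _ _
  map_mul m n F := by
    refine Lp.ext ?_
    have h := (measurePreserving_mul_right μ m).quasiMeasurePreserving.ae
      (coeFn_rightRegular n F)
    filter_upwards [coeFn_rightRegular (m * n) F, coeFn_rightRegular m (rightRegular μ n F), h]
      with z h1 h2 h3
    rw [h1, h2, h3, mul_assoc]
  map_one F := by
    refine Lp.ext ?_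
    filter_upwards [coeFn_rightRegular 1 F] with z h1
    rw [h1, mul_one]
  continuous F := by
    let g : G → C(G, G) := fun m => ⟨fun z => z * m, by fun_prop⟩
    have hg : Continuous g := by
      let g' : C(G × G, G) := ⟨fun x => x.2 * x.1, by fun_prop⟩
      exact g'.curry.continuous
    exact (continuous_const (y := F)).compMeasurePreservingLp hg
      (fun m => measurePreserving_mul_right μ m) (by norm_num)

theorem integrated_toLp_eq {K f : G → ℝ} (hK : Integrable K μ) (hf : MemLp f 2 μ)
    (hKf : MemLp (rconv μ K f) 2 μ) :
    (isUnitaryRep_rightRegular (μ := μ)).integrated hK (hf.toLp f) = hKf.toLp _ := by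
  refine ext_inner_right ℝ fun g => ?_
  rw [IsUnitaryRep.integrated_apply, real_inner_comm, ← integral_inner
    (isUnitaryRep_rightRegular.integrable_smul hK _), L2.inner_def]
  have h2 : (ENNReal.ofReal 2) = 2 := by simp
  have h := integral_rconv_mul_eq (μ := μ) Real.HolderConjugate.two_two hK (h2.symm ▸ hf)
    (g := g) (by rw [h2]; exact Lp.memLp g)
  trans ∫ z, rconv μ K f z * g z ∂μ
  · rw [h]
    congr 1; ext m
    rw [inner_smul_right, L2.inner_def]
    congr 1
    refine integral_congr_ae ?_
    have h3 := (measurePreserving_mul_right μ m).quasiMeasurePreserving.ae (hf.coeFn_toLp)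
    filter_upwards [coeFn_rightRegular m (hf.toLp f), h3] with z h1 h3
    rw [h1, h3]
    simp
  · refine integral_congr_ae ?_
    filter_upwards [hKf.coeFn_toLp] with z hz
    rw [hz]
    simp [mul_comm]

theorem rconv_sum_ae {p : ℝ} (hp : 1 ≤ p) {ι : Type*} {κ : ι → G → ℝ} {f : G → ℝ}
    (hκ : ∀ j, Integrable (κ j) μ)
    (hf : MemLp f (ENNReal.ofReal p) μ) (s : Finset ι) :
    rconv μ (fun m => ∑ j ∈ s, κ j m) f =ᵐ[μ] fun z => ∑ j ∈ s, rconv μ (κ j) f z := by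
  have h : ∀ j ∈ s, ∀ᵐ z ∂μ, Integrable (fun m => κ j m * f (z * m)) μ := fun j _ =>
    ae_integrable_kernel_mul hp (hκ j) hf
  rw [← Finset.eventually_all] at h
  filter_upwards [h] with z hz
  simp only [rconv, Finset.sum_mul]
  exact integral_finsetSum s hz

theorem eLpNorm_two_rconv_sum_le {ε : ℝ} {M : ℝ} (hM0 : 0 < M)
    (hM : ∀ x : ℝ, 0 < x → ∀ s : Finset ℤ,
      ∑ j ∈ s, min ((x / 2 ^ j) ^ (ε / 2)) ((2 ^ j / x) ^ (ε / 2)) ≤ M) {N : G → ℝ}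
    (hN : ∀ m, N m⁻¹ = N m) (hN0 : ∀ m, 0 ≤ N m) {C : ℝ} (hC : 0 < C)
    {κ : ℤ → G → ℝ} (hκ : IsDyadicKernel μ N ε C κ) (s : Finset ℤ) {f : G → ℝ}
    (hf : MemLp f 2 μ) :
    eLpNorm (rconv μ (fun m => ∑ j ∈ s, κ j m) f) 2 μ ≤ ENNReal.ofReal (C * M) * eLpNorm f 2 μ := by
  have h2 : (ENNReal.ofReal 2) = 2 := by simp
  have hf' : MemLp f (ENNReal.ofReal 2) μ := h2 ▸ hf
  have hr : ∀ j, MemLp (rconv μ (κ j) f) 2 μ := fun j =>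
    h2 ▸ memLp_rconv (by norm_num) (hκ.integrable j) hf'
  have hU := isUnitaryRep_rightRegular (μ := μ)
  have hn := (∑ j ∈ s, hU.integrated (hκ.integrable j)).le_of_opNorm_le
    (hU.norm_sum_integrated_le hM0 hM hN hN0 hC hκ s) (hf.toLp f)
  have e : (∑ j ∈ s, hU.integrated (hκ.integrable j)) (hf.toLp f) =
      (memLp_finsetSum s fun j _ => hr j).toLp _ := by
    rw [_root_.sum_apply]
    simp only [integrated_toLp_eq _ hf (hr _)]
    refine Lp.ext ?_
    have h : ∀ j ∈ s, ∀ᵐ z ∂μ, (hr j).toLp _ z = rconv μ (κ j) f z := fun j _ => (hr j).coeFn_toLp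
    rw [← Finset.eventually_all] at h
    filter_upwards [Lp.coeFn_fun_finsetSum s fun j => (hr j).toLp _,
      (memLp_finsetSum s fun j _ => hr j).coeFn_toLp, h] with z h1 h3 h4
    rw [h1, h3]
    exact Finset.sum_congr rfl h4
  rw [e, Lp.norm_toLp, Lp.norm_toLp] at hn
  rw [eLpNorm_congr_ae (rconv_sum_ae (by norm_num) hκ.integrable hf' s),
    ← ENNReal.ofReal_toReal (memLp_finsetSum s fun j _ => hr j).2.ne,
    ← ENNReal.ofReal_toReal hf.2.ne, ← ENNReal.ofReal_mul (by positivity)]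
  exact ENNReal.ofReal_le_ofReal hn

end RegularRep

section CZKernel

variable {G : Type*} [Group G] [TopologicalSpace G] [IsTopologicalGroup G] [MeasurableSpace G]
  [BorelSpace G] [SecondCountableTopology G]

/-- A homogeneous gauge on `G`: a symmetric subadditive length function generating the topology,
whose balls of radius `r` have measure `c * r ^ Q`. -/
structure IsGauge (μ : Measure G) (N : G → ℝ) (c Q : ℝ) : Prop where
  continuous : Continuous N
  nonneg : ∀ m, 0 ≤ N m
  one : N 1 = 0
  inv : ∀ m, N m⁻¹ = N m
  mul_le : ∀ m n, N (m * n) ≤ N m + N n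
  nhds : ∀ U ∈ nhds (1 : G), ∃ r > 0, {m | N m < r} ⊆ U
  measure_ball : ∀ r > 0, μ {m | N m < r} = ENNReal.ofReal (c * r ^ Q)
  c_pos : 0 < c
  Q_pos : 0 < Q

/-- A Calderón–Zygmund kernel: an integrable kernel, together with a bound `A` for its
`L²`-operator norm and for its Hörmander integrals. -/
structure IsCZKernel (μ : Measure G) (N : G → ℝ) (A : ℝ) (K : G → ℝ) : Prop where
  integrable : Integrable K μ
  eLpNorm_two_le : ∀ f, MemLp f 2 μ → eLpNorm (rconv μ K f) 2 μ ≤ ENNReal.ofReal A * eLpNorm f 2 μ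
  hormander : ∀ h, ∫⁻ u in {u | 2 * N h ≤ N u}, ‖K (u * h) - K u‖ₑ ∂μ ≤ ENNReal.ofReal A

variable {μ : Measure G} [SigmaFinite μ]
  [μ.IsMulLeftInvariant] [μ.IsMulRightInvariant] [μ.IsInvInvariant]

theorem IsDyadicKernel.setLIntegral_le {N : G → ℝ} {c Q : ℝ} (hN : IsGauge μ N c Q)
    {ε C : ℝ} (hε : 0 < ε) (hC : 0 < C) {κ : ℤ → G → ℝ} (hκ : IsDyadicKernel μ N ε C κ)
    {r : ℝ} (hr : 0 < r) (j : ℤ) :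
    ∫⁻ u in {u | r ≤ N u}, ‖κ j u‖ₑ ∂μ ≤ ENNReal.ofReal (C * (2 ^ j / r) ^ ε) := by
  have hms : MeasurableSet {u | r ≤ N u} := measurableSet_le measurable_const
    hN.continuous.measurable
  calc ∫⁻ u in {u | r ≤ N u}, ‖κ j u‖ₑ ∂μ
      ≤ ∫⁻ u in {u | r ≤ N u}, ENNReal.ofReal ((r ^ ε)⁻¹) *
          (‖κ j u‖ₑ * ENNReal.ofReal (N u ^ ε)) ∂μ := by
        refine setLIntegral_mono' hms fun u hu => ?_
        have h1 : 1 ≤ ENNReal.ofReal ((r ^ ε)⁻¹) * ENNReal.ofReal (N u ^ ε) := by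
          rw [← ENNReal.ofReal_mul (by positivity), ENNReal.one_le_ofReal, inv_mul_eq_div,
            one_le_div (by positivity)]
          exact Real.rpow_le_rpow hr.le hu hε.le
        calc ‖κ j u‖ₑ = ‖κ j u‖ₑ * 1 := (mul_one _).symm
          _ ≤ ‖κ j u‖ₑ * (ENNReal.ofReal ((r ^ ε)⁻¹) * ENNReal.ofReal (N u ^ ε)) := by gcongr
          _ = _ := by ring
    _ = ENNReal.ofReal ((r ^ ε)⁻¹) *
          ∫⁻ u in {u | r ≤ N u}, (‖κ j u‖ₑ * ENNReal.ofReal (N u ^ ε)) ∂μ :=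
        lintegral_const_mul' _ _ ofReal_ne_top
    _ ≤ ENNReal.ofReal ((r ^ ε)⁻¹) * ENNReal.ofReal (C * ((2 : ℝ) ^ j) ^ ε) := by
        gcongr
        exact (setLIntegral_le_lintegral _ _).trans (hκ.moment_le j)
    _ = _ := by
        rw [← ENNReal.ofReal_mul (by positivity), Real.div_rpow (by positivity) hr.le]
        congr 1; field_simp

theorem IsDyadicKernel.hormander_term_le {N : G → ℝ} {c Q : ℝ} (hN : IsGauge μ N c Q)
    {ε C : ℝ} (hε : 0 < ε) (hC : 0 < C) {κ : ℤ → G → ℝ} (hκ : IsDyadicKernel μ N ε C κ)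
    {h : G} (hh : 0 < N h) (j : ℤ) :
    ∫⁻ u in {u | 2 * N h ≤ N u}, ‖κ j (u * h) - κ j u‖ₑ ∂μ ≤
      ENNReal.ofReal (2 * C * min ((N h / 2 ^ j) ^ ε) ((2 ^ j / N h) ^ ε)) := by
  rw [mul_min_of_nonneg _ _ (by positivity), ENNReal.ofReal_mono.map_min]
  refine le_min ?_ ?_
  · refine (setLIntegral_le_lintegral _ _).trans ((hκ.right_le j h).trans ?_)
    refine ENNReal.ofReal_le_ofReal ?_
    have : 0 ≤ C * (N h / 2 ^ j) ^ ε := by positivity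
    linarith
  · have hms : MeasurableSet {u | N h ≤ N u} := measurableSet_le measurable_const
      hN.continuous.measurable
    have hms' : MeasurableSet {u | 2 * N h ≤ N u} := measurableSet_le measurable_const
      hN.continuous.measurable
    have hb := hκ.setLIntegral_le hN hε hC hh j
    calc ∫⁻ u in {u | 2 * N h ≤ N u}, ‖κ j (u * h) - κ j u‖ₑ ∂μ
        ≤ ∫⁻ u in {u | 2 * N h ≤ N u}, ‖κ j (u * h)‖ₑ + ‖κ j u‖ₑ ∂μ :=
          lintegral_mono fun u => by simpa [sub_eq_add_neg] using enorm_add_le (κ j (u * h)) (-κ j u)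
      _ = ∫⁻ u in {u | 2 * N h ≤ N u}, ‖κ j (u * h)‖ₑ ∂μ +
            ∫⁻ u in {u | 2 * N h ≤ N u}, ‖κ j u‖ₑ ∂μ :=
          lintegral_add_right' _ (hκ.integrable j).1.enorm.restrict
      _ ≤ ENNReal.ofReal (C * (2 ^ j / N h) ^ ε) + ENNReal.ofReal (C * (2 ^ j / N h) ^ ε) := by
          refine add_le_add ?_ ((lintegral_mono_set fun u hu => ?_).trans hb)
          · rw [← lintegral_indicator hms] at hb
            rw [← lintegral_mul_right_eq_self _ h] at hb
            rw [← lintegral_indicator hms']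
            refine (lintegral_mono fun u => ?_).trans hb
            refine Set.indicator_apply_le' (fun hu => ?_) (fun _ => zero_le)
            have hu' : 2 * N h ≤ N u := hu
            have h3 : N u ≤ N (u * h) + N h := by
              simpa [hN.inv] using hN.mul_le (u * h) h⁻¹
            have h2 : u * h ∈ {u | N h ≤ N u} := by
              change N h ≤ N (u * h)
              linarith
            rw [Set.indicator_of_mem h2]
          · have : 2 * N h ≤ N u := hu
            change N h ≤ N u
            linarith
      _ = _ := by
          rw [← ENNReal.ofReal_add (by positivity) (by positivity)]; congr 1; ring

theorem exists_isCZKernel_sum [IsLocallyFiniteMeasure μ] [μ.InnerRegularCompactLTTop]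
    {N : G → ℝ} {c Q : ℝ} (hN : IsGauge μ N c Q) {ε C : ℝ} (hε : 0 < ε) (hC : 0 < C) :
    ∃ A : ℝ, 0 < A ∧ ∀ κ : ℤ → G → ℝ, IsDyadicKernel μ N ε C κ → ∀ s : Finset ℤ,
      IsCZKernel μ N A (fun m => ∑ j ∈ s, κ j m) := by
  obtain ⟨M, hM0, hM⟩ := exists_sum_min_rpow_le (half_pos hε)
  obtain ⟨M', hM0', hM'⟩ := exists_sum_min_rpow_le hε
  refine ⟨max (C * M) (2 * C * M'), by positivity, fun κ hκ s => ⟨?_, fun f hf => ?_, fun h => ?_⟩⟩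
  · exact integrable_finsetSum s fun j _ => hκ.integrable j
  · refine (eLpNorm_two_rconv_sum_le hM0 hM hN.inv hN.nonneg hC hκ s hf).trans ?_
    gcongr
    exact le_max_left _ _
  · refine le_trans ?_ (ENNReal.ofReal_le_ofReal (le_max_right _ _))
    have hsum : ∫⁻ u in {u | 2 * N h ≤ N u}, ‖∑ j ∈ s, κ j (u * h) - ∑ j ∈ s, κ j u‖ₑ ∂μ ≤
        ∑ j ∈ s, ∫⁻ u in {u | 2 * N h ≤ N u}, ‖κ j (u * h) - κ j u‖ₑ ∂μ := by
      rw [← lintegral_finsetSum']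
      · refine lintegral_mono fun u => ?_
        rw [← Finset.sum_sub_distrib]
        exact enorm_sum_le _ _
      · intro j _
        exact (((hκ.integrable j).1.comp_quasiMeasurePreserving
          (measurePreserving_mul_right μ h).quasiMeasurePreserving).sub
            (hκ.integrable j).1).enorm.restrict
    refine hsum.trans ?_
    rcases (hN.nonneg h).eq_or_lt with h0 | h0
    · refine (Finset.sum_le_sum fun j _ =>
        (setLIntegral_le_lintegral _ _).trans (hκ.right_le j h)).trans ?_
      simp [← h0, Real.zero_rpow hε.ne']
    · refine (Finset.sum_le_sum fun j _ => hκ.hormander_term_le hN hε hC h0 j).trans ?_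
      rw [← ENNReal.ofReal_sum_of_nonneg fun j _ => by positivity, ← Finset.mul_sum]
      refine ENNReal.ofReal_le_ofReal ?_
      gcongr
      exact hM' (N h) h0 s

end CZKernel

section WeakType

variable {G : Type*} [Group G] [TopologicalSpace G] [IsTopologicalGroup G] [MeasurableSpace G]
  [BorelSpace G] [SecondCountableTopology G]
  {μ : Measure G} [SigmaFinite μ]
  [μ.IsMulLeftInvariant] [μ.IsMulRightInvariant] [μ.IsInvInvariant]
  {N : G → ℝ} {c Q : ℝ}

/-- The left-invariant ball of the gauge `N`. -/
def gball (N : G → ℝ) (z : G) (r : ℝ) : Set G := {y | N (z⁻¹ * y) < r}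

theorem IsGauge.isOpen_gball (hN : IsGauge μ N c Q) (z : G) (r : ℝ) : IsOpen (gball N z r) :=
  isOpen_lt (hN.continuous.comp (continuous_const.mul continuous_id)) continuous_const

theorem IsGauge.measurableSet_gball (hN : IsGauge μ N c Q) (z : G) (r : ℝ) :
    MeasurableSet (gball N z r) := (hN.isOpen_gball z r).measurableSet

theorem IsGauge.self_mem_gball (hN : IsGauge μ N c Q) (z : G) {r : ℝ} (hr : 0 < r) :
    z ∈ gball N z r := by simpa [gball, hN.one] using hr

theorem IsGauge.measure_gball (hN : IsGauge μ N c Q) (z : G) {r : ℝ} (hr : 0 < r) :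
    μ (gball N z r) = ENNReal.ofReal (c * r ^ Q) := by
  rw [← hN.measure_ball r hr]
  exact measure_preimage_mul μ z⁻¹ {m | N m < r}

theorem lintegral_inv_mul_eq (F : G → ℝ≥0∞) (y : G) : ∫⁻ z, F (z⁻¹ * y) ∂μ = ∫⁻ u, F u ∂μ := by
  rw [lintegral_inv_eq_self (fun z => F (z * y)), lintegral_mul_right_eq_self]

theorem IsCZKernel.lintegral_atom_le (hN : IsGauge μ N c Q) {A : ℝ} {K : G → ℝ}
    (hK : IsCZKernel μ N A K) {b : G → ℝ} (hb : Integrable b μ) (hb0 : ∫ y, b y ∂μ = 0)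
    {y₀ : G} {ρ : ℝ} (hsupp : ∀ y, b y ≠ 0 → y ∈ gball N y₀ ρ) :
    ∫⁻ z in (gball N y₀ (2 * ρ))ᶜ, ‖rconv μ K b z‖ₑ ∂μ ≤
      ENNReal.ofReal A * ∫⁻ y, ‖b y‖ₑ ∂μ := by
  have hb1 : MemLp b (ENNReal.ofReal 1) μ := by simpa using memLp_one_iff_integrable.mpr hb
  have hS := (hN.measurableSet_gball y₀ (2 * ρ)).compl
  have hpt : ∀ᵐ z ∂μ, ‖rconv μ K b z‖ₑ ≤ ∫⁻ y, ‖K (z⁻¹ * y) - K (z⁻¹ * y₀)‖ₑ * ‖b y‖ₑ ∂μ := by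
    filter_upwards [ae_integrable_kernel_mul le_rfl hK.integrable hb1] with z hz
    have e1 : rconv μ K b z = ∫ y, K (z⁻¹ * y) * b y ∂μ := by
      rw [← integral_mul_left_eq_self _ z]; simp [rconv]
    have hz' : Integrable (fun y => K (z⁻¹ * y) * b y) μ := by
      simpa using hz.comp_mul_left z⁻¹
    have e2 : rconv μ K b z = ∫ y, (K (z⁻¹ * y) - K (z⁻¹ * y₀)) * b y ∂μ := by
      simp only [sub_mul]
      rw [integral_sub hz' (hb.const_mul _), integral_const_mul, hb0, mul_zero, sub_zero, e1]
    rw [e2]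
    refine (enorm_integral_le_lintegral_enorm _).trans (le_of_eq ?_)
    simp only [enorm_mul]
  have hj : AEMeasurable (Function.uncurry fun z y => ‖K (z⁻¹ * y) - K (z⁻¹ * y₀)‖ₑ * ‖b y‖ₑ)
      ((μ.restrict (gball N y₀ (2 * ρ))ᶜ).prod μ) := by
    have q1 : Measure.QuasiMeasurePreserving (fun x : G × G => x.1⁻¹ * x.2) (μ.prod μ) μ :=
      (Measure.quasiMeasurePreserving_snd (μ := μ) (ν := μ)).comp
        (measurePreserving_prod_inv_mul μ μ).quasiMeasurePreserving
    have q2 : Measure.QuasiMeasurePreserving (fun z : G => z⁻¹ * y₀) μ μ :=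
      (measurePreserving_mul_right μ y₀).quasiMeasurePreserving.comp
        (Measure.measurePreserving_inv μ).quasiMeasurePreserving
    have m1 : AEStronglyMeasurable (fun x : G × G => K (x.1⁻¹ * x.2)) (μ.prod μ) :=
      hK.integrable.1.comp_quasiMeasurePreserving q1
    have m2 : AEStronglyMeasurable (fun x : G × G => K (x.1⁻¹ * y₀)) (μ.prod μ) :=
      (hK.integrable.1.comp_quasiMeasurePreserving q2).comp_fst
    have := (m1.sub m2).enorm.mul hb.1.enorm.comp_snd
    refine this.mono_ac ?_
    exact (Measure.absolutelyContinuous_of_le Measure.restrict_le_self).prod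
      Measure.AbsolutelyContinuous.rfl
  calc ∫⁻ z in (gball N y₀ (2 * ρ))ᶜ, ‖rconv μ K b z‖ₑ ∂μ
      ≤ ∫⁻ z in (gball N y₀ (2 * ρ))ᶜ, ∫⁻ y, ‖K (z⁻¹ * y) - K (z⁻¹ * y₀)‖ₑ * ‖b y‖ₑ ∂μ ∂μ :=
        lintegral_mono_ae (ae_restrict_of_ae hpt)
    _ = ∫⁻ y, ∫⁻ z in (gball N y₀ (2 * ρ))ᶜ, ‖K (z⁻¹ * y) - K (z⁻¹ * y₀)‖ₑ * ‖b y‖ₑ ∂μ ∂μ :=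
        lintegral_lintegral_swap hj
    _ ≤ ∫⁻ y, ENNReal.ofReal A * ‖b y‖ₑ ∂μ := by
        refine lintegral_mono fun y => ?_
        by_cases hy : b y = 0
        · simp [hy]
        rw [lintegral_mul_const' _ _ enorm_ne_top]
        gcongr
        have hy' : N (y₀⁻¹ * y) < ρ := hsupp y hy
        have hms : MeasurableSet {u | 2 * N (y₀⁻¹ * y) ≤ N u} :=
          measurableSet_le measurable_const hN.continuous.measurable
        refine le_trans ?_ (hK.hormander (y₀⁻¹ * y))
        rw [← lintegral_indicator hS, ← lintegral_indicator hms]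
        conv_rhs => rw [← lintegral_inv_mul_eq _ y₀]
        refine lintegral_mono fun z => ?_
        refine Set.indicator_apply_le' (fun hz => ?_) (fun _ => zero_le)
        have hz' : 2 * ρ ≤ N (z⁻¹ * y₀) := by
          have : 2 * ρ ≤ N (y₀⁻¹ * z) := not_lt.mp hz
          rw [← hN.inv]; simpa using this
        have hz2 : z⁻¹ * y₀ ∈ {u | 2 * N (y₀⁻¹ * y) ≤ N u} := by
          change 2 * N (y₀⁻¹ * y) ≤ N (z⁻¹ * y₀)
          linarith
        rw [Set.indicator_of_mem hz2]
        simp [mul_assoc]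
    _ = _ := lintegral_const_mul' _ _ ofReal_ne_top

end WeakType

section WeakType

variable {G : Type*} [Group G] [TopologicalSpace G] [IsTopologicalGroup G] [MeasurableSpace G]
  [BorelSpace G] [SecondCountableTopology G]
  {μ : Measure G} [SigmaFinite μ]
  [μ.IsMulLeftInvariant] [μ.IsMulRightInvariant] [μ.IsInvInvariant]
  {N : G → ℝ} {c Q : ℝ}

theorem IsGauge.exists_stopping_scale (hN : IsGauge μ N c Q) {f : G → ℝ} (hf : Continuous f)
    (hfi : Integrable f μ) {α : ℝ} (hα : 0 < α) {z : G} (hz : α < |f z|) :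
    ∃ k : ℤ, ENNReal.ofReal α * μ (gball N z (2 ^ k)) ≤ ∫⁻ y in gball N z (2 ^ k), ‖f y‖ₑ ∂μ ∧
      ∀ l, k < l →
        ∫⁻ y in gball N z (2 ^ l), ‖f y‖ₑ ∂μ ≤ ENNReal.ofReal α * μ (gball N z (2 ^ l)) := by
  have hQ := hN.Q_pos
  have hc := hN.c_pos
  have bdd : ∃ n : ℤ, ∀ k : ℤ, ENNReal.ofReal α * μ (gball N z (2 ^ k)) ≤
      ∫⁻ y in gball N z (2 ^ k), ‖f y‖ₑ ∂μ → k ≤ n := by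
    have ht : Filter.Tendsto (fun n : ℕ => α * (c * ((2 : ℝ) ^ n) ^ Q)) Filter.atTop
        Filter.atTop :=
      ((tendsto_rpow_atTop hQ).comp
        (tendsto_pow_atTop_atTop_of_one_lt one_lt_two)).const_mul_atTop hc |>.const_mul_atTop hα
    obtain ⟨n, hn⟩ := (ht.eventually_gt_atTop (∫⁻ y, ‖f y‖ₑ ∂μ).toReal).exists
    refine ⟨n, fun k hk => ?_⟩
    by_contra hcon
    have hkn : (n : ℤ) ≤ k := by omega
    have h1 : ENNReal.ofReal (α * (c * ((2 : ℝ) ^ n) ^ Q)) ≤ ∫⁻ y, ‖f y‖ₑ ∂μ := by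
      calc ENNReal.ofReal (α * (c * ((2 : ℝ) ^ n) ^ Q))
          ≤ ENNReal.ofReal (α * (c * ((2 : ℝ) ^ k) ^ Q)) := by
            refine ENNReal.ofReal_le_ofReal ?_
            have : (2 : ℝ) ^ n ≤ 2 ^ k := by
              rw [← zpow_natCast]; exact zpow_le_zpow_right₀ one_le_two hkn
            gcongr
        _ = ENNReal.ofReal α * μ (gball N z (2 ^ k)) := by
            rw [hN.measure_gball z (by positivity), ENNReal.ofReal_mul hα.le]
        _ ≤ _ := hk.trans (setLIntegral_le_lintegral _ _)
    rw [ENNReal.ofReal_le_iff_le_toReal hfi.2.ne] at h1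
    linarith
  have ne : ∃ k : ℤ, ENNReal.ofReal α * μ (gball N z (2 ^ k)) ≤
      ∫⁻ y in gball N z (2 ^ k), ‖f y‖ₑ ∂μ := by
    have hU : {m | α < |f (z * m)|} ∈ _root_.nhds (1 : G) :=
      (isOpen_lt continuous_const ((hf.comp (continuous_const.mul continuous_id)).abs)).mem_nhds
        (by simpa using hz)
    obtain ⟨r, hr, hrU⟩ := hN.nhds _ hU
    obtain ⟨k, hk⟩ := exists_mem_Ico_zpow hr one_lt_two
    refine ⟨k, ?_⟩
    rw [← setLIntegral_const]
    refine setLIntegral_mono' (hN.measurableSet_gball _ _) fun y hy => ?_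
    have : α < |f (z * (z⁻¹ * y))| := hrU (show N (z⁻¹ * y) < r from lt_of_lt_of_le hy hk.1)
    rw [mul_inv_cancel_left] at this
    rw [← ofReal_norm, Real.norm_eq_abs]
    exact ENNReal.ofReal_le_ofReal this.le
  obtain ⟨k, hk1, hk2⟩ := Int.exists_greatest_of_bdd bdd ne
  refine ⟨k, hk1, fun l hl => ?_⟩
  by_contra hcon
  exact absurd (hk2 l (not_le.mp hcon).le) (by omega)

theorem IsGauge.exists_cz_covering (hN : IsGauge μ N c Q) {f : G → ℝ} (hf : Continuous f)
    (hfc : HasCompactSupport f) (hfi : Integrable f μ) {α : ℝ} (hα : 0 < α) :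
    ∃ (t : Finset G) (r : G → ℝ), (∀ i, 0 < r i) ∧
      (t : Set G).PairwiseDisjoint (fun i => gball N i (r i)) ∧
      (∀ y, 2 * α ≤ |f y| → ∃ i ∈ t, y ∈ gball N i (8 * r i)) ∧
      (∀ i ∈ t, ENNReal.ofReal α * μ (gball N i (r i)) ≤ ∫⁻ y in gball N i (r i), ‖f y‖ₑ ∂μ) ∧
      (∀ i ∈ t, ∫⁻ y in gball N i (8 * r i), ‖f y‖ₑ ∂μ ≤
        ENNReal.ofReal α * μ (gball N i (8 * r i))) := by
  set S : Set G := {y | 2 * α ≤ |f y|} with hS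
  have hScl : IsClosed S := isClosed_le continuous_const hf.abs
  have hScomp : IsCompact S := by
    refine hfc.isCompact.of_isClosed_subset hScl fun y (hy : 2 * α ≤ |f y|) => subset_tsupport _ ?_
    intro h0
    rw [h0, abs_zero] at hy
    linarith
  have hex : ∀ z, ∃ k : ℤ, z ∈ S →
      (ENNReal.ofReal α * μ (gball N z (2 ^ k)) ≤ ∫⁻ y in gball N z (2 ^ k), ‖f y‖ₑ ∂μ ∧
      ∀ l, k < l →
        ∫⁻ y in gball N z (2 ^ l), ‖f y‖ₑ ∂μ ≤ ENNReal.ofReal α * μ (gball N z (2 ^ l))) := by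
    intro z
    by_cases hz : z ∈ S
    · obtain ⟨k, hk⟩ := hN.exists_stopping_scale hf hfi hα (z := z)
        (by have : 2 * α ≤ |f z| := hz; linarith)
      exact ⟨k, fun _ => hk⟩
    · exact ⟨0, fun h => absurd h hz⟩
  choose k hk using hex
  have hr : ∀ i, (0 : ℝ) < 2 ^ k i := fun i => by positivity
  obtain ⟨t₀, ht₀S, ht₀⟩ := hScomp.elim_nhds_subcover (fun z => gball N z (2 ^ k z))
    fun z _ => (hN.isOpen_gball _ _).mem_nhds (hN.self_mem_gball z (hr z))
  obtain ⟨u, hut, hdisj, hcov⟩ := Vitali.exists_disjoint_subfamily_covering_enlargement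
    (fun z => gball N z (2 ^ k z)) (t₀ : Set G) (fun z => (2 : ℝ) ^ k z) 2 one_lt_two
    (fun z _ => (hr z).le) (∑ z ∈ t₀, (2 : ℝ) ^ k z)
    (fun z hz => Finset.single_le_sum (f := fun z => (2 : ℝ) ^ k z) (fun i _ => (hr i).le) hz)
    (fun z _ => ⟨z, hN.self_mem_gball z (hr z)⟩)
  have hufin : u.Finite := t₀.finite_toSet.subset hut
  have huS : ∀ i ∈ hufin.toFinset, i ∈ S := fun i hi =>
    ht₀S i (hut (hufin.mem_toFinset.mp hi))
  refine ⟨hufin.toFinset, fun i => 2 ^ k i, hr, by simpa using hdisj, fun y hy => ?_,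
    fun i hi => (hk i (huS i hi)).1, fun i hi => ?_⟩
  · obtain ⟨a, ha, hya⟩ := Set.mem_iUnion₂.mp (ht₀ hy)
    obtain ⟨b, hb, ⟨x, hxa, hxb⟩, hab⟩ := hcov a ha
    refine ⟨b, hufin.mem_toFinset.mpr hb, ?_⟩
    have h1 : N (a⁻¹ * y) < 2 ^ k a := hya
    have h2 : N (a⁻¹ * x) < 2 ^ k a := hxa
    have h3 : N (b⁻¹ * x) < 2 ^ k b := hxb
    have h4 : N (b⁻¹ * y) ≤ N (b⁻¹ * x) + (N (a⁻¹ * x) + N (a⁻¹ * y)) := by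
      have e : b⁻¹ * y = (b⁻¹ * x) * ((a⁻¹ * x)⁻¹ * (a⁻¹ * y)) := by group
      rw [e]
      refine (hN.mul_le _ _).trans ?_
      gcongr
      refine (hN.mul_le _ _).trans ?_
      rw [hN.inv]
    change N (b⁻¹ * y) < 8 * 2 ^ k b
    have := hr b
    linarith
  · have := (hk i (huS i hi)).2 (k i + 3) (by omega)
    have e : (2 : ℝ) ^ (k i + 3) = 8 * 2 ^ k i := by
      rw [zpow_add₀ (by norm_num)]; norm_num; ring
    rwa [e] at this

end WeakType

theorem meas_le_abs_le {α : Type*} [MeasurableSpace α] {μ : Measure α} {p : ℝ} (hp : 0 < p)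
    {h : α → ℝ} (hh : AEStronglyMeasurable h μ) {l : ℝ} (hl : 0 < l) :
    μ {x | l ≤ |h x|} ≤ ENNReal.ofReal ((l ^ p)⁻¹) * ∫⁻ x, ‖h x‖ₑ ^ p ∂μ := by
  have h1 := meas_ge_le_lintegral_div (μ := μ) (hh.enorm.pow_const p)
    (ε := ENNReal.ofReal (l ^ p)) (by simpa using by positivity) ofReal_ne_top
  rw [ENNReal.ofReal_inv_of_pos (by positivity), mul_comm, ← div_eq_mul_inv]
  refine (measure_mono fun x hx => ?_).trans h1
  change ENNReal.ofReal (l ^ p) ≤ ‖h x‖ₑ ^ p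
  rw [← ofReal_norm, ENNReal.ofReal_rpow_of_nonneg (norm_nonneg _) hp.le]
  exact ENNReal.ofReal_le_ofReal (Real.rpow_le_rpow hl.le hx hp.le)

section WeakType

variable {G : Type*} [Group G] [TopologicalSpace G] [IsTopologicalGroup G] [MeasurableSpace G]
  [BorelSpace G] [SecondCountableTopology G]
  {μ : Measure G} [SigmaFinite μ]
  [μ.IsMulLeftInvariant] [μ.IsMulRightInvariant] [μ.IsInvInvariant]
  {N : G → ℝ} {c Q : ℝ}

theorem rconv_add_ae {p q : ℝ} (hp : 1 ≤ p) (hq : 1 ≤ q) {K f g : G → ℝ} (hK : Integrable K μ)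
    (hf : MemLp f (ENNReal.ofReal p) μ) (hg : MemLp g (ENNReal.ofReal q) μ) :
    rconv μ K (fun y => f y + g y) =ᵐ[μ] fun z => rconv μ K f z + rconv μ K g z := by
  filter_upwards [ae_integrable_kernel_mul hp hK hf, ae_integrable_kernel_mul hq hK hg]
    with z h1 h2
  simp only [rconv, mul_add]
  exact integral_add h1 h2

theorem rconv_finsetSum_ae {p : ℝ} (hp : 1 ≤ p) {ι : Type*} {K : G → ℝ} {f : ι → G → ℝ}
    (hK : Integrable K μ) {s : Finset ι}
    (hf : ∀ i ∈ s, MemLp (f i) (ENNReal.ofReal p) μ) :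
    rconv μ K (fun y => ∑ i ∈ s, f i y) =ᵐ[μ] fun z => ∑ i ∈ s, rconv μ K (f i) z := by
  have h : ∀ j ∈ s, ∀ᵐ z ∂μ, Integrable (fun m => K m * f j (z * m)) μ := fun j hj =>
    ae_integrable_kernel_mul hp hK (hf j hj)
  rw [← Finset.eventually_all] at h
  filter_upwards [h] with z hz
  simp only [rconv, Finset.mul_sum]
  exact integral_finsetSum s hz

/-- The Calderón–Zygmund decomposition at height `α`. -/
theorem IsGauge.exists_cz_decomposition (hN : IsGauge μ N c Q) {f : G → ℝ} (hf : Continuous f)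
    (hfc : HasCompactSupport f) (hfi : Integrable f μ) {α : ℝ} (hα : 0 < α) :
    ∃ (t : Finset G) (r : G → ℝ) (b : G → G → ℝ) (g : G → ℝ), (∀ i, 0 < r i) ∧
      (∀ i ∈ t, Integrable (b i) μ) ∧ (∀ i ∈ t, ∫ y, b i y ∂μ = 0) ∧
      (∀ i ∈ t, ∀ y, b i y ≠ 0 → y ∈ gball N i (8 * r i)) ∧
      (∑ i ∈ t, ∫⁻ y, ‖b i y‖ₑ ∂μ ≤ 2 * ∫⁻ y, ‖f y‖ₑ ∂μ) ∧
      Integrable g μ ∧ (∫⁻ y, ‖g y‖ₑ ∂μ ≤ 3 * ∫⁻ y, ‖f y‖ₑ ∂μ) ∧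
      (∀ y, |g y| ≤ (2 + 8 ^ Q) * α) ∧
      (∀ y, f y = g y + ∑ i ∈ t, b i y) ∧
      (ENNReal.ofReal α * ∑ i ∈ t, ENNReal.ofReal (c * r i ^ Q) ≤ ∫⁻ y, ‖f y‖ₑ ∂μ) := by
  have hQ := hN.Q_pos
  have hc := hN.c_pos
  obtain ⟨t, r, hr, hdisj, hcov, hlow, hup⟩ := hN.exists_cz_covering hf hfc hfi hα
  have hmE : ∀ i, MeasurableSet (gball N i (8 * r i)) := fun i => hN.measurableSet_gball _ _
  have hmB : ∀ i, MeasurableSet (gball N i (r i)) := fun i => hN.measurableSet_gball _ _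
  have hBE : ∀ i, gball N i (r i) ⊆ gball N i (8 * r i) := fun i y (hy : N (i⁻¹ * y) < r i) => by
    change N (i⁻¹ * y) < 8 * r i
    have := hr i
    linarith
  set n : G → ℝ := fun y => ∑ i ∈ t, (gball N i (8 * r i)).indicator 1 y with hn
  have hnm : Measurable n := Finset.measurable_sum _ fun i _ => measurable_one.indicator (hmE i)
  have hind : ∀ i y, 0 ≤ (gball N i (8 * r i)).indicator (1 : G → ℝ) y := fun i y =>
    Set.indicator_nonneg (fun _ _ => zero_le_one) y
  have hn1 : ∀ i ∈ t, ∀ y ∈ gball N i (8 * r i), 1 ≤ n y := fun i hi y hy => by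
    have : (gball N i (8 * r i)).indicator (1 : G → ℝ) y ≤ n y :=
      Finset.single_le_sum (f := fun i => (gball N i (8 * r i)).indicator (1 : G → ℝ) y)
        (fun j _ => hind j y) hi
    rwa [Set.indicator_of_mem hy] at this
  set w : G → G → ℝ := fun i y => (gball N i (8 * r i)).indicator 1 y * (n y)⁻¹ with hw
  have hwm : ∀ i, Measurable (w i) := fun i => (measurable_one.indicator (hmE i)).mul hnm.inv
  have hn0 : ∀ y, 0 ≤ n y := fun y => Finset.sum_nonneg fun j _ => hind j y
  have hw0 : ∀ i y, 0 ≤ w i y := fun i y => mul_nonneg (hind i y) (inv_nonneg.mpr (hn0 y))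
  have hWsum : ∀ y, ∑ i ∈ t, w i y = n y * (n y)⁻¹ := fun y => by
    simp only [hw, ← Finset.sum_mul, hn]
  have hW1 : ∀ y, ∑ i ∈ t, w i y ≤ 1 := fun y => by
    rw [hWsum]; exact mul_inv_le_one
  have hwE : ∀ i y, y ∉ gball N i (8 * r i) → w i y = 0 := fun i y hy => by
    simp [hw, Set.indicator_of_notMem hy]
  have hw1 : ∀ i ∈ t, ∀ y, w i y ≤ 1 := fun i hi y =>
    (Finset.single_le_sum (f := fun i => w i y) (fun j _ => hw0 j y) hi).trans (hW1 y)
  have hfwi : ∀ i ∈ t, Integrable (fun y => f y * w i y) μ := fun i hi =>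
    hfi.mul_bdd (c := 1) (hwm i).aestronglyMeasurable (Filter.Eventually.of_forall fun y => by
      rw [Real.norm_eq_abs, abs_of_nonneg (hw0 i y)]; exact hw1 i hi y)
  have hFsum : ∑ i ∈ t, ∫⁻ y, ‖f y * w i y‖ₑ ∂μ ≤ ∫⁻ y, ‖f y‖ₑ ∂μ := by
    rw [← lintegral_finsetSum' _ fun i hi => (hfwi i hi).1.enorm]
    refine lintegral_mono fun y => ?_
    simp only [enorm_mul, ← Finset.mul_sum]
    refine mul_le_of_le_one_right' ?_
    simp only [Real.enorm_of_nonneg (hw0 _ y)]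
    rw [← ENNReal.ofReal_sum_of_nonneg fun i _ => hw0 i y]
    exact ENNReal.ofReal_le_one.mpr (hW1 y)
  have hFup : ∀ i ∈ t, ∫⁻ y, ‖f y * w i y‖ₑ ∂μ ≤ ENNReal.ofReal (α * (c * (8 * r i) ^ Q)) := by
    intro i hi
    have h8 : 0 < 8 * r i := by have := hr i; positivity
    rw [ENNReal.ofReal_mul hα.le, ← hN.measure_gball i h8]
    refine le_trans ?_ (hup i hi)
    rw [← lintegral_indicator (hmE i)]
    refine lintegral_mono fun y => ?_
    by_cases hy : y ∈ gball N i (8 * r i)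
    · rw [Set.indicator_of_mem hy, enorm_mul]
      refine mul_le_of_le_one_right' ?_
      rw [Real.enorm_of_nonneg (hw0 _ y)]
      exact ENNReal.ofReal_le_one.mpr (hw1 i hi y)
    · simp [hwE i y hy]
  set β : G → ℝ := fun i => (∫ y, f y * w i y ∂μ) / (c * r i ^ Q) with hβ
  have hcr : ∀ i, 0 < c * r i ^ Q := fun i => by have := hr i; positivity
  have hβe : ∀ i, ‖β i‖ₑ * ENNReal.ofReal (c * r i ^ Q) ≤ ∫⁻ y, ‖f y * w i y‖ₑ ∂μ := by
    intro i
    refine le_trans (le_of_eq ?_) (enorm_integral_le_lintegral_enorm _)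
    rw [← Real.enorm_of_nonneg (hcr i).le, ← enorm_mul, hβ, div_mul_cancel₀ _ (hcr i).ne']
  have hβb : ∀ i ∈ t, |β i| ≤ 8 ^ Q * α := by
    intro i hi
    have h1 := (hβe i).trans (hFup i hi)
    rw [← ofReal_norm, ← ENNReal.ofReal_mul (norm_nonneg _), ENNReal.ofReal_le_ofReal_iff
      (by have := hr i; positivity), Real.norm_eq_abs, Real.mul_rpow (by norm_num) (hr i).le] at h1
    refine le_of_mul_le_mul_right (h1.trans (le_of_eq ?_)) (hcr i)
    ring
  set b : G → G → ℝ := fun i y => f y * w i y - (gball N i (r i)).indicator (fun _ => β i) y with hb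
  have hBfin : ∀ i, μ (gball N i (r i)) ≠ ∞ := fun i => by
    rw [hN.measure_gball i (hr i)]; exact ofReal_ne_top
  have hβi : ∀ i, Integrable ((gball N i (r i)).indicator (fun _ => β i)) μ := fun i =>
    (integrable_indicator_iff (hmB i)).mpr (integrableOn_const (hBfin i))
  have hbi : ∀ i ∈ t, Integrable (b i) μ := fun i hi => (hfwi i hi).sub (hβi i)
  have hbn : ∀ i ∈ t, ∫⁻ y, ‖b i y‖ₑ ∂μ ≤ 2 * ∫⁻ y, ‖f y * w i y‖ₑ ∂μ := by
    intro i hi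
    calc ∫⁻ y, ‖b i y‖ₑ ∂μ
        ≤ ∫⁻ y, ‖f y * w i y‖ₑ + ‖(gball N i (r i)).indicator (fun _ => β i) y‖ₑ ∂μ :=
          lintegral_mono fun y => enorm_sub_le
      _ = ∫⁻ y, ‖f y * w i y‖ₑ ∂μ +
            ∫⁻ y, ‖(gball N i (r i)).indicator (fun _ => β i) y‖ₑ ∂μ :=
          lintegral_add_left' (hfwi i hi).1.enorm _
      _ ≤ _ := by
          rw [two_mul]
          refine add_le_add le_rfl ?_
          simp only [enorm_indicator_eq_indicator_enorm]
          rw [lintegral_indicator (hmB i), setLIntegral_const, hN.measure_gball i (hr i)]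
          exact hβe i
  have hbsum : ∑ i ∈ t, ∫⁻ y, ‖b i y‖ₑ ∂μ ≤ 2 * ∫⁻ y, ‖f y‖ₑ ∂μ := by
    refine (Finset.sum_le_sum hbn).trans ?_
    rw [← Finset.mul_sum]
    gcongr
  have hbsi : Integrable (fun y => ∑ i ∈ t, b i y) μ := integrable_finsetSum _ hbi
  refine ⟨t, r, b, fun y => f y - ∑ i ∈ t, b i y, hr, hbi, fun i hi => ?_, fun i hi y hy => ?_,
    hbsum, hfi.sub hbsi, ?_, fun y => ?_, fun y => by ring, ?_⟩
  · simp only [hb]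
    rw [integral_sub (hfwi i hi) (hβi i), integral_indicator (hmB i), setIntegral_const,
      Measure.real, hN.measure_gball i (hr i), ENNReal.toReal_ofReal (hcr i).le, smul_eq_mul, hβ,
      mul_div_cancel₀ _ (hcr i).ne', sub_self]
  · by_contra hcon
    exact hy (by simp [hb, hwE i y hcon, Set.indicator_of_notMem fun h => hcon (hBE i h)])
  · calc ∫⁻ y, ‖f y - ∑ i ∈ t, b i y‖ₑ ∂μ ≤ ∫⁻ y, ‖f y‖ₑ + ∑ i ∈ t, ‖b i y‖ₑ ∂μ :=
          lintegral_mono fun y => enorm_sub_le.trans (add_le_add le_rfl (enorm_sum_le _ _))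
      _ = ∫⁻ y, ‖f y‖ₑ ∂μ + ∑ i ∈ t, ∫⁻ y, ‖b i y‖ₑ ∂μ := by
          rw [lintegral_add_left' hfi.1.enorm, lintegral_finsetSum' _ fun i hi => (hbi i hi).1.enorm]
      _ ≤ ∫⁻ y, ‖f y‖ₑ ∂μ + 2 * ∫⁻ y, ‖f y‖ₑ ∂μ := by gcongr
      _ = _ := by ring
  · have e : f y - ∑ i ∈ t, b i y = f y * (1 - ∑ i ∈ t, w i y) +
        ∑ i ∈ t, (gball N i (r i)).indicator (fun _ => β i) y := by
      simp only [hb, Finset.sum_sub_distrib, ← Finset.mul_sum]; ring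
    have h1 : |f y * (1 - ∑ i ∈ t, w i y)| ≤ 2 * α := by
      rcases lt_or_ge |f y| (2 * α) with h | h
      · rw [abs_mul, abs_of_nonneg (sub_nonneg.mpr (hW1 y))]
        have : 0 ≤ ∑ i ∈ t, w i y := Finset.sum_nonneg fun i _ => hw0 i y
        calc |f y| * (1 - ∑ i ∈ t, w i y) ≤ |f y| * 1 := by gcongr; linarith
          _ ≤ _ := by linarith
      · obtain ⟨i, hi, hyi⟩ := hcov y h
        have := hn1 i hi y hyi
        rw [hWsum, mul_inv_cancel₀ (by linarith), sub_self, mul_zero, abs_zero]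
        positivity
    have h2 : |∑ i ∈ t, (gball N i (r i)).indicator (fun _ => β i) y| ≤ 8 ^ Q * α := by
      by_cases hex : ∃ i ∈ t, y ∈ gball N i (r i)
      · obtain ⟨i, hi, hyi⟩ := hex
        rw [Finset.sum_eq_single_of_mem i hi, Set.indicator_of_mem hyi]
        · exact hβb i hi
        · intro j hj hji
          refine Set.indicator_of_notMem (fun hyj => ?_) _
          exact Set.disjoint_left.mp (hdisj hj hi hji) hyj hyi
      · push Not at hex
        rw [Finset.sum_eq_zero fun i hi => Set.indicator_of_notMem (hex i hi) _, abs_zero]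
        positivity
    change |f y - ∑ i ∈ t, b i y| ≤ _
    rw [e]
    exact (abs_add_le _ _).trans (by linarith)
  · rw [Finset.mul_sum]
    calc ∑ i ∈ t, ENNReal.ofReal α * ENNReal.ofReal (c * r i ^ Q)
        ≤ ∑ i ∈ t, ∫⁻ y in gball N i (r i), ‖f y‖ₑ ∂μ := by
          refine Finset.sum_le_sum fun i hi => ?_
          rw [← hN.measure_gball i (hr i)]
          exact hlow i hi
      _ = ∫⁻ y in ⋃ i ∈ t, gball N i (r i), ‖f y‖ₑ ∂μ :=
          (lintegral_biUnion_finset hdisj (fun i _ => hmB i) _).symm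
      _ ≤ _ := setLIntegral_le_lintegral _ _

end WeakType

section WeakType

variable {G : Type*} [Group G] [TopologicalSpace G] [IsTopologicalGroup G] [MeasurableSpace G]
  [BorelSpace G] [SecondCountableTopology G]
  {μ : Measure G} [SigmaFinite μ]
  [μ.IsMulLeftInvariant] [μ.IsMulRightInvariant] [μ.IsInvInvariant]
  {N : G → ℝ} {c Q : ℝ}

theorem memLp_two_of_bounded {g : G → ℝ} (hg : Integrable g μ) {M : ℝ}
    (hM : ∀ y, |g y| ≤ M) :
    MemLp g 2 μ ∧ ∫⁻ y, ‖g y‖ₑ ^ (2 : ℝ) ∂μ ≤ ENNReal.ofReal M * ∫⁻ y, ‖g y‖ₑ ∂μ := by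
  have h : ∫⁻ y, ‖g y‖ₑ ^ (2 : ℝ) ∂μ ≤ ENNReal.ofReal M * ∫⁻ y, ‖g y‖ₑ ∂μ := by
    rw [← lintegral_const_mul'' _ hg.1.enorm]
    refine lintegral_mono fun y => ?_
    rw [ENNReal.rpow_two, sq]
    gcongr
    rw [← ofReal_norm]
    exact ENNReal.ofReal_le_ofReal (hM y)
  refine ⟨⟨hg.1, ?_⟩, h⟩
  have e := eLpNorm_rpow_eq (ν := μ) (p := 2) (by norm_num) g
  rw [ENNReal.ofReal_ofNat] at e
  have h3 : eLpNorm g 2 μ ^ (2 : ℝ) < ∞ := by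
    rw [e]
    exact h.trans_lt (ENNReal.mul_lt_top ofReal_lt_top hg.2)
  exact (ENNReal.rpow_lt_top_iff_of_pos (by norm_num)).mp h3

/-- Calderón–Zygmund operators are of weak type `(1,1)`. -/
theorem IsGauge.exists_weak_type (hN : IsGauge μ N c Q) {A : ℝ} (hA : 0 < A) :
    ∃ B > 0, ∀ K, IsCZKernel μ N A K → ∀ f : G → ℝ, Continuous f → HasCompactSupport f →
      Integrable f μ → ∀ α > 0,
      μ {z | α ≤ |rconv μ K f z|} ≤ ENNReal.ofReal (B / α) * ∫⁻ y, ‖f y‖ₑ ∂μ := by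
  refine ⟨4 * A ^ 2 * ((2 + 8 ^ Q) * 3) + 16 ^ Q + 2 * A * 2, by positivity,
    fun K hK f hf hfc hfi α hα => ?_⟩
  have hQ := hN.Q_pos
  have hc := hN.c_pos
  obtain ⟨t, r, b, g, hr, hbi, hb0, hbs, hbsum, hgi, hg1, hgb, hfe, hrs⟩ :=
    hN.exists_cz_decomposition hf hfc hfi hα
  set I := ∫⁻ y, ‖f y‖ₑ ∂μ with hI
  set Ω : Set G := ⋃ i ∈ t, gball N i (2 * (8 * r i)) with hΩ
  have hΩm : MeasurableSet Ω := t.measurableSet_biUnion fun i _ => hN.measurableSet_gball _ _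
  have hb1 : ∀ i ∈ t, MemLp (b i) (ENNReal.ofReal 1) μ := fun i hi => by
    simpa using memLp_one_iff_integrable.mpr (hbi i hi)
  have hbS1 : MemLp (fun y => ∑ i ∈ t, b i y) (ENNReal.ofReal 1) μ := by
    simpa using memLp_one_iff_integrable.mpr (integrable_finsetSum _ hbi)
  have hg1' : MemLp g (ENNReal.ofReal 1) μ := by
    simpa using memLp_one_iff_integrable.mpr hgi
  obtain ⟨hg2, hg2'⟩ := memLp_two_of_bounded hgi hgb
  have hG := hK.eLpNorm_two_le g hg2
  have hTgm := aestronglyMeasurable_rconv hK.integrable.1 hgi.1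
  have e1 : rconv μ K f =ᵐ[μ] fun z => rconv μ K g z + ∑ i ∈ t, rconv μ K (b i) z := by
    rw [show f = fun y => g y + ∑ i ∈ t, b i y from funext hfe]
    filter_upwards [rconv_add_ae le_rfl le_rfl hK.integrable hg1' hbS1,
      rconv_finsetSum_ae le_rfl hK.integrable hb1] with z h1 h2
    rw [h1, h2]
  have hsub : μ {z | α ≤ |rconv μ K f z|} ≤ μ {z | α / 2 ≤ |rconv μ K g z|} + μ Ω +
      (μ.restrict Ωᶜ) {z | α / 2 ≤ |∑ i ∈ t, rconv μ K (b i) z|} := by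
    rw [Measure.restrict_apply' hΩm.compl]
    refine le_trans ?_ (add_le_add (measure_union_le _ _) le_rfl)
    refine le_trans ?_ (measure_union_le _ _)
    refine measure_mono_ae ?_
    filter_upwards [e1] with z hz (hα' : α ≤ |rconv μ K f z|)
    rw [hz] at hα'
    by_cases h1 : α / 2 ≤ |rconv μ K g z|
    · exact Or.inl (Or.inl h1)
    by_cases h2 : z ∈ Ω
    · exact Or.inl (Or.inr h2)
    refine Or.inr ⟨?_, h2⟩
    change α / 2 ≤ _
    have := hα'.trans (abs_add_le _ _)
    linarith
  have hg : μ {z | α / 2 ≤ |rconv μ K g z|} ≤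
      ENNReal.ofReal (4 * A ^ 2 * ((2 + 8 ^ Q) * 3) / α) * I := by
    refine (meas_le_abs_le (p := 2) (by norm_num) hTgm (by positivity)).trans ?_
    have e := eLpNorm_rpow_eq (ν := μ) (p := 2) (by norm_num) (rconv μ K g)
    have e' := eLpNorm_rpow_eq (ν := μ) (p := 2) (by norm_num) g
    rw [ENNReal.ofReal_ofNat] at e e'
    rw [← e]
    calc _ ≤ ENNReal.ofReal (((α / 2) ^ (2 : ℝ))⁻¹) *
          (ENNReal.ofReal A * eLpNorm g 2 μ) ^ (2 : ℝ) := by gcongr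
      _ = ENNReal.ofReal (((α / 2) ^ (2 : ℝ))⁻¹) *
          (ENNReal.ofReal (A ^ (2 : ℝ)) * ∫⁻ y, ‖g y‖ₑ ^ (2 : ℝ) ∂μ) := by
        rw [ENNReal.mul_rpow_of_nonneg _ _ (by norm_num), e',
          ENNReal.ofReal_rpow_of_pos hA]
      _ ≤ ENNReal.ofReal (((α / 2) ^ (2 : ℝ))⁻¹) *
          (ENNReal.ofReal (A ^ (2 : ℝ)) *
            (ENNReal.ofReal ((2 + 8 ^ Q) * α) * (ENNReal.ofReal 3 * I))) := by
        gcongr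
        refine hg2'.trans ?_
        gcongr
        simpa using hg1
      _ = _ := by
        simp only [← mul_assoc]
        rw [← ENNReal.ofReal_mul (by positivity), ← ENNReal.ofReal_mul (by positivity),
          ← ENNReal.ofReal_mul (by positivity)]
        congr 2
        rw [Real.rpow_two, Real.rpow_two]
        field_simp
        ring
  have hΩ' : μ Ω ≤ ENNReal.ofReal (16 ^ Q / α) * I := by
    refine (measure_biUnion_finset_le t _).trans ?_
    calc ∑ i ∈ t, μ (gball N i (2 * (8 * r i)))
        = ∑ i ∈ t, ENNReal.ofReal (16 ^ Q / α) *
            (ENNReal.ofReal α * ENNReal.ofReal (c * r i ^ Q)) := by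
          refine Finset.sum_congr rfl fun i _ => ?_
          have hri := hr i
          rw [hN.measure_gball i (by positivity), ← ENNReal.ofReal_mul (by positivity),
            ← ENNReal.ofReal_mul (by positivity), show 2 * (8 * r i) = 16 * r i by ring,
            Real.mul_rpow (by norm_num) hri.le]
          congr 1
          field_simp
      _ = ENNReal.ofReal (16 ^ Q / α) *
            (ENNReal.ofReal α * ∑ i ∈ t, ENNReal.ofReal (c * r i ^ Q)) := by
          rw [Finset.mul_sum, Finset.mul_sum]
      _ ≤ _ := by gcongr
  have hb : (μ.restrict Ωᶜ) {z | α / 2 ≤ |∑ i ∈ t, rconv μ K (b i) z|} ≤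
      ENNReal.ofReal (2 * A * 2 / α) * I := by
    have hm : ∀ i ∈ t, AEStronglyMeasurable (rconv μ K (b i)) μ := fun i hi =>
      aestronglyMeasurable_rconv hK.integrable.1 (hbi i hi).1
    refine (meas_le_abs_le (p := 1) one_pos
      (Finset.aestronglyMeasurable_fun_sum _ fun i hi => (hm i hi).restrict)
      (by positivity)).trans ?_
    simp only [Real.rpow_one, ENNReal.rpow_one]
    calc _ ≤ ENNReal.ofReal ((α / 2)⁻¹) *
          ∫⁻ z in Ωᶜ, ∑ i ∈ t, ‖rconv μ K (b i) z‖ₑ ∂μ := by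
          gcongr
          exact enorm_sum_le _ _
      _ = ENNReal.ofReal ((α / 2)⁻¹) *
          ∑ i ∈ t, ∫⁻ z in Ωᶜ, ‖rconv μ K (b i) z‖ₑ ∂μ := by
          rw [lintegral_finsetSum' _ fun i hi => (hm i hi).enorm.restrict]
      _ ≤ ENNReal.ofReal ((α / 2)⁻¹) * ∑ i ∈ t, ENNReal.ofReal A * ∫⁻ y, ‖b i y‖ₑ ∂μ := by
          gcongr with i hi
          refine le_trans (lintegral_mono_set ?_)
            (hK.lintegral_atom_le hN (hbi i hi) (hb0 i hi) (hbs i hi))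
          exact Set.compl_subset_compl.mpr (Set.subset_biUnion_of_mem (u := fun i =>
            gball N i (2 * (8 * r i))) hi)
      _ ≤ ENNReal.ofReal ((α / 2)⁻¹) * (ENNReal.ofReal A * (ENNReal.ofReal 2 * I)) := by
          rw [← Finset.mul_sum]
          gcongr
          simpa using hbsum
      _ = _ := by
        simp only [← mul_assoc]
        rw [← ENNReal.ofReal_mul (by positivity), ← ENNReal.ofReal_mul (by positivity)]
        congr 2
        field_simp
  refine hsub.trans ((add_le_add (add_le_add hg hΩ') hb).trans (le_of_eq ?_))
  rw [← add_mul, ← add_mul, ← ENNReal.ofReal_add (by positivity) (by positivity),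
    ← ENNReal.ofReal_add (by positivity) (by positivity)]
  congr 2
  ring

end WeakType

theorem lintegral_Ioc_zero_rpow {s a : ℝ} (hs : -1 < s) (ha : 0 ≤ a) :
    ∫⁻ l in Set.Ioc 0 a, ENNReal.ofReal (l ^ s) = ENNReal.ofReal (a ^ (s + 1) / (s + 1)) := by
  have h := intervalIntegral.intervalIntegrable_rpow' (a := 0) (b := a) hs
  rw [intervalIntegrable_iff_integrableOn_Ioc_of_le ha] at h
  rw [← ofReal_integral_eq_lintegral_ofReal h, ← intervalIntegral.integral_of_le ha,
    integral_rpow (Or.inl hs), Real.zero_rpow (by linarith), sub_zero]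
  filter_upwards [ae_restrict_mem measurableSet_Ioc] with l hl
  exact Real.rpow_nonneg hl.1.le _

theorem lintegral_Ioi_rpow {s a : ℝ} (hs : s < -1) (ha : 0 < a) :
    ∫⁻ l in Set.Ioi a, ENNReal.ofReal (l ^ s) = ENNReal.ofReal (a ^ (s + 1) / (-(s + 1))) := by
  have h := integrableOn_Ioi_rpow_of_lt hs ha
  rw [← ofReal_integral_eq_lintegral_ofReal h, integral_Ioi_rpow_of_lt hs ha, neg_div, div_neg]
  filter_upwards [ae_restrict_mem measurableSet_Ioi] with l hl
  exact Real.rpow_nonneg (ha.trans hl).le _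

/-- Integration of a distributional inequality. -/
theorem lintegral_enorm_rpow_le_of_meas_le {α β : Type*} [MeasurableSpace α] [MeasurableSpace β]
    {μ : Measure α} {ν : Measure β} [SFinite ν] {p : ℝ} (hp : 0 < p) {h : α → ℝ}
    (hh : AEMeasurable h μ) {φ : ℝ → β → ℝ≥0∞}
    (hφ : AEMeasurable (Function.uncurry φ) ((volume.restrict (Set.Ioi 0)).prod ν))
    (hle : ∀ l > 0, μ {x | l ≤ |h x|} ≤ ∫⁻ y, φ l y ∂ν) {Ψ : β → ℝ≥0∞}
    (hΨ : ∀ y, ∫⁻ l in Set.Ioi 0, φ l y * ENNReal.ofReal (l ^ (p - 1)) ≤ Ψ y) :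
    ∫⁻ x, ‖h x‖ₑ ^ p ∂μ ≤ ENNReal.ofReal p * ∫⁻ y, Ψ y ∂ν := by
  have hm : Measurable fun l : ℝ => ENNReal.ofReal (l ^ (p - 1)) := by fun_prop
  have e : ∀ x, ‖h x‖ₑ ^ p = ENNReal.ofReal (|h x| ^ p) := fun x => by
    rw [← ofReal_norm, ENNReal.ofReal_rpow_of_nonneg (norm_nonneg _) hp.le, Real.norm_eq_abs]
  simp only [e]
  rw [lintegral_rpow_eq_lintegral_meas_le_mul μ (Filter.Eventually.of_forall fun x => abs_nonneg _)
    (measurable_norm.comp_aemeasurable hh) hp]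
  gcongr
  calc ∫⁻ l in Set.Ioi 0, μ {x | l ≤ |h x|} * ENNReal.ofReal (l ^ (p - 1))
      ≤ ∫⁻ l in Set.Ioi 0, (∫⁻ y, φ l y ∂ν) * ENNReal.ofReal (l ^ (p - 1)) := by
        refine setLIntegral_mono' measurableSet_Ioi fun l hl => ?_
        gcongr
        exact hle l hl
    _ = ∫⁻ l in Set.Ioi 0, ∫⁻ y, φ l y * ENNReal.ofReal (l ^ (p - 1)) ∂ν := by
        refine lintegral_congr fun l => ?_
        rw [lintegral_mul_const' _ _ ofReal_ne_top]
    _ = ∫⁻ y, (∫⁻ l in Set.Ioi 0, φ l y * ENNReal.ofReal (l ^ (p - 1))) ∂ν :=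
        lintegral_lintegral_swap (f := fun l y => φ l y * ENNReal.ofReal (l ^ (p - 1)))
          (hφ.mul (hm.comp measurable_fst).aemeasurable)
    _ ≤ _ := lintegral_mono hΨ

/-- The kernel of the Marcinkiewicz interpolation between weak `(1,1)` and `(2,2)`. -/
theorem lintegral_marcinkiewicz_le {B D p : ℝ} (hB : 0 ≤ B) (hD : 0 ≤ D) (hp : 1 < p) (hp2 : p < 2)
    (y : ℝ) :
    ∫⁻ l in Set.Ioi 0, ENNReal.ofReal (B / l * |y - max (-l) (min l y)| +
        D / l ^ 2 * (max (-l) (min l y)) ^ 2) * ENNReal.ofReal (l ^ (p - 1)) ≤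
      ENNReal.ofReal ((B + D) / (p - 1) + D / (2 - p)) * ENNReal.ofReal (|y| ^ p) := by
  rcases eq_or_ne y 0 with rfl | hy
  · refine le_trans (le_of_eq ?_) zero_le
    rw [lintegral_eq_zero_iff' ?_]
    · filter_upwards [ae_restrict_mem measurableSet_Ioi] with l hl
      have hl : 0 < l := hl
      simp [hl.le]
    · refine Measurable.aemeasurable ?_
      fun_prop
  have hy' : 0 < |y| := abs_pos.mpr hy
  have hcl : ∀ l, 0 < l → |max (-l) (min l y)| ≤ l ∧ |max (-l) (min l y)| ≤ |y| ∧
      |y - max (-l) (min l y)| ≤ |y| ∧ (|y| ≤ l → y - max (-l) (min l y) = 0) := by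
    intro l hl
    rcases le_total l y with h | h
    · rw [min_eq_left h, max_eq_right (by linarith), abs_of_pos hl, abs_of_pos (hl.trans_le h),
        abs_of_nonneg (by linarith)]
      exact ⟨le_rfl, h, by linarith, fun h' => by linarith⟩
    · rw [min_eq_right h]
      rcases le_total (-l) y with h1 | h1
      · rw [max_eq_right h1]
        exact ⟨abs_le.mpr ⟨h1, h⟩, le_rfl, by simp, fun _ => by simp⟩
      · rw [max_eq_left h1, abs_neg, abs_of_pos hl, abs_of_nonpos (by linarith : y ≤ 0),
          abs_of_nonpos (by linarith : y - -l ≤ 0)]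
        exact ⟨le_rfl, by linarith, by linarith, fun h' => by linarith⟩
  rw [← Set.Ioc_union_Ioi_eq_Ioi hy'.le, lintegral_union measurableSet_Ioi
    (Set.disjoint_left.mpr fun x h1 h2 => not_lt.mpr h1.2 h2)]
  have h1 : ∫⁻ l in Set.Ioc 0 |y|, ENNReal.ofReal (B / l * |y - max (-l) (min l y)| +
        D / l ^ 2 * (max (-l) (min l y)) ^ 2) * ENNReal.ofReal (l ^ (p - 1)) ≤
      ENNReal.ofReal ((B + D) / (p - 1)) * ENNReal.ofReal (|y| ^ p) := by
    calc _ ≤ ∫⁻ l in Set.Ioc 0 |y|, ENNReal.ofReal ((B + D) * |y|) * ENNReal.ofReal (l ^ (p - 2)) := by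
          refine setLIntegral_mono' measurableSet_Ioc fun l hl => ?_
          have hl0 := hl.1
          obtain ⟨c1, c2, c3, c4⟩ := hcl l hl0
          rw [← ENNReal.ofReal_mul (by positivity), ← ENNReal.ofReal_mul (by positivity)]
          refine ENNReal.ofReal_le_ofReal ?_
          rw [show p - 1 = (p - 2) + 1 by ring, Real.rpow_add_one hl0.ne']
          have e : (B / l * |y - max (-l) (min l y)| + D / l ^ 2 * (max (-l) (min l y)) ^ 2) * l ≤
              (B + D) * |y| := by
            rw [← sq_abs (max (-l) (min l y))]
            calc _ = B * |y - max (-l) (min l y)| +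
                  D * (|max (-l) (min l y)| / l * |max (-l) (min l y)|) := by field_simp
              _ ≤ B * |y| + D * (1 * |y|) := by
                gcongr
                rwa [div_le_one hl0]
              _ = _ := by ring
          calc _ = ((B / l * |y - max (-l) (min l y)| + D / l ^ 2 * (max (-l) (min l y)) ^ 2) * l) *
                l ^ (p - 2) := by ring
            _ ≤ _ := by gcongr
      _ = _ := by
          rw [lintegral_const_mul' _ _ ofReal_ne_top, lintegral_Ioc_zero_rpow (by linarith) hy'.le,
            ← ENNReal.ofReal_mul (by positivity), ← ENNReal.ofReal_mul
              (div_nonneg (by positivity) (by linarith))]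
          congr 1
          rw [show p - 2 + 1 = p - 1 by ring, show |y| ^ p = |y| ^ (p - 1) * |y| by
            rw [← Real.rpow_add_one hy'.ne']; ring_nf]
          ring
  have h2 : ∫⁻ l in Set.Ioi |y|, ENNReal.ofReal (B / l * |y - max (-l) (min l y)| +
        D / l ^ 2 * (max (-l) (min l y)) ^ 2) * ENNReal.ofReal (l ^ (p - 1)) ≤
      ENNReal.ofReal (D / (2 - p)) * ENNReal.ofReal (|y| ^ p) := by
    calc _ ≤ ∫⁻ l in Set.Ioi |y|, ENNReal.ofReal (D * |y| ^ 2) * ENNReal.ofReal (l ^ (p - 3)) := by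
          refine setLIntegral_mono' measurableSet_Ioi fun l (hl : |y| < l) => ?_
          have hl0 := hy'.trans hl
          obtain ⟨c1, c2, c3, c4⟩ := hcl l hl0
          rw [← ENNReal.ofReal_mul (by positivity), ← ENNReal.ofReal_mul (by positivity)]
          refine ENNReal.ofReal_le_ofReal ?_
          rw [show p - 1 = (p - 3) + (2 : ℕ) by push_cast; ring, Real.rpow_add_natCast hl0.ne',
            c4 hl.le, abs_zero, mul_zero, zero_add, ← sq_abs (max (-l) (min l y))]
          calc _ = D * |max (-l) (min l y)| ^ 2 * l ^ (p - 3) := by field_simp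
            _ ≤ _ := by gcongr
      _ = _ := by
          rw [lintegral_const_mul' _ _ ofReal_ne_top, lintegral_Ioi_rpow (by linarith) hy',
            ← ENNReal.ofReal_mul (by positivity), ← ENNReal.ofReal_mul
              (div_nonneg (by positivity) (by linarith))]
          congr 1
          rw [show p - 3 + 1 = p - 2 by ring, show |y| ^ p = |y| ^ (p - 2) * |y| ^ 2 by
            rw [← Real.rpow_add_natCast hy'.ne']; push_cast; ring_nf]
          ring
  refine (add_le_add h1 h2).trans (le_of_eq ?_)
  rw [← add_mul, ← ENNReal.ofReal_add (div_nonneg (by positivity) (by linarith))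
    (div_nonneg hD (by linarith))]

section StrongType

variable {G : Type*} [Group G] [TopologicalSpace G] [IsTopologicalGroup G] [MeasurableSpace G]
  [BorelSpace G] [SecondCountableTopology G]
  {μ : Measure G} [SigmaFinite μ]
  [μ.IsMulLeftInvariant] [μ.IsMulRightInvariant] [μ.IsInvInvariant]
  [IsLocallyFiniteMeasure μ]
  {N : G → ℝ} {c Q : ℝ}

theorem IsGauge.exists_strong_type (hN : IsGauge μ N c Q) {A : ℝ} (hA : 0 < A) {p : ℝ}
    (hp : 1 < p) (hp2 : p < 2) :
    ∃ C > 0, ∀ K, IsCZKernel μ N A K → ∀ f : G → ℝ, Continuous f → HasCompactSupport f →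
      eLpNorm (rconv μ K f) (ENNReal.ofReal p) μ ≤
        ENNReal.ofReal C * eLpNorm f (ENNReal.ofReal p) μ := by
  obtain ⟨B, hB, hweak⟩ := hN.exists_weak_type (μ := μ) hA
  have hp0 : 0 < p := by linarith
  set M : ℝ := (2 * B + 4 * A ^ 2) / (p - 1) + 4 * A ^ 2 / (2 - p) with hM
  have hM0 : 0 < M := add_pos (div_pos (by positivity) (by linarith))
    (div_pos (by positivity) (by linarith))
  refine ⟨(p * M) ^ (1 / p), by positivity, fun K hK f hf hfc => ?_⟩
  have hTm := aestronglyMeasurable_rconv hK.integrable.1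
    (hf.integrable_of_hasCompactSupport (μ := μ) hfc).1
  set φ : ℝ → G → ℝ≥0∞ := fun l y => ENNReal.ofReal (2 * B / l * |f y - max (-l) (min l (f y))| +
        4 * A ^ 2 / l ^ 2 * (max (-l) (min l (f y))) ^ 2) with hφ
  have key := lintegral_enorm_rpow_le_of_meas_le (μ := μ) (ν := μ) hp0 hTm.aemeasurable (φ := φ)
    (Ψ := fun y => ENNReal.ofReal M * ENNReal.ofReal (|f y| ^ p)) ?_ ?_ ?_
  · rw [← ENNReal.rpow_le_rpow_iff hp0, ENNReal.mul_rpow_of_nonneg _ _ hp0.le,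
      eLpNorm_rpow_eq hp0, eLpNorm_rpow_eq hp0, ENNReal.ofReal_rpow_of_nonneg (by positivity) hp0.le,
      ← Real.rpow_mul (by positivity), one_div_mul_cancel hp0.ne', Real.rpow_one,
      ENNReal.ofReal_mul hp0.le, mul_assoc]
    refine key.trans (le_of_eq ?_)
    rw [lintegral_const_mul' _ _ ofReal_ne_top]
    congr 3
    ext y
    rw [← ofReal_norm, ENNReal.ofReal_rpow_of_nonneg (norm_nonneg _) hp0.le, Real.norm_eq_abs]
  · refine Measurable.aemeasurable ?_
    have := hf.measurable
    simp only [Function.uncurry_def, hφ]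
    fun_prop
  · intro l hl
    set f2 : G → ℝ := fun y => max (-l) (min l (f y)) with hf2
    set f1 : G → ℝ := fun y => f y - f2 y with hf1
    have h2c : Continuous f2 := by fun_prop
    have h1c : Continuous f1 := by fun_prop
    have h2s : HasCompactSupport f2 :=
      hfc.comp_left (g := fun x => max (-l) (min l x)) (by simp [hl.le])
    have h1s : HasCompactSupport f1 :=
      hfc.comp_left (g := fun x => x - max (-l) (min l x)) (by simp [hl.le])
    have h1i := h1c.integrable_of_hasCompactSupport (μ := μ) h1s
    have h1m : MemLp f1 (ENNReal.ofReal 1) μ := h1c.memLp_of_hasCompactSupport h1s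
    have h2m : MemLp f2 (ENNReal.ofReal 2) μ := h2c.memLp_of_hasCompactSupport h2s
    have h2t := hK.eLpNorm_two_le f2 (by simpa using h2m)
    have e : rconv μ K f =ᵐ[μ] fun z => rconv μ K f1 z + rconv μ K f2 z := by
      rw [show f = fun y => f1 y + f2 y from funext fun y => by simp [hf1]]
      exact rconv_add_ae le_rfl one_le_two hK.integrable h1m h2m
    have b2 : μ {z | l / 2 ≤ |rconv μ K f2 z|} ≤
        ENNReal.ofReal (4 * A ^ 2 / l ^ 2) * ∫⁻ y, ENNReal.ofReal (f2 y ^ 2) ∂μ := by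
      refine (meas_le_abs_le (p := 2) (by norm_num)
        (aestronglyMeasurable_rconv hK.integrable.1 h2m.1) (by positivity)).trans ?_
      have e := eLpNorm_rpow_eq (ν := μ) (p := 2) (by norm_num) (rconv μ K f2)
      have e' := eLpNorm_rpow_eq (ν := μ) (p := 2) (by norm_num) f2
      rw [ENNReal.ofReal_ofNat] at e e'
      rw [← e]
      calc _ ≤ ENNReal.ofReal (((l / 2) ^ (2 : ℝ))⁻¹) *
            (ENNReal.ofReal A * eLpNorm f2 2 μ) ^ (2 : ℝ) := by gcongr
        _ = ENNReal.ofReal (((l / 2) ^ (2 : ℝ))⁻¹) *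
            (ENNReal.ofReal (A ^ (2 : ℝ)) * ∫⁻ y, ‖f2 y‖ₑ ^ (2 : ℝ) ∂μ) := by
          rw [ENNReal.mul_rpow_of_nonneg _ _ (by norm_num), e',
            ENNReal.ofReal_rpow_of_pos hA]
        _ = _ := by
          rw [← mul_assoc, ← ENNReal.ofReal_mul (by positivity), Real.rpow_two, Real.rpow_two]
          congr 1
          · congr 1; field_simp; norm_num
          · refine lintegral_congr fun y => ?_
            rw [← ofReal_norm, ENNReal.ofReal_rpow_of_nonneg (norm_nonneg _) (by norm_num),
              Real.norm_eq_abs, Real.rpow_two, sq_abs]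
    have b1 := hweak K hK f1 h1c h1s h1i (l / 2) (by positivity)
    calc μ {z | l ≤ |rconv μ K f z|}
        ≤ μ ({z | l / 2 ≤ |rconv μ K f1 z|} ∪ {z | l / 2 ≤ |rconv μ K f2 z|}) := by
          refine measure_mono_ae ?_
          filter_upwards [e] with z hz (hl' : l ≤ |rconv μ K f z|)
          rw [hz] at hl'
          by_cases h : l / 2 ≤ |rconv μ K f1 z|
          · exact Or.inl h
          · refine Or.inr ?_
            change l / 2 ≤ _
            have := hl'.trans (abs_add_le _ _)
            linarith
      _ ≤ _ := measure_union_le _ _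
      _ ≤ _ := add_le_add b1 b2
      _ = ∫⁻ y, (ENNReal.ofReal (B / (l / 2)) * ‖f1 y‖ₑ +
            ENNReal.ofReal (4 * A ^ 2 / l ^ 2) * ENNReal.ofReal (f2 y ^ 2)) ∂μ := by
          rw [lintegral_add_left' (h1i.1.enorm.const_mul _), lintegral_const_mul' _ _ ofReal_ne_top,
            lintegral_const_mul' _ _ ofReal_ne_top]
      _ = _ := by
          refine lintegral_congr fun y => ?_
          rw [← ofReal_norm, ← ENNReal.ofReal_mul (by positivity), ← ENNReal.ofReal_mul
            (by positivity), ← ENNReal.ofReal_add (by positivity) (by positivity)]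
          simp only [hφ]
          congr 2
          rw [Real.norm_eq_abs]
          field_simp
          rfl
  · intro y
    exact lintegral_marcinkiewicz_le (by positivity) (by positivity) hp hp2 (f y)

theorem eLpNorm_rconv_le_of_continuous [T2Space G] [LocallyCompactSpace G] [μ.Regular]
    {p : ℝ} (hp : 1 ≤ p) {C : ℝ} {K : G → ℝ} (hK : Integrable K μ)
    (h : ∀ f : G → ℝ, Continuous f → HasCompactSupport f →
      eLpNorm (rconv μ K f) (ENNReal.ofReal p) μ ≤
        ENNReal.ofReal C * eLpNorm f (ENNReal.ofReal p) μ)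
    {f : G → ℝ} (hf : MemLp f (ENNReal.ofReal p) μ) :
    eLpNorm (rconv μ K f) (ENNReal.ofReal p) μ ≤
      ENNReal.ofReal C * eLpNorm f (ENNReal.ofReal p) μ := by
  have hp1 : 1 ≤ ENNReal.ofReal p := ENNReal.one_le_ofReal.mpr hp
  set D := ENNReal.ofReal C + ∫⁻ m, ‖K m‖ₑ ∂μ with hD
  have hDt : D ≠ ∞ := ENNReal.add_ne_top.mpr ⟨ofReal_ne_top, hK.2.ne⟩
  have hδ : ∀ δ : ℝ≥0∞, δ ≠ 0 → eLpNorm (rconv μ K f) (ENNReal.ofReal p) μ ≤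
      ENNReal.ofReal C * eLpNorm f (ENNReal.ofReal p) μ + D * δ := by
    intro δ hδ
    obtain ⟨g, hgc, hfg, hg, hgm⟩ := hf.exists_hasCompactSupport_eLpNorm_sub_le ofReal_ne_top hδ
    have e : rconv μ K f =ᵐ[μ] fun z => rconv μ K g z + rconv μ K (f - g) z := by
      conv_lhs => rw [show f = fun y => g y + (f - g) y from funext fun y => by simp]
      exact rconv_add_ae hp hp hK hgm (hf.sub hgm)
    have hgf : eLpNorm g (ENNReal.ofReal p) μ ≤ eLpNorm f (ENNReal.ofReal p) μ + δ := by
      calc eLpNorm g (ENNReal.ofReal p) μ = eLpNorm (f - (f - g)) (ENNReal.ofReal p) μ := by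
            rw [show f - (f - g) = g from funext fun y => by simp]
        _ ≤ _ := eLpNorm_sub_le hf.1 (hf.1.sub hgm.1) hp1
        _ ≤ _ := by gcongr
    calc eLpNorm (rconv μ K f) (ENNReal.ofReal p) μ
        = eLpNorm (rconv μ K g + rconv μ K (f - g)) (ENNReal.ofReal p) μ := eLpNorm_congr_ae e
      _ ≤ eLpNorm (rconv μ K g) (ENNReal.ofReal p) μ +
          eLpNorm (rconv μ K (f - g)) (ENNReal.ofReal p) μ :=
          eLpNorm_add_le (aestronglyMeasurable_rconv hK.1 hgm.1)
            (aestronglyMeasurable_rconv hK.1 (hf.1.sub hgm.1)) hp1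
      _ ≤ ENNReal.ofReal C * (eLpNorm f (ENNReal.ofReal p) μ + δ) +
          (∫⁻ m, ‖K m‖ₑ ∂μ) * δ := by
          gcongr
          · exact (h g hg hgc).trans (by gcongr)
          · exact (eLpNorm_rconv_le hp hK.1 (hf.1.sub hgm.1)).trans (by gcongr)
      _ = _ := by rw [hD]; ring
  refine ENNReal.le_of_forall_pos_le_add fun ε hε _ => ?_
  have hD1 : D + 1 ≠ ∞ := by simp [hDt]
  refine (hδ (ε / (D + 1)) ?_).trans ?_
  · exact (ENNReal.div_pos (by exact_mod_cast hε.ne') hD1).ne'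
  · gcongr
    calc D * (ε / (D + 1)) ≤ (D + 1) * (ε / (D + 1)) := by gcongr; exact le_self_add
      _ = ε := ENNReal.mul_div_cancel (by simp) hD1

theorem eLpNorm_rconv_le_of_dual {p p' : ℝ} (hpp : p.HolderConjugate p') {C : ℝ}
    {K : G → ℝ} (hK : Integrable K μ)
    (h : ∀ g, MemLp g (ENNReal.ofReal p') μ →
      eLpNorm (rconv μ (fun m => K m⁻¹) g) (ENNReal.ofReal p') μ ≤
        ENNReal.ofReal C * eLpNorm g (ENNReal.ofReal p') μ)
    {f : G → ℝ} (hf : MemLp f (ENNReal.ofReal p) μ) :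
    eLpNorm (rconv μ K f) (ENNReal.ofReal p) μ ≤
      ENNReal.ofReal C * eLpNorm f (ENNReal.ofReal p) μ := by
  have hp0 := hpp.pos
  have hp0' := hpp.symm.pos
  have hp1 := hpp.lt
  set u := rconv μ K f with hu
  have hum : MemLp u (ENNReal.ofReal p) μ := memLp_rconv hp1.le hK hf
  set g : G → ℝ := fun z => |u z| ^ (p - 2) * u z with hg
  have hgabs : ∀ z, ‖g z‖ₑ ^ p' = ‖u z‖ₑ ^ p := by
    intro z
    rcases eq_or_ne (u z) 0 with h0 | h0
    · simp [hg, h0, ENNReal.zero_rpow_of_pos hp0, ENNReal.zero_rpow_of_pos hp0']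
    · have h1 : 0 < |u z| := abs_pos.mpr h0
      rw [← ofReal_norm, ← ofReal_norm, ENNReal.ofReal_rpow_of_nonneg (norm_nonneg _) hp0'.le,
        ENNReal.ofReal_rpow_of_nonneg (norm_nonneg _) hp0.le, Real.norm_eq_abs, Real.norm_eq_abs,
        hg, abs_mul, abs_of_nonneg (Real.rpow_nonneg (abs_nonneg _) _),
        ← Real.rpow_add_one h1.ne', ← Real.rpow_mul h1.le]
      congr 2
      rw [show p - 2 + 1 = p - 1 by ring, hpp.sub_one_mul_conj]
  have hgu : ∀ z, u z * g z = ‖u z‖ ^ p := by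
    intro z
    rcases eq_or_ne (u z) 0 with h0 | h0
    · simp [h0, Real.zero_rpow hp0.ne']
    · have h1 : 0 < |u z| := abs_pos.mpr h0
      rw [hg, Real.norm_eq_abs]
      calc u z * (|u z| ^ (p - 2) * u z) = |u z| ^ (p - 2) * |u z| ^ 2 := by
            rw [sq_abs]; ring
        _ = _ := by
            rw [← Real.rpow_add_natCast h1.ne']; push_cast; ring_nf
  have hgm : AEStronglyMeasurable g μ := by
    have := hum.1.aemeasurable
    refine AEMeasurable.aestronglyMeasurable ?_
    have h2 : AEMeasurable (fun z => |u z|) μ := measurable_norm.comp_aemeasurable this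
    exact (h2.pow_const _).mul this
  have hgint : eLpNorm g (ENNReal.ofReal p') μ ^ p' = eLpNorm u (ENNReal.ofReal p) μ ^ p := by
    rw [eLpNorm_rpow_eq hp0', eLpNorm_rpow_eq hp0]
    exact lintegral_congr hgabs
  have hgp : MemLp g (ENNReal.ofReal p') μ := by
    refine ⟨hgm, ?_⟩
    rw [← ENNReal.rpow_lt_top_iff_of_pos hp0', hgint]
    exact ENNReal.rpow_lt_top_of_nonneg hp0.le hum.2.ne
  have hkey : eLpNorm u (ENNReal.ofReal p) μ ^ p ≤ eLpNorm f (ENNReal.ofReal p) μ *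
      (ENNReal.ofReal C * eLpNorm g (ENNReal.ofReal p') μ) := by
    have e1 : eLpNorm u (ENNReal.ofReal p) μ ^ p = ENNReal.ofReal (∫ z, u z * g z ∂μ) := by
      rw [eLpNorm_rpow_eq hp0]
      simp only [hgu]
      have hi : Integrable (fun z => ‖u z‖ ^ p) μ := by
        have := hum.integrable_norm_rpow (by simpa using hp0) ofReal_ne_top
        rwa [ENNReal.toReal_ofReal hp0.le] at this
      rw [ofReal_integral_eq_lintegral_ofReal hi
        (Filter.Eventually.of_forall fun z => by positivity)]
      refine lintegral_congr fun z => ?_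
      rw [← ofReal_norm, ENNReal.ofReal_rpow_of_nonneg (norm_nonneg _) hp0.le]
    rw [e1, hu, integral_rconv_mul_eq_integral_mul_rconv hpp hK hf hgp]
    set v := rconv μ (fun m => K m⁻¹) g with hv
    calc ENNReal.ofReal (∫ z, f z * v z ∂μ) ≤ ∫⁻ z, ‖f z‖ₑ * ‖v z‖ₑ ∂μ := by
          refine (ENNReal.ofReal_le_ofReal (le_abs_self _)).trans ?_
          rw [← Real.norm_eq_abs, ofReal_norm]
          simpa only [enorm_mul] using enorm_integral_le_lintegral_enorm (μ := μ) fun z => f z * v z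
      _ ≤ (∫⁻ z, ‖f z‖ₑ ^ p ∂μ) ^ (1 / p) * (∫⁻ z, ‖v z‖ₑ ^ p' ∂μ) ^ (1 / p') :=
          ENNReal.lintegral_mul_le_Lp_mul_Lq μ hpp hf.1.enorm
            (aestronglyMeasurable_rconv hK.comp_inv.1 hgm).enorm
      _ = eLpNorm f (ENNReal.ofReal p) μ * eLpNorm v (ENNReal.ofReal p') μ := by
          rw [← eLpNorm_rpow_eq hp0, ← eLpNorm_rpow_eq hp0', ← ENNReal.rpow_mul,
            ← ENNReal.rpow_mul, mul_one_div_cancel hp0.ne', mul_one_div_cancel hp0'.ne',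
            ENNReal.rpow_one, ENNReal.rpow_one]
      _ ≤ _ := by gcongr; exact h g hgp
  set U := eLpNorm u (ENNReal.ofReal p) μ with hU
  have hUt : U ≠ ∞ := hum.2.ne
  rcases eq_or_ne U 0 with h0 | h0
  · rw [h0]; exact zero_le
  have hgU : eLpNorm g (ENNReal.ofReal p') μ = U ^ (p - 1) := by
    have : (eLpNorm g (ENNReal.ofReal p') μ ^ p') ^ (1 / p') = (U ^ p) ^ (1 / p') := by rw [hgint]
    rw [← ENNReal.rpow_mul, ← ENNReal.rpow_mul, mul_one_div_cancel hp0'.ne', ENNReal.rpow_one]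
      at this
    rw [this]
    congr 1
    have := hpp.sub_one_mul_conj
    field_simp
    linarith
  rw [hgU, show p = 1 + (p - 1) by ring, ENNReal.rpow_add _ _ h0 hUt, ENNReal.rpow_one,
    show (1 : ℝ) + (p - 1) = p by ring, ← mul_assoc] at hkey
  have hV0 : U ^ (p - 1) ≠ 0 := by simp [h0, hUt]
  have hVt : U ^ (p - 1) ≠ ∞ := ENNReal.rpow_ne_top_of_nonneg (by linarith) hUt
  rw [ENNReal.mul_le_mul_iff_left hV0 hVt] at hkey
  rwa [mul_comm]

/-- Uniform `L^p` bounds for sums of dyadic kernels. -/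
theorem exists_eLpNorm_rconv_sum_le [T2Space G] [LocallyCompactSpace G] [μ.Regular]
    [μ.InnerRegularCompactLTTop] (hN : IsGauge μ N c Q) {ε C : ℝ} (hε : 0 < ε) (hC : 0 < C)
    {p : ℝ} (hp : 1 < p) :
    ∃ C' > 0, ∀ κ, IsDyadicKernel μ N ε C κ → ∀ (s : Finset ℤ) (f : G → ℝ),
      MemLp f (ENNReal.ofReal p) μ →
        eLpNorm (rconv μ (fun m => ∑ j ∈ s, κ j m) f) (ENNReal.ofReal p) μ ≤
          ENNReal.ofReal C' * eLpNorm f (ENNReal.ofReal p) μ := by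
  obtain ⟨A, hA, hCZ⟩ := exists_isCZKernel_sum (μ := μ) hN hε hC
  rcases lt_trichotomy p 2 with h | rfl | h
  · obtain ⟨C', hC', hst⟩ := hN.exists_strong_type (μ := μ) hA hp h
    exact ⟨C', hC', fun κ hκ s f hf => eLpNorm_rconv_le_of_continuous hp.le
      (hCZ κ hκ s).integrable (hst _ (hCZ κ hκ s)) hf⟩
  · exact ⟨A, hA, fun κ hκ s f hf => by simpa using (hCZ κ hκ s).eLpNorm_two_le f (by simpa using hf)⟩
  · have hpp := Real.HolderConjugate.conjExponent hp
    set p' := p.conjExponent with hp'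
    have h1 := hpp.symm.lt
    have h2 : p' < 2 := by
      rw [hp', Real.conjExponent, div_lt_iff₀ (by linarith)]; linarith
    obtain ⟨C', hC', hst⟩ := hN.exists_strong_type (μ := μ) hA h1 h2
    refine ⟨C', hC', fun κ hκ s f hf => ?_⟩
    have hcz' := hCZ _ (hκ.comp_inv hN.inv) s
    exact eLpNorm_rconv_le_of_dual hpp (hCZ κ hκ s).integrable
      (fun g hg => eLpNorm_rconv_le_of_continuous h1.le hcz'.integrable (hst _ hcz') hg) hf

end StrongType

section FractionalIntegration

variable {G : Type*} [Group G] [TopologicalSpace G] [IsTopologicalGroup G] [MeasurableSpace G]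
  [BorelSpace G] [SecondCountableTopology G]
  {μ : Measure G} [SigmaFinite μ]
  [μ.IsMulLeftInvariant] [μ.IsMulRightInvariant] [μ.IsInvInvariant]

/-- Kernels of size `r` in `L¹` and `r ^ (1 - Q)` in `L^∞`. -/
structure IsFractionalKernel (μ : Measure G) (Q L : ℝ) (K : ℤ → G → ℝ) : Prop where
  aestronglyMeasurable : ∀ j, AEStronglyMeasurable (K j) μ
  lintegral_le : ∀ j, ∫⁻ m, ‖K j m‖ₑ ∂μ ≤ ENNReal.ofReal (L * 2 ^ j)
  enorm_le : ∀ j m, ‖K j m‖ₑ ≤ ENNReal.ofReal (L * (2 ^ j : ℝ) ^ (1 - Q))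

theorem lintegral_kernel_mul_le {q q' : ℝ} (hq : q.HolderConjugate q') {Q L r : ℝ} (hL : 0 < L)
    (hr : 0 < r) {K F : G → ℝ≥0∞} (hK : AEMeasurable K μ) (hF : AEMeasurable F μ)
    (hK1 : ∫⁻ m, K m ∂μ ≤ ENNReal.ofReal (L * r))
    (hKi : ∀ m, K m ≤ ENNReal.ofReal (L * r ^ (1 - Q))) (hF1 : ∫⁻ y, F y ^ q ∂μ ≤ 1) (z : G) :
    ∫⁻ m, K m * F (z * m) ∂μ ≤ ENNReal.ofReal (L * r ^ (-(Q / q - 1))) := by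
  have hq0 := hq.pos
  have hq0' := hq.symm.pos
  have h1 := ENNReal.lintegral_mul_le_Lp_mul_Lq μ hq.symm hK
    (hF.comp_quasiMeasurePreserving (measurePreserving_mul_left μ z).quasiMeasurePreserving)
  have h2 : ∫⁻ m, F (z * m) ^ q ∂μ ≤ 1 := by
    rwa [lintegral_mul_left_eq_self (fun y => F y ^ q)]
  have h3 : ∫⁻ m, K m ^ q' ∂μ ≤ ENNReal.ofReal ((L * r ^ (-(Q / q - 1))) ^ q') := by
    calc ∫⁻ m, K m ^ q' ∂μ ≤ ∫⁻ m, K m * ENNReal.ofReal (L * r ^ (1 - Q)) ^ (q' - 1) ∂μ := by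
          refine lintegral_mono fun m => ?_
          rw [show q' = 1 + (q' - 1) by ring, ENNReal.rpow_add_of_nonneg _ _ zero_le_one
            hq.symm.sub_one_pos.le, ENNReal.rpow_one, show (1 : ℝ) + (q' - 1) - 1 = q' - 1 by ring]
          gcongr
          · exact hq.symm.sub_one_pos.le
          · exact hKi m
      _ = (∫⁻ m, K m ∂μ) * ENNReal.ofReal (L * r ^ (1 - Q)) ^ (q' - 1) :=
          lintegral_mul_const'' _ hK
      _ ≤ ENNReal.ofReal (L * r) * ENNReal.ofReal (L * r ^ (1 - Q)) ^ (q' - 1) := by gcongr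
      _ = _ := by
          rw [ENNReal.ofReal_rpow_of_nonneg (by positivity) hq.symm.sub_one_pos.le,
            ← ENNReal.ofReal_mul (by positivity), Real.mul_rpow hL.le (by positivity),
            Real.mul_rpow hL.le (by positivity), ← Real.rpow_mul hr.le, ← Real.rpow_mul hr.le]
          congr 1
          calc L * r * (L ^ (q' - 1) * r ^ ((1 - Q) * (q' - 1)))
              = (L ^ (q' - 1) * L) * (r ^ ((1 - Q) * (q' - 1)) * r) := by ring
            _ = _ := by
              rw [← Real.rpow_add_one hL.ne', ← Real.rpow_add_one hr.ne']
              congr 2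
              · ring
              · have e := hq.symm.sub_one_mul_conj
                have e2 : q' / q = q' - 1 := by field_simp; linarith
                calc (1 - Q) * (q' - 1) + 1 = q' - Q * (q' - 1) := by ring
                  _ = q' - Q * (q' / q) := by rw [e2]
                  _ = _ := by ring
  calc _ ≤ _ := h1
    _ ≤ ENNReal.ofReal ((L * r ^ (-(Q / q - 1))) ^ q') ^ (1 / q') * 1 ^ (1 / q) := by
        simp only [Function.comp_apply]
        gcongr
    _ = _ := by
        rw [ENNReal.one_rpow, mul_one, ENNReal.ofReal_rpow_of_nonneg (by positivity) (by positivity),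
          ← Real.rpow_mul (by positivity), mul_one_div_cancel hq0'.ne', Real.rpow_one]

theorem lintegral_fractional_kernel_le {p e c₀ : ℝ} (he : 0 < e) (hpe : e < p) (hc : 0 < c₀)
    {a : ℝ} (ha : 0 ≤ a) :
    ∫⁻ l in Set.Ioi 0, (if c₀ * l ^ e < a then ENNReal.ofReal (a / (2 * (c₀ * l ^ e))) else 0) *
        ENNReal.ofReal (l ^ (p - 1)) ≤
      ENNReal.ofReal ((1 / c₀) ^ (p / e) / (2 * (p - e))) * ENNReal.ofReal (a ^ (p / e)) := by
  rcases ha.eq_or_lt with rfl | ha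
  · refine le_trans (le_of_eq ?_) zero_le
    rw [lintegral_eq_zero_iff' ?_]
    · filter_upwards [ae_restrict_mem measurableSet_Ioi] with l hl
      have hl : 0 < l := hl
      have : ¬ c₀ * l ^ e < 0 := not_lt.mpr (by positivity)
      simp [this]
    · refine Measurable.aemeasurable (Measurable.mul (Measurable.ite ?_ ?_ ?_) ?_)
      · exact measurableSet_lt (by fun_prop) (by fun_prop)
      all_goals fun_prop
  set X : ℝ := (a / c₀) ^ (1 / e) with hX
  have hX0 : 0 < X := by positivity
  calc _ ≤ ∫⁻ l in Set.Ioi 0, (Set.Ioc 0 X).indicator (fun l => ENNReal.ofReal (a / (2 * c₀)) *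
          ENNReal.ofReal (l ^ (p - 1 - e))) l := by
        refine setLIntegral_mono' measurableSet_Ioi fun l (hl : 0 < l) => ?_
        split_ifs with h
        · have hlX : l ≤ X := by
            have h1 : l ^ e ≤ a / c₀ := by rw [le_div_iff₀ hc]; linarith
            calc l = (l ^ e) ^ (1 / e) := by
                  rw [← Real.rpow_mul hl.le, mul_one_div_cancel he.ne', Real.rpow_one]
              _ ≤ _ := Real.rpow_le_rpow (by positivity) h1 (by positivity)
          rw [Set.indicator_of_mem (show l ∈ Set.Ioc 0 X from ⟨hl, hlX⟩), ← ENNReal.ofReal_mul (by positivity),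
            ← ENNReal.ofReal_mul (by positivity)]
          refine le_of_eq (congrArg _ ?_)
          rw [Real.rpow_sub hl (p - 1), mul_comm]
          field_simp
        · rw [zero_mul]; exact zero_le
    _ = ∫⁻ l in Set.Ioc 0 X, ENNReal.ofReal (a / (2 * c₀)) *
          ENNReal.ofReal (l ^ (p - 1 - e)) := by
        rw [lintegral_indicator measurableSet_Ioc, Measure.restrict_restrict measurableSet_Ioc,
          Set.inter_eq_left.mpr Set.Ioc_subset_Ioi_self]
    _ = _ := by
        have hpe' : 0 < p - e := by linarith
        rw [lintegral_const_mul' _ _ ofReal_ne_top, lintegral_Ioc_zero_rpow (by linarith) hX0.le,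
          ← ENNReal.ofReal_mul (by positivity), ← ENNReal.ofReal_mul (by positivity),
          show p - 1 - e + 1 = p - e by ring, hX, ← Real.rpow_mul (by positivity),
          show 1 / e * (p - e) = p / e - 1 by field_simp, Real.rpow_sub (by positivity),
          Real.rpow_one, Real.div_rpow ha.le hc.le, Real.div_rpow zero_le_one hc.le, Real.one_rpow]
        congr 1
        field_simp

theorem IsFractionalKernel.measure_le {Q L : ℝ} (hL : 0 < L) {q q' : ℝ}
    (hq : q.HolderConjugate q') {M₁ M₂ : ℝ} (hM₁ : 0 < M₁) (hθ : 0 < Q / q - 1)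
    (hM1 : ∀ x > 0, ∀ s : Finset ℤ, ∑ j ∈ s, min ((x / 2 ^ j) ^ (1 : ℝ)) ((2 ^ j / x) ^ (1 : ℝ)) ≤ M₁)
    (hM2 : ∀ x > 0, ∀ s : Finset ℤ,
      ∑ j ∈ s, min ((x / 2 ^ j) ^ (Q / q - 1)) ((2 ^ j / x) ^ (Q / q - 1)) ≤ M₂)
    {K : ℤ → G → ℝ} (hK : IsFractionalKernel μ Q L K) (s : Finset ℤ) {f : G → ℝ}
    (hf : AEStronglyMeasurable f μ) (hf1 : ∫⁻ y, ‖f y‖ₑ ^ q ∂μ ≤ 1) {l A R : ℝ} (hl : 0 < l)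
    (hR : 0 < R) (hRl : L * M₂ * R ^ (-(Q / q - 1)) = l / 4) (hA : A * (L * M₁ * R) = l / 4) :
    μ {z | l ≤ |rconv μ (fun m => ∑ j ∈ s, K j m) f z|} ≤
      ENNReal.ofReal (1 / (2 * A)) * ∫⁻ y, (if A < |f y| then ‖f y‖ₑ else 0) ∂μ := by
  have hA0 : 0 < A := by
    have : 0 < A * (L * M₁ * R) := by rw [hA]; positivity
    exact pos_of_mul_pos_left this (by positivity)
  set S := s.filter fun j : ℤ => (2 : ℝ) ^ j ≤ R with hS
  set B := s.filter fun j : ℤ => ¬ (2 : ℝ) ^ j ≤ R with hB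
  set k : G → ℝ≥0∞ := fun m => ∑ j ∈ S, ‖K j m‖ₑ with hk
  have hkm : AEMeasurable k μ := Finset.aemeasurable_fun_sum _ fun j _ =>
    (hK.aestronglyMeasurable j).enorm
  have hk1 : ∫⁻ m, k m ∂μ ≤ ENNReal.ofReal (L * M₁ * R) := by
    rw [hk, lintegral_finsetSum' _ fun j _ => (hK.aestronglyMeasurable j).enorm]
    refine (Finset.sum_le_sum fun j _ => hK.lintegral_le j).trans ?_
    rw [← ENNReal.ofReal_sum_of_nonneg fun j _ => by positivity]
    refine ENNReal.ofReal_le_ofReal ?_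
    calc ∑ j ∈ S, L * (2 : ℝ) ^ j
        = L * R * ∑ j ∈ S, min ((R / 2 ^ j) ^ (1 : ℝ)) ((2 ^ j / R) ^ (1 : ℝ)) := by
          rw [Finset.mul_sum]
          refine Finset.sum_congr rfl fun j hj => ?_
          have h2 : (2 : ℝ) ^ j ≤ R := (Finset.mem_filter.mp hj).2
          have h3 : (0 : ℝ) < 2 ^ j := by positivity
          rw [Real.rpow_one, Real.rpow_one, min_eq_right]
          · field_simp
          · exact ((div_le_one hR).mpr h2).trans ((one_le_div h3).mpr h2)
      _ ≤ L * R * M₁ := by gcongr; exact hM1 R hR S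
      _ = _ := by ring
  set F : G → ℝ≥0∞ := fun y => if A < |f y| then ‖f y‖ₑ else 0 with hF
  have hfa : AEMeasurable (fun y => |f y|) μ := measurable_norm.comp_aemeasurable hf.aemeasurable
  have hFm : AEMeasurable F μ := by
    have : F = (fun x : ℝ => if A < |x| then ‖x‖ₑ else 0) ∘ f := rfl
    rw [this]
    refine Measurable.comp_aemeasurable ?_ hf.aemeasurable
    exact Measurable.ite (measurableSet_lt (by fun_prop) (by fun_prop)) (by fun_prop) (by fun_prop)
  have hjm : AEMeasurable (Function.uncurry fun z m => k m * F (z * m)) (μ.prod μ) :=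
    hkm.comp_snd.mul (hFm.comp_quasiMeasurePreserving quasiMeasurePreserving_mul_prod)
  have hFt : ∀ {H : G → ℝ≥0∞}, AEMeasurable H μ → ∀ z, AEMeasurable (fun m => H (z * m)) μ :=
    fun hH z => hH.comp_quasiMeasurePreserving
      (measurePreserving_mul_left μ z).quasiMeasurePreserving
  have hbig : ∀ z, ∑ j ∈ B, ∫⁻ m, ‖K j m‖ₑ * ‖f (z * m)‖ₑ ∂μ ≤ ENNReal.ofReal (l / 4) := by
    intro z
    refine (Finset.sum_le_sum fun j _ => lintegral_kernel_mul_le (r := (2 : ℝ) ^ j) hq hL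
      (by positivity) (hK.aestronglyMeasurable j).enorm hf.enorm (hK.lintegral_le j)
      (hK.enorm_le j) hf1 z).trans ?_
    rw [← ENNReal.ofReal_sum_of_nonneg fun j _ => by positivity, ← hRl]
    refine ENNReal.ofReal_le_ofReal ?_
    calc ∑ j ∈ B, L * ((2 : ℝ) ^ j) ^ (-(Q / q - 1))
        = L * R ^ (-(Q / q - 1)) *
            ∑ j ∈ B, min ((R / 2 ^ j) ^ (Q / q - 1)) ((2 ^ j / R) ^ (Q / q - 1)) := by
          rw [Finset.mul_sum]
          refine Finset.sum_congr rfl fun j hj => ?_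
          have h2 : R < (2 : ℝ) ^ j := not_le.mp (Finset.mem_filter.mp hj).2
          have h3 : (0 : ℝ) < 2 ^ j := by positivity
          rw [min_eq_left, Real.div_rpow hR.le h3.le, Real.rpow_neg hR.le, Real.rpow_neg h3.le]
          · field_simp
          · exact Real.rpow_le_rpow (by positivity) (((div_le_one h3).mpr h2.le).trans
              ((one_le_div hR).mpr h2.le)) hθ.le
      _ ≤ L * R ^ (-(Q / q - 1)) * M₂ := by gcongr; exact hM2 R hR B
      _ = _ := by ring
  have hsmall : ∀ z, ∑ j ∈ S, ∫⁻ m, ‖K j m‖ₑ * ‖f (z * m)‖ₑ ∂μ ≤ ENNReal.ofReal (l / 4) +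
      ∫⁻ m, k m * F (z * m) ∂μ := by
    intro z
    rw [(lintegral_finsetSum' S (f := fun j m => ‖K j m‖ₑ * ‖f (z * m)‖ₑ) fun j _ =>
      (hK.aestronglyMeasurable j).enorm.mul (hFt hf.enorm z)).symm]
    calc ∫⁻ m, ∑ j ∈ S, ‖K j m‖ₑ * ‖f (z * m)‖ₑ ∂μ
        ≤ ∫⁻ m, (k m * ENNReal.ofReal A + k m * F (z * m)) ∂μ := by
          refine lintegral_mono fun m => ?_
          rw [← mul_add, ← Finset.sum_mul]
          refine mul_le_mul_right ?_ _
          simp only [hF]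
          split_ifs with h
          · exact le_add_self
          · rw [add_zero, ← ofReal_norm]
            exact ENNReal.ofReal_le_ofReal (not_lt.mp h)
      _ = (∫⁻ m, k m ∂μ) * ENNReal.ofReal A + ∫⁻ m, k m * F (z * m) ∂μ := by
          rw [lintegral_add_left' (hkm.mul_const _), lintegral_mul_const'' _ hkm]
      _ ≤ ENNReal.ofReal (L * M₁ * R) * ENNReal.ofReal A + ∫⁻ m, k m * F (z * m) ∂μ := by
          gcongr
      _ = _ := by
          rw [← ENNReal.ofReal_mul (by positivity), mul_comm _ A, hA]
  have hpt : ∀ z, ‖rconv μ (fun m => ∑ j ∈ s, K j m) f z‖ₑ ≤ ENNReal.ofReal (l / 2) +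
      ∫⁻ m, k m * F (z * m) ∂μ := by
    intro z
    calc _ ≤ ∫⁻ m, ‖∑ j ∈ s, K j m‖ₑ * ‖f (z * m)‖ₑ ∂μ := enorm_rconv_le _ _ _
      _ ≤ ∫⁻ m, ∑ j ∈ s, ‖K j m‖ₑ * ‖f (z * m)‖ₑ ∂μ := by
          refine lintegral_mono fun m => ?_
          rw [← Finset.sum_mul]
          gcongr
          exact enorm_sum_le _ _
      _ = ∑ j ∈ s, ∫⁻ m, ‖K j m‖ₑ * ‖f (z * m)‖ₑ ∂μ :=
          lintegral_finsetSum' _ fun j _ =>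
            (hK.aestronglyMeasurable j).enorm.mul (hFt hf.enorm z)
      _ = ∑ j ∈ S, ∫⁻ m, ‖K j m‖ₑ * ‖f (z * m)‖ₑ ∂μ +
            ∑ j ∈ B, ∫⁻ m, ‖K j m‖ₑ * ‖f (z * m)‖ₑ ∂μ :=
          (Finset.sum_filter_add_sum_filter_not s _ _).symm
      _ ≤ _ := add_le_add (hsmall z) (hbig z)
      _ = _ := by
          rw [add_right_comm, ← ENNReal.ofReal_add (by positivity) (by positivity)]
          congr 2; ring
  calc μ {z | l ≤ |rconv μ (fun m => ∑ j ∈ s, K j m) f z|}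
      ≤ μ {z | ENNReal.ofReal (l / 2) ≤ ∫⁻ m, k m * F (z * m) ∂μ} := by
        refine measure_mono fun z (hz : l ≤ _) => ?_
        have h1 := hpt z
        rw [← ofReal_norm, Real.norm_eq_abs] at h1
        have h2 := (ENNReal.ofReal_le_ofReal hz).trans h1
        refine (ENNReal.add_le_add_iff_left (ofReal_ne_top (r := l / 2))).mp ?_
        rwa [← ENNReal.ofReal_add (by positivity) (by positivity), add_halves]
    _ ≤ (∫⁻ z, ∫⁻ m, k m * F (z * m) ∂μ ∂μ) / ENNReal.ofReal (l / 2) :=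
        meas_ge_le_lintegral_div hjm.lintegral_prod_right' (by simpa using hl) ofReal_ne_top
    _ ≤ (ENNReal.ofReal (L * M₁ * R) * ∫⁻ y, F y ∂μ) / ENNReal.ofReal (l / 2) := by
        have := lintegral_kernel_rpow_le (μ := μ) (le_refl (1 : ℝ)) hkm hFm
        simp only [ENNReal.rpow_one] at this
        refine ENNReal.div_le_div_right (this.trans ?_) _
        gcongr
    _ = _ := by
        rw [div_eq_mul_inv, ← ENNReal.ofReal_inv_of_pos (by positivity), mul_right_comm,
          ← ENNReal.ofReal_mul (by positivity)]
        congr 2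
        have : l = 4 * (A * (L * M₁ * R)) := by rw [hA]; ring
        rw [this]
        field_simp
        norm_num

theorem exists_eLpNorm_rconv_fractional_le {Q L p q : ℝ} (hQ : 1 < Q) (hL : 0 < L) (hq : 1 < q)
    (hp : 0 < p) (hpq : 1 / q = 1 / p + 1 / Q) :
    ∃ C : ℝ, 0 < C ∧ ∀ K : ℤ → G → ℝ, IsFractionalKernel μ Q L K → ∀ (s : Finset ℤ) (f : G → ℝ),
      MemLp f (ENNReal.ofReal q) μ →
      eLpNorm (rconv μ (fun m => ∑ j ∈ s, K j m) f) (ENNReal.ofReal p) μ ≤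
        ENNReal.ofReal C * eLpNorm f (ENNReal.ofReal q) μ := by
  have hq0 : 0 < q := by linarith
  have hQ0 : 0 < Q := by linarith
  set θ := Q / q - 1 with hθd
  have hθ : θ = Q / p := by
    rw [hθd, div_eq_mul_one_div, hpq]; field_simp; ring
  have hθ0 : 0 < θ := by rw [hθ]; positivity
  have he : p / q = 1 + p / Q := by
    rw [div_eq_mul_one_div, hpq]; field_simp
  set e := 1 + p / Q with hed
  have he0 : 0 < e := by positivity
  have hpe : p / e = q := by rw [← he]; field_simp
  have hep : e < p := by
    rw [← he, div_lt_iff₀ hq0]; nlinarith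
  obtain ⟨M₁, hM₁, hM1⟩ := exists_sum_min_rpow_le (ε := 1) one_pos
  obtain ⟨M₂, hM₂, hM2⟩ := exists_sum_min_rpow_le (ε := θ) hθ0
  set q' := q.conjExponent with hq'
  have hqq : q.HolderConjugate q' := Real.HolderConjugate.conjExponent hq
  set b : ℝ := (4 * L * M₂) ^ (1 / θ) with hb
  have hb0 : 0 < b := by positivity
  set c₀ : ℝ := 1 / (4 * L * M₁ * b) with hc
  have hc0 : 0 < c₀ := by positivity
  set D : ℝ := p * ((1 / c₀) ^ (p / e) / (2 * (p - e))) with hD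
  have hpe0 : 0 < p - e := by linarith
  have hD0 : 0 < D := by positivity
  refine ⟨D ^ (1 / p), by positivity, fun K hK s f hf => ?_⟩
  have key : ∀ f : G → ℝ, AEStronglyMeasurable f μ → ∫⁻ y, ‖f y‖ₑ ^ q ∂μ ≤ 1 →
      eLpNorm (rconv μ (fun m => ∑ j ∈ s, K j m) f) (ENNReal.ofReal p) μ ≤
        ENNReal.ofReal (D ^ (1 / p)) := by
    intro f hf hf1
    set g := hf.mk f with hg
    have hfg : f =ᵐ[μ] g := hf.ae_eq_mk
    have hgm : Measurable g := hf.stronglyMeasurable_mk.measurable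
    have hKs : AEStronglyMeasurable (fun m => ∑ j ∈ s, K j m) μ :=
      Finset.aestronglyMeasurable_fun_sum _ fun j _ => hK.aestronglyMeasurable j
    have hT := aestronglyMeasurable_rconv hKs hf
    have h := lintegral_enorm_rpow_le_of_meas_le (ν := μ) hp hT.aemeasurable
      (φ := fun l y => if c₀ * l ^ e < |g y| then
        ENNReal.ofReal (|g y| / (2 * (c₀ * l ^ e))) else 0)
      (Ψ := fun y => ENNReal.ofReal ((1 / c₀) ^ (p / e) / (2 * (p - e))) *
        ENNReal.ofReal (|g y| ^ (p / e))) ?_ ?_ ?_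
    · rw [lintegral_const_mul' _ _ ofReal_ne_top, ← mul_assoc,
        ← ENNReal.ofReal_mul hp.le, ← hD, hpe] at h
      have h2 : ∫⁻ y, ENNReal.ofReal (|g y| ^ q) ∂μ ≤ 1 := by
        refine le_trans (le_of_eq (lintegral_congr_ae ?_)) hf1
        filter_upwards [hfg] with y hy
        rw [hy, ← ENNReal.ofReal_rpow_of_nonneg (abs_nonneg _) hq0.le, ← Real.norm_eq_abs,
          ofReal_norm]
      rw [← eLpNorm_rpow_eq hp] at h
      rw [← ENNReal.ofReal_rpow_of_pos hD0, ← ENNReal.rpow_le_rpow_iff hp, ← ENNReal.rpow_mul,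
        one_div_mul_cancel hp.ne', ENNReal.rpow_one]
      exact h.trans ((mul_le_mul_right h2 _).trans (mul_one _).le)
    · refine (Measurable.ite (measurableSet_lt ?_ ?_) ?_ measurable_const).aemeasurable
      all_goals fun_prop
    · intro l hl
      have hRR : (0 : ℝ) < (4 * L * M₂ / l) ^ (1 / θ) := by positivity
      have hll : 0 < l ^ e := by positivity
      refine (hK.measure_le hL hqq hM₁ hθ0 hM1 hM2 s hf hf1 (A := c₀ * l ^ e)
        (R := (4 * L * M₂ / l) ^ (1 / θ)) hl hRR ?_ ?_).trans ?_
      · rw [Real.rpow_neg hRR.le, ← Real.rpow_mul (by positivity), one_div_mul_cancel hθ0.ne',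
          Real.rpow_one]
        field_simp
      · have h3 : l ^ e = l * l ^ (1 / θ) := by
          rw [hed, Real.rpow_add hl, Real.rpow_one, hθ, one_div_div]
        rw [Real.div_rpow (by positivity) hl.le, h3, ← hb, hc]
        field_simp
      · rw [← lintegral_const_mul' _ _ ofReal_ne_top]
        refine le_of_eq (lintegral_congr_ae ?_)
        filter_upwards [hfg] with y hy
        rw [hy]
        split_ifs with h4
        · rw [← ofReal_norm, ← ENNReal.ofReal_mul (by positivity), Real.norm_eq_abs]
          congr 1; field_simp
        · exact mul_zero _
    · intro y
      exact lintegral_fractional_kernel_le he0 hep hc0 (abs_nonneg _)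
  set a := (eLpNorm f (ENNReal.ofReal q) μ) with ha
  have hatop : a ≠ ⊤ := hf.2.ne
  by_cases ha0 : a = 0
  · have hf0 : f =ᵐ[μ] 0 := (eLpNorm_eq_zero_iff hf.1 (by simpa using hq0)).mp ha0
    have : rconv μ (fun m => ∑ j ∈ s, K j m) f = 0 := by
      funext z
      have h1 : (fun m => f (z * m)) =ᵐ[μ] 0 :=
        (measurePreserving_mul_left μ z).quasiMeasurePreserving.ae_eq_comp hf0
      simp only [rconv, Pi.zero_apply]
      rw [integral_congr_ae (g := fun _ => 0) (by filter_upwards [h1] with m hm; simp [hm])]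
      simp
    rw [this, eLpNorm_zero]; exact zero_le
  · have hr0 : 0 < a.toReal := ENNReal.toReal_pos ha0 hatop
    have h1 := key (fun y => a.toReal⁻¹ * f y) (hf.1.const_mul _) ?_
    · have h2 : rconv μ (fun m => ∑ j ∈ s, K j m) f =
          a.toReal • rconv μ (fun m => ∑ j ∈ s, K j m) (fun y => a.toReal⁻¹ * f y) := by
        funext z
        simp only [rconv, Pi.smul_apply, smul_eq_mul]
        rw [← integral_const_mul]
        congr 1; funext m; field_simp
      rw [h2, eLpNorm_const_smul, Real.enorm_eq_ofReal hr0.le, ENNReal.ofReal_toReal hatop, mul_comm]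
      gcongr
    · rw [← eLpNorm_rpow_eq hq0]
      have : eLpNorm (fun y => a.toReal⁻¹ * f y) (ENNReal.ofReal q) μ = 1 := by
        have h3 := eLpNorm_const_smul (a.toReal⁻¹) f (ENNReal.ofReal q) μ
        rw [Real.enorm_eq_ofReal (by positivity), ENNReal.ofReal_inv_of_pos hr0,
          ENNReal.ofReal_toReal hatop, ← ha, ENNReal.inv_mul_cancel ha0 hatop] at h3
        exact h3
      rw [this, ENNReal.one_rpow]

end FractionalIntegration

section KineticGroup

variable {d : ℕ}

theorem kmul_assoc (a b c : Pt d) : kmul (kmul a b) c = kmul a (kmul b c) := by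
  simp only [kmul, Prod.mk.injEq]
  refine ⟨by ring, ?_, by abel⟩
  rw [smul_add, add_smul]; abel

theorem kinv_kmul_self (a : Pt d) : kmul (kinv a) a = 0 := by
  simp [kmul, kinv, Prod.ext_iff]

/-- The kinetic group law on phase space. -/
instance kineticGroup : Group (Pt d) where
  mul := kmul
  one := 0
  inv := kinv
  mul_assoc := kmul_assoc
  one_mul a := by change kmul 0 a = a; simp [kmul]
  mul_one a := by change kmul a 0 = a; simp [kmul]
  inv_mul_cancel := kinv_kmul_self

theorem kinetic_mul_def (a b : Pt d) :
    a * b = (a.1 + b.1, a.2.1 + b.2.1 + b.1 • a.2.2, a.2.2 + b.2.2) := rfl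

theorem kinetic_inv_def (a : Pt d) : a⁻¹ = (-a.1, -a.2.1 + a.1 • a.2.2, -a.2.2) := rfl

theorem kinetic_one_def : (1 : Pt d) = 0 := rfl

instance : IsTopologicalGroup (Pt d) where
  continuous_mul := by
    simp only [kinetic_mul_def]; fun_prop
  continuous_inv := by
    simp only [kinetic_inv_def]; fun_prop

instance isAddHaarMeasure_volume_prod : (volume : Measure (V d × V d)).IsAddHaarMeasure :=
  Measure.prod.instIsAddHaarMeasure _ _

instance isAddHaarMeasure_volume_phaseSpace : (volume : Measure (Pt d)).IsAddHaarMeasure :=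
  Measure.prod.instIsAddHaarMeasure _ _

instance isNegInvariant_volume_prod : (volume : Measure (V d × V d)).IsNegInvariant :=
  Measure.IsAddHaarMeasure.isNegInvariant_of_regular _

theorem map_shear_volume (s : ℝ) : MeasurePreserving (fun p : V d × V d => (p.1 + s • p.2, p.2)) := by
  have h : MeasurePreserving (fun p : V d × V d => (p.1, p.2 + s • p.1)) :=
    (MeasurePreserving.id volume).skew_product (by fun_prop)
      (Filter.Eventually.of_forall fun a => (measurePreserving_add_right volume (s • a)).map_eq)
  exact (Measure.measurePreserving_swap.comp h).comp Measure.measurePreserving_swap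

instance : (volume : Measure (Pt d)).IsMulLeftInvariant where
  map_mul_left_eq_self g := by
    have h : MeasurePreserving (fun m : Pt d => (g.1 + m.1, (g.2.1 + m.1 • g.2.2, g.2.2) + m.2)) :=
      (measurePreserving_add_left volume g.1).skew_product
        (g := fun (s : ℝ) (p : V d × V d) => (g.2.1 + s • g.2.2, g.2.2) + p) (by fun_prop)
        (Filter.Eventually.of_forall fun a => (measurePreserving_add_left volume _).map_eq)
    have e : (fun m : Pt d => g * m) =
        fun m : Pt d => (g.1 + m.1, (g.2.1 + m.1 • g.2.2, g.2.2) + m.2) := by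
      funext m
      simp only [kinetic_mul_def, Prod.ext_iff, Prod.fst_add, Prod.snd_add, true_and]
      exact ⟨by abel, trivial⟩
    exact (congrArg (fun F => Measure.map F volume) e).trans h.map_eq

instance : (volume : Measure (Pt d)).IsMulRightInvariant where
  map_mul_right_eq_self g := by
    have h : MeasurePreserving (fun m : Pt d => (m.1 + g.1,
        (fun p : V d × V d => (p.1 + g.1 • p.2, p.2)) m.2 + g.2)) :=
      (measurePreserving_add_right volume g.1).prod
        ((measurePreserving_add_right volume g.2).comp (map_shear_volume g.1))
    have e : (fun m : Pt d => m * g) = fun m : Pt d => (m.1 + g.1,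
        (fun p : V d × V d => (p.1 + g.1 • p.2, p.2)) m.2 + g.2) := by
      funext m
      simp only [kinetic_mul_def, Prod.ext_iff, Prod.fst_add, Prod.snd_add, true_and]
      exact ⟨by abel, trivial⟩
    exact (congrArg (fun F => Measure.map F volume) e).trans h.map_eq

instance : (volume : Measure (Pt d)).IsInvInvariant where
  inv_eq_self := by
    have h : MeasurePreserving (fun m : Pt d => (-m.1,
        -(fun p : V d × V d => (p.1 + (-m.1) • p.2, p.2)) m.2)) :=
      (Measure.measurePreserving_neg volume).skew_product (by fun_prop)
        (Filter.Eventually.of_forall fun a =>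
          ((Measure.measurePreserving_neg volume).comp (map_shear_volume (-a))).map_eq)
    have e : (fun m : Pt d => m⁻¹) = (fun m : Pt d => (-m.1,
        -(fun p : V d × V d => (p.1 + (-m.1) • p.2, p.2)) m.2)) := by
      funext m
      simp [kinetic_inv_def, add_comm]
    exact (congrArg (fun F => Measure.map F volume) e).trans h.map_eq

/-- Kinetic dilations. -/
def dil (r : ℝ) (m : Pt d) : Pt d := (r ^ 2 * m.1, r ^ 3 • m.2.1, r • m.2.2)

@[fun_prop]
theorem continuous_dil (r : ℝ) : Continuous (dil r : Pt d → Pt d) := by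
  unfold dil; fun_prop

theorem dil_dil (r s : ℝ) (m : Pt d) : dil r (dil s m) = dil (r * s) m := by
  simp only [dil, smul_smul, mul_pow, mul_assoc]

theorem dil_one (m : Pt d) : dil 1 m = m := by simp [dil]

theorem dil_inv_dil {r : ℝ} (hr : r ≠ 0) (m : Pt d) : dil r⁻¹ (dil r m) = m := by
  rw [dil_dil, inv_mul_cancel₀ hr, dil_one]

theorem dil_dil_inv {r : ℝ} (hr : r ≠ 0) (m : Pt d) : dil r (dil r⁻¹ m) = m := by
  rw [dil_dil, mul_inv_cancel₀ hr, dil_one]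

theorem dil_mul (r : ℝ) (a b : Pt d) : dil r (a * b) = dil r a * dil r b := by
  simp only [dil, kinetic_mul_def, smul_add, smul_smul, Prod.mk.injEq, and_true]
  refine ⟨by ring, ?_⟩
  congr 2; ring

theorem dil_inv (r : ℝ) (a : Pt d) : dil r a⁻¹ = (dil r a)⁻¹ := by
  simp only [dil, kinetic_inv_def, smul_add, smul_smul, smul_neg, Prod.mk.injEq, and_true]
  refine ⟨by ring, ?_⟩
  congr 2; ring

/-- Dilations as measurable equivalences. -/
def dilEquiv (d : ℕ) {r : ℝ} (hr : r ≠ 0) : Pt d ≃ᵐ Pt d where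
  toFun := dil r
  invFun := dil r⁻¹
  left_inv := dil_inv_dil hr
  right_inv := dil_dil_inv hr
  measurable_toFun := (continuous_dil r).measurable
  measurable_invFun := (continuous_dil r⁻¹).measurable

theorem map_dil_volume {r : ℝ} (hr : 0 < r) :
    (volume : Measure (Pt d)).map (dil r) = ENNReal.ofReal (r ^ (-(4 * (d : ℝ) + 2))) • volume := by
  set L : Pt d →ₗ[ℝ] Pt d := (r ^ 2 • LinearMap.id).prodMap
    ((r ^ 3 • LinearMap.id).prodMap (r • LinearMap.id)) with hL
  have hdet : LinearMap.det L = r ^ (4 * d + 2) := by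
    rw [hL, LinearMap.det_prodMap, LinearMap.det_prodMap]
    simp only [LinearMap.det_smul, LinearMap.det_id, finrank_euclideanSpace, Fintype.card_fin,
      Module.finrank_self]
    ring
  have h := Measure.map_linearMap_addHaar_eq_smul_addHaar (volume : Measure (Pt d)) (f := L)
    (by rw [hdet]; positivity)
  rw [hdet, abs_of_pos (by positivity)] at h
  have e : (r ^ (4 * d + 2))⁻¹ = r ^ (-(4 * (d : ℝ) + 2)) := by
    rw [Real.rpow_neg hr.le, ← Real.rpow_natCast]; push_cast; rfl
  rw [← e]
  exact h

theorem lintegral_dil {r : ℝ} (hr : 0 < r) (g : Pt d → ℝ≥0∞) :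
    ∫⁻ m, g (dil r m) = ENNReal.ofReal (r ^ (-(4 * (d : ℝ) + 2))) * ∫⁻ m, g m := by
  have h := lintegral_map_equiv (μ := (volume : Measure (Pt d))) g (dilEquiv d hr.ne')
  have e : ⇑(dilEquiv d hr.ne') = dil r := rfl
  rw [e, map_dil_volume hr, lintegral_smul_measure, smul_eq_mul] at h
  exact h.symm

theorem integral_dil {r : ℝ} (hr : 0 < r) (g : Pt d → ℝ) :
    ∫ m, g (dil r m) = r ^ (-(4 * (d : ℝ) + 2)) * ∫ m, g m := by
  have h := integral_map_equiv (μ := (volume : Measure (Pt d))) (dilEquiv d hr.ne') g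
  have e : ⇑(dilEquiv d hr.ne') = dil r := rfl
  rw [e, map_dil_volume hr, integral_smul_measure, ENNReal.toReal_ofReal (by positivity),
    smul_eq_mul] at h
  exact h.symm

theorem integrable_comp_dil {r : ℝ} (hr : 0 < r) {g : Pt d → ℝ} (hg : Integrable g) :
    Integrable (fun m => g (dil r m)) := by
  have h : Integrable g ((volume : Measure (Pt d)).map (dilEquiv d hr.ne')) := by
    have e : ⇑(dilEquiv d hr.ne') = dil r := rfl
    rw [e, map_dil_volume hr]
    exact hg.smul_measure ofReal_ne_top
  exact (integrable_map_equiv _ _).mp h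

/-- The quasinorm `max (|s|^{1/2}, |y|^{1/3}, |w|)`. -/
def knorm₀ (m : Pt d) : ℝ := max (√|m.1|) (max (‖m.2.1‖ ^ (1 / 3 : ℝ)) ‖m.2.2‖)

theorem knorm₀_nonneg (m : Pt d) : 0 ≤ knorm₀ m := (Real.sqrt_nonneg _).trans (le_max_left _ _)

theorem knorm₀_le_iff {m : Pt d} {ρ : ℝ} (hρ : 0 ≤ ρ) :
    knorm₀ m ≤ ρ ↔ |m.1| ≤ ρ ^ 2 ∧ ‖m.2.1‖ ≤ ρ ^ 3 ∧ ‖m.2.2‖ ≤ ρ := by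
  rw [knorm₀, max_le_iff, max_le_iff, Real.sqrt_le_iff, and_iff_right hρ,
    show (1 / 3 : ℝ) = (3 : ℝ)⁻¹ by norm_num,
    Real.rpow_inv_le_iff_of_pos (norm_nonneg _) hρ (by norm_num)]
  norm_num

theorem knorm₀_mul_le (m n : Pt d) : knorm₀ (m * n) ≤ knorm₀ m + knorm₀ n := by
  have ha := knorm₀_nonneg m
  have hb := knorm₀_nonneg n
  obtain ⟨h1, h2, h3⟩ := (knorm₀_le_iff ha).mp le_rfl
  obtain ⟨k1, k2, k3⟩ := (knorm₀_le_iff hb).mp le_rfl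
  rw [knorm₀_le_iff (by positivity)]
  set a := knorm₀ m
  set b := knorm₀ n
  simp only [kinetic_mul_def]
  refine ⟨?_, ?_, (norm_add_le _ _).trans (add_le_add h3 k3)⟩
  · refine (abs_add_le _ _).trans ((add_le_add h1 k1).trans ?_)
    nlinarith [mul_nonneg ha hb]
  · refine (norm_add_le _ _).trans ((add_le_add (norm_add_le _ _) le_rfl).trans ?_)
    rw [norm_smul, Real.norm_eq_abs]
    have : |n.1| * ‖m.2.2‖ ≤ b ^ 2 * a := mul_le_mul k1 h3 (norm_nonneg _) (by positivity)
    nlinarith [mul_nonneg ha hb, mul_nonneg (mul_nonneg ha hb) ha, mul_nonneg (mul_nonneg ha hb) hb]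

theorem knorm₀_dil {r : ℝ} (hr : 0 < r) (m : Pt d) : knorm₀ (dil r m) = r * knorm₀ m := by
  simp only [knorm₀, dil, abs_mul, norm_smul, Real.norm_eq_abs, abs_of_pos hr, abs_pow]
  rw [mul_max_of_nonneg _ _ hr.le, mul_max_of_nonneg _ _ hr.le, Real.sqrt_mul (by positivity),
    Real.sqrt_sq hr.le, Real.mul_rpow (by positivity) (by positivity), ← Real.rpow_natCast r 3,
    ← Real.rpow_mul hr.le]
  norm_num

@[fun_prop]
theorem continuous_knorm₀ : Continuous (knorm₀ : Pt d → ℝ) := by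
  unfold knorm₀
  have : Continuous fun m : Pt d => ‖m.2.1‖ ^ (1 / 3 : ℝ) :=
    (continuous_norm.comp (by fun_prop)).rpow_const fun _ => Or.inr (by norm_num)
  fun_prop

/-- The symmetrised homogeneous norm of the kinetic group. -/
def knorm (m : Pt d) : ℝ := max (knorm₀ m) (knorm₀ m⁻¹)

theorem knorm_nonneg (m : Pt d) : 0 ≤ knorm m := (knorm₀_nonneg m).trans (le_max_left _ _)

theorem knorm_inv (m : Pt d) : knorm m⁻¹ = knorm m := by
  rw [knorm, knorm, inv_inv, max_comm]

theorem knorm_mul_le (m n : Pt d) : knorm (m * n) ≤ knorm m + knorm n := by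
  refine max_le ((knorm₀_mul_le m n).trans (add_le_add (le_max_left _ _) (le_max_left _ _))) ?_
  rw [mul_inv_rev, add_comm]
  exact (knorm₀_mul_le _ _).trans (add_le_add (le_max_right _ _) (le_max_right _ _))

theorem knorm_dil {r : ℝ} (hr : 0 < r) (m : Pt d) : knorm (dil r m) = r * knorm m := by
  rw [knorm, ← dil_inv, knorm₀_dil hr, knorm₀_dil hr, knorm, mul_max_of_nonneg _ _ hr.le]

@[fun_prop]
theorem continuous_knorm : Continuous (knorm : Pt d → ℝ) := by
  unfold knorm
  exact continuous_knorm₀.max (continuous_knorm₀.comp continuous_inv)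

theorem bounds_of_knorm_le {m : Pt d} {ρ : ℝ} (h : knorm m ≤ ρ) :
    |m.1| ≤ ρ ^ 2 ∧ ‖m.2.1‖ ≤ ρ ^ 3 ∧ ‖m.2.2‖ ≤ ρ :=
  (knorm₀_le_iff ((knorm_nonneg m).trans h)).mp ((le_max_left _ _).trans h)

theorem knorm_one : knorm (1 : Pt d) = 0 := by
  simp only [knorm, inv_one]
  simp [knorm₀, kinetic_one_def]

theorem isGauge_knorm (d : ℕ) : ∃ c, IsGauge (volume : Measure (Pt d)) knorm c (4 * d + 2) := by
  have hball : ∀ r > 0, (volume : Measure (Pt d)) {m | knorm m < r} =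
      ENNReal.ofReal (r ^ (4 * (d : ℝ) + 2)) * volume {m : Pt d | knorm m < 1} := by
    intro r hr
    have hm : ∀ t : ℝ, MeasurableSet {m : Pt d | knorm m < t} := fun t =>
      measurableSet_lt continuous_knorm.measurable measurable_const
    have h := lintegral_dil (d := d) (inv_pos.mpr hr) ({m | knorm m < 1}.indicator 1)
    have e : ∀ m : Pt d, ({m | knorm m < 1}.indicator (1 : Pt d → ℝ≥0∞)) (dil r⁻¹ m) =
        {m | knorm m < r}.indicator 1 m := by
      intro m
      simp only [Set.indicator, Set.mem_ofPred_eq, knorm_dil (inv_pos.mpr hr)]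
      congr 1
      rw [inv_mul_lt_iff₀ hr, mul_one]
    simp only [e] at h
    rw [lintegral_indicator_one (hm _), lintegral_indicator_one (hm _)] at h
    rw [h, Real.rpow_neg (by positivity), Real.inv_rpow hr.le, inv_inv]
  have hpos : 0 < (volume : Measure (Pt d)) {m | knorm m < 1} :=
    (isOpen_lt continuous_knorm continuous_const).measure_pos _ ⟨1, by simp [knorm_one]⟩
  have hbd : ∀ r : ℝ, 0 < r → r ≤ 1 → {m : Pt d | knorm m < r} ⊆ Metric.closedBall 0 r := by
    intro r hr hr1 m hm
    obtain ⟨h1, h2, h3⟩ := bounds_of_knorm_le (le_of_lt hm)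
    rw [mem_closedBall_zero_iff, Prod.norm_def, Prod.norm_def]
    refine max_le (h1.trans ?_) (max_le (h2.trans ?_) h3)
    · exact pow_le_of_le_one hr.le hr1 two_ne_zero
    · exact pow_le_of_le_one hr.le hr1 three_ne_zero
  have hfin : (volume : Measure (Pt d)) {m | knorm m < 1} ≠ ⊤ :=
    ((measure_mono (hbd 1 one_pos le_rfl)).trans_lt measure_closedBall_lt_top).ne
  refine ⟨((volume : Measure (Pt d)) {m | knorm m < 1}).toReal, continuous_knorm, knorm_nonneg,
    knorm_one, knorm_inv, knorm_mul_le, fun U hU => ?_, fun r hr => ?_,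
    ENNReal.toReal_pos hpos.ne' hfin, by positivity⟩
  · obtain ⟨ε, hε, hU⟩ := Metric.mem_nhds_iff.mp hU
    refine ⟨min (ε / 2) 1, by positivity, (hbd _ (by positivity) (min_le_right _ _)).trans ?_⟩
    refine (Metric.closedBall_subset_ball ?_).trans hU
    exact (min_le_left _ _).trans_lt (by linarith)
  · rw [hball r hr, mul_comm, ENNReal.ofReal_mul toReal_nonneg, ENNReal.ofReal_toReal hfin]

end KineticGroup

section FractionalDerivative

variable {d : ℕ}

/-- The singular weight in the definition of `fracDx`. -/
def fracWeight (d : ℕ) (h : V d) : ℝ := ‖h‖ ^ (-(d : ℝ) - 1 / 3)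

/-- A modulus of continuity which is integrable against `fracWeight`. -/
def fracModulus (h : V d) : ℝ := min (‖h‖ ^ (1 / 2 : ℝ)) (‖h‖ ^ (1 / 6 : ℝ))

theorem fracWeight_nonneg (h : V d) : 0 ≤ fracWeight d h := by unfold fracWeight; positivity

theorem fracModulus_nonneg (h : V d) : 0 ≤ fracModulus h := by unfold fracModulus; positivity

@[fun_prop]
theorem measurable_fracWeight : Measurable (fracWeight d) := by unfold fracWeight; fun_prop

theorem min_one_norm_le_fracModulus (h : V d) : min 1 ‖h‖ ≤ fracModulus h := by
  unfold fracModulus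
  rcases le_total ‖h‖ 1 with h1 | h1
  · refine (min_le_right _ _).trans (le_min ?_ ?_)
    all_goals exact Real.self_le_rpow_of_le_one (norm_nonneg _) h1 (by norm_num)
  · exact (min_le_left _ _).trans (le_min (Real.one_le_rpow h1 (by norm_num))
      (Real.one_le_rpow h1 (by norm_num)))

theorem sqrt_min_one_norm_le_fracModulus (h : V d) :
    (min 1 ‖h‖) ^ (1 / 2 : ℝ) ≤ fracModulus h := by
  unfold fracModulus
  rcases le_total ‖h‖ 1 with h1 | h1
  · rw [min_eq_right h1]
    refine le_min le_rfl ?_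
    rcases (norm_nonneg h).eq_or_lt with h0 | h0
    · rw [← h0]; norm_num
    · exact Real.rpow_le_rpow_of_exponent_ge h0 h1 (by norm_num)
  · rw [min_eq_left h1, Real.one_rpow]
    exact le_min (Real.one_le_rpow h1 (by norm_num)) (Real.one_le_rpow h1 (by norm_num))

theorem min_norm_rpow_le_fracModulus (h : V d) :
    min ‖h‖ (‖h‖ ^ (1 / 6 : ℝ)) ≤ fracModulus h := by
  unfold fracModulus
  rcases le_total ‖h‖ 1 with h1 | h1
  · refine (min_le_left _ _).trans (le_min ?_ ?_)
    all_goals exact Real.self_le_rpow_of_le_one (norm_nonneg _) h1 (by norm_num)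
  · refine (min_le_right _ _).trans (le_min ?_ le_rfl)
    exact Real.rpow_le_rpow_of_exponent_le h1 (by norm_num)

theorem integrable_fracModulus_mul_fracWeight (hd : 1 ≤ d) :
    Integrable (fun h : V d => fracModulus h * fracWeight d h) := by
  have : Nontrivial (V d) := by
    have : Nonempty (Fin d) := ⟨⟨0, hd⟩⟩
    infer_instance
  have h := integrable_fun_norm_addHaar (μ := (volume : Measure (V d)))
    (f := fun y : ℝ => min (y ^ (1 / 2 : ℝ)) (y ^ (1 / 6 : ℝ)) * y ^ (-(d : ℝ) - 1 / 3))
  refine h.mpr ?_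
  rw [finrank_euclideanSpace, Fintype.card_fin, ← Set.Ioc_union_Ioi_eq_Ioi (zero_le_one' ℝ)]
  have e : ∀ y : ℝ, 0 < y → ∀ a : ℝ, y ^ (d - 1) * (y ^ a * y ^ (-(d : ℝ) - 1 / 3)) =
      y ^ (a - 4 / 3) := by
    intro y hy a
    rw [← Real.rpow_natCast, ← Real.rpow_add hy, ← Real.rpow_add hy, Nat.cast_sub hd]
    congr 1; push_cast; ring
  refine IntegrableOn.union ?_ ?_
  · have h1 : IntegrableOn (fun y : ℝ => y ^ ((1 / 2 : ℝ) - 4 / 3)) (Set.Ioc 0 1) :=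
      (intervalIntegrable_iff_integrableOn_Ioc_of_le zero_le_one).mp
        (intervalIntegral.intervalIntegrable_rpow' (by norm_num))
    refine Integrable.mono' h1 (by fun_prop) ?_
    filter_upwards [ae_restrict_mem measurableSet_Ioc] with y hy
    have hy0 : 0 < y := hy.1
    rw [Real.norm_of_nonneg (by positivity), ← e y hy0, smul_eq_mul]
    gcongr
    exact min_le_left _ _
  · have h1 : IntegrableOn (fun y : ℝ => y ^ ((1 / 6 : ℝ) - 4 / 3)) (Set.Ioi 1) :=
      integrableOn_Ioi_rpow_of_lt (by norm_num) one_pos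
    refine Integrable.mono' h1 (by fun_prop) ?_
    filter_upwards [ae_restrict_mem measurableSet_Ioi] with y hy
    have hy0 : 0 < y := one_pos.trans hy
    rw [Real.norm_of_nonneg (by positivity), ← e y hy0, smul_eq_mul]
    gcongr
    exact min_le_right _ _

/-- Second order central differences in the `x` variable. -/
def secDiff (u : Pt d → ℝ) (h : V d) (z : Pt d) : ℝ :=
  2 * u z - u (z.1, z.2.1 + h, z.2.2) - u (z.1, z.2.1 - h, z.2.2)

theorem fracDx_eq (u : Pt d → ℝ) (z : Pt d) :
    fracDx u z = ∫ h : V d, secDiff u h z * fracWeight d h := rfl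

/-- The centre of the kinetic group. -/
def ctr (h : V d) : Pt d := (0, h, 0)

theorem mul_ctr (z : Pt d) (h : V d) : z * ctr h = (z.1, z.2.1 + h, z.2.2) := by
  simp [kinetic_mul_def, ctr]

theorem ctr_mul (z : Pt d) (h : V d) : ctr h * z = z * ctr h := by
  simp [kinetic_mul_def, ctr, add_comm]

theorem ctr_inv (h : V d) : (ctr h)⁻¹ = ctr (-h) := by
  simp [kinetic_inv_def, ctr]

theorem secDiff_eq (u : Pt d → ℝ) (h : V d) (z : Pt d) :
    secDiff u h z = 2 * u z - u (z * ctr h) - u (z * ctr (-h)) := by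
  rw [mul_ctr, mul_ctr, secDiff, sub_eq_add_neg z.2.1]

theorem continuous_secDiff {u : Pt d → ℝ} (hu : Continuous u) :
    Continuous (fun q : V d × Pt d => secDiff u q.1 q.2) := by
  unfold secDiff; fun_prop

theorem knorm_ctr (h : V d) : knorm (ctr h) = ‖h‖ ^ (1 / 3 : ℝ) := by
  rw [knorm, ctr_inv]
  have : (0 : ℝ) ≤ ‖h‖ ^ (1 / 3 : ℝ) := by positivity
  simp only [knorm₀, ctr, abs_zero, Real.sqrt_zero, norm_zero, norm_neg, max_self,
    max_eq_left this, max_eq_right this]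

/-- The total mass of the modulus `fracModulus`. -/
def fracMass (d : ℕ) : ℝ := ∫ h : V d, fracModulus h * fracWeight d h

theorem lintegral_ofReal_fracModulus (hd : 1 ≤ d) {C : ℝ} (hC : 0 ≤ C) :
    ∫⁻ h : V d, ENNReal.ofReal (C * fracModulus h) * ENNReal.ofReal (fracWeight d h) =
      ENNReal.ofReal (C * fracMass d) := by
  rw [fracMass, ← integral_const_mul, ofReal_integral_eq_lintegral_ofReal
    ((integrable_fracModulus_mul_fracWeight hd).const_mul C)]
  · refine lintegral_congr fun h => ?_
    rw [← ENNReal.ofReal_mul (mul_nonneg hC (fracModulus_nonneg h)), mul_assoc]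
  · exact Filter.Eventually.of_forall fun h =>
      mul_nonneg hC (mul_nonneg (fracModulus_nonneg h) (fracWeight_nonneg h))

theorem lintegral_enorm_fracIntegral_le (hd : 1 ≤ d) {u : V d → Pt d → ℝ} {g : Pt d → ℝ≥0∞}
    (hu : Continuous (fun q : V d × Pt d => u q.1 q.2)) (hg : Measurable g) {C : ℝ} (hC : 0 ≤ C)
    (hle : ∀ h, ∫⁻ m, ‖u h m‖ₑ * g m ≤ ENNReal.ofReal (C * fracModulus h)) :
    ∫⁻ m, ∫⁻ h, ‖u h m * fracWeight d h‖ₑ * g m ≤ ENNReal.ofReal (C * fracMass d) := by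
  rw [← lintegral_ofReal_fracModulus hd hC, lintegral_lintegral_swap]
  · refine lintegral_mono fun h => ?_
    calc ∫⁻ m, ‖u h m * fracWeight d h‖ₑ * g m
        = ∫⁻ m, (‖u h m‖ₑ * g m) * ENNReal.ofReal (fracWeight d h) := by
          refine lintegral_congr fun m => ?_
          rw [enorm_mul, Real.enorm_eq_ofReal (fracWeight_nonneg h)]
          ring
      _ = (∫⁻ m, ‖u h m‖ₑ * g m) * ENNReal.ofReal (fracWeight d h) :=
          lintegral_mul_const' _ _ ofReal_ne_top
      _ ≤ _ := by gcongr; exact hle h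
  · have := (hu.comp continuous_swap).measurable
    refine Measurable.aemeasurable (Measurable.mul (Measurable.enorm (Measurable.mul this ?_)) ?_)
    all_goals fun_prop

end FractionalDerivative

section TestKernel

variable {d : ℕ}

/-- Lipschitz functions supported in a ball. -/
structure IsTestKernel (A : Pt d → ℝ) (L R : ℝ) : Prop where
  lip_nonneg : 0 ≤ L
  radius_nonneg : 0 ≤ R
  lip : ∀ m n, |A m - A n| ≤ L * ‖m - n‖
  supp : ∀ m, A m ≠ 0 → ‖m‖ ≤ R

namespace IsTestKernel

variable {A : Pt d → ℝ} {L R : ℝ} (hA : IsTestKernel A L R)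
include hA

theorem continuous : Continuous A :=
  (LipschitzWith.of_dist_le_mul (K := ⟨L, hA.lip_nonneg⟩) fun m n => by
    rw [Real.dist_eq, dist_eq_norm]; exact hA.lip m n).continuous

theorem abs_le (m : Pt d) : |A m| ≤ L * (2 * R + 1) := by
  have hR := hA.radius_nonneg
  have hL := hA.lip_nonneg
  by_cases hm : A m = 0
  · rw [hm, abs_zero]; positivity
  set n : Pt d := (R + 1, 0, 0) with hn
  have hnn : ‖n‖ = R + 1 := by
    simp only [hn, Prod.norm_def, norm_zero, max_self, Real.norm_eq_abs]
    rw [abs_of_nonneg (by positivity), max_eq_left (by positivity)]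
  have h0 : A n = 0 := by
    by_contra h
    have := hA.supp n h
    linarith
  have h := hA.lip m n
  rw [h0, sub_zero] at h
  refine h.trans ?_
  gcongr
  have := norm_sub_le m n
  have := hA.supp m hm
  linarith

theorem integrable : Integrable A := by
  refine hA.continuous.integrable_of_hasCompactSupport ?_
  refine HasCompactSupport.of_support_subset_isCompact (isCompact_closedBall (0 : Pt d) R) ?_
  intro m hm
  simpa using hA.supp m hm

theorem exists_lintegral_comp_sub_le : ∃ C : ℝ, 0 ≤ C ∧ ∀ (T : Pt d → Pt d) (δ : ℝ),
    MeasurePreserving T → 0 ≤ δ →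
    (δ ≤ 1 → ∀ m, ‖T m - m‖ ≤ δ * (1 + ‖m‖) ∧ ‖m‖ ≤ 2 * ‖T m‖ + 2) →
    ∫⁻ m, ‖A (T m) - A m‖ₑ ≤ ENNReal.ofReal (C * min 1 δ) := by
  have hL := hA.lip_nonneg
  have hR := hA.radius_nonneg
  set B : Set (Pt d) := Metric.closedBall 0 (2 * R + 2) with hB
  set v : ℝ := volume.real B with hv
  have hBt : (volume : Measure (Pt d)) B ≠ ⊤ := measure_closedBall_lt_top.ne
  set a : ℝ := ∫ m, |A m| with ha
  have ha0 : 0 ≤ a := integral_nonneg fun m => abs_nonneg _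
  have hAa : ∫⁻ m, ‖A m‖ₑ = ENNReal.ofReal a := by
    rw [ha, ofReal_integral_eq_lintegral_ofReal hA.integrable.abs
      (Filter.Eventually.of_forall fun m => abs_nonneg _)]
    exact lintegral_congr fun m => by rw [← ofReal_norm, Real.norm_eq_abs]
  refine ⟨L * (2 * R + 3) * v + 2 * a, by positivity, fun T δ hT hδ h => ?_⟩
  rcases le_total δ 1 with h1 | h1
  · have hpt : ∀ m, ‖A (T m) - A m‖ₑ ≤
        B.indicator (fun _ => ENNReal.ofReal (L * (δ * (2 * R + 3)))) m := by
      intro m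
      obtain ⟨e1, e2⟩ := h h1 m
      by_cases hm : m ∈ B
      · rw [Set.indicator_of_mem hm, ← ofReal_norm, Real.norm_eq_abs]
        refine ENNReal.ofReal_le_ofReal ((hA.lip _ _).trans ?_)
        have : ‖m‖ ≤ 2 * R + 2 := by simpa [hB] using hm
        refine mul_le_mul_of_nonneg_left (e1.trans ?_) hL
        exact mul_le_mul_of_nonneg_left (by linarith) hδ
      · have hm' : 2 * R + 2 < ‖m‖ := by simpa [hB] using hm
        have z1 : A m = 0 := by
          by_contra hc
          linarith [hA.supp m hc]
        have z2 : A (T m) = 0 := by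
          by_contra hc
          linarith [hA.supp _ hc]
        simp [z1, z2]
    refine (lintegral_mono hpt).trans ?_
    rw [lintegral_indicator_const measurableSet_closedBall, min_eq_right h1,
      ← ENNReal.ofReal_toReal hBt, ← ENNReal.ofReal_mul (by positivity)]
    refine ENNReal.ofReal_le_ofReal ?_
    calc L * (δ * (2 * R + 3)) * v = (L * (2 * R + 3) * v) * δ := by ring
      _ ≤ _ := by gcongr; linarith
  · have hmeas : AEMeasurable (fun m => ‖A m‖ₑ) :=
      hA.continuous.measurable.enorm.aemeasurable
    calc ∫⁻ m, ‖A (T m) - A m‖ₑ ≤ ∫⁻ m, (‖A (T m)‖ₑ + ‖A m‖ₑ) :=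
          lintegral_mono fun m => enorm_sub_le
      _ = ENNReal.ofReal (2 * a) := by
          rw [lintegral_add_right' _ hmeas, hT.lintegral_comp hA.continuous.measurable.enorm, hAa,
            ← ENNReal.ofReal_add ha0 ha0, two_mul]
      _ ≤ _ := by
          rw [min_eq_left h1, mul_one]
          refine ENNReal.ofReal_le_ofReal ?_
          have : 0 ≤ L * (2 * R + 3) * v := by positivity
          linarith

theorem exists_left_le : ∃ C : ℝ, 0 ≤ C ∧ ∀ a : Pt d,
    ∫⁻ m, ‖A (a * m) - A m‖ₑ ≤ ENNReal.ofReal (C * min 1 (knorm a)) := by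
  obtain ⟨C, hC, h⟩ := hA.exists_lintegral_comp_sub_le
  refine ⟨C, hC, fun a => h _ _ (measurePreserving_mul_left volume a) (knorm_nonneg a) ?_⟩
  intro ha m
  obtain ⟨b1, b2, b3⟩ := bounds_of_knorm_le (le_refl (knorm a))
  have h0 := knorm_nonneg a
  replace b1 := b1.trans (pow_le_of_le_one h0 ha two_ne_zero)
  replace b2 := b2.trans (pow_le_of_le_one h0 ha three_ne_zero)
  set N := knorm a
  have c1 : |m.1| ≤ ‖m‖ := norm_fst_le m
  have c2 : ‖m.2.1‖ ≤ ‖m‖ := (norm_fst_le m.2).trans (norm_snd_le m)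
  have c3 : ‖m.2.2‖ ≤ ‖m‖ := (norm_snd_le m.2).trans (norm_snd_le m)
  have e1 : |(a * m).1| ≤ ‖a * m‖ := norm_fst_le (a * m)
  have e2 : ‖(a * m).2.1‖ ≤ ‖a * m‖ := (norm_fst_le (a * m).2).trans (norm_snd_le (a * m))
  have e3 : ‖(a * m).2.2‖ ≤ ‖a * m‖ := (norm_snd_le (a * m).2).trans (norm_snd_le (a * m))
  constructor
  · rw [Prod.norm_def, Prod.norm_def]
    simp only [kinetic_mul_def, Prod.fst_sub, Prod.snd_sub, add_sub_cancel_right]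
    refine max_le ?_ (max_le ?_ ?_)
    · rw [Real.norm_eq_abs]; nlinarith [norm_nonneg m]
    · have : a.2.1 + m.2.1 + m.1 • a.2.2 - m.2.1 = a.2.1 + m.1 • a.2.2 := by abel
      rw [this]
      refine (norm_add_le _ _).trans ?_
      rw [norm_smul, Real.norm_eq_abs]
      have := mul_le_mul c1 b3 (norm_nonneg _) (norm_nonneg m)
      nlinarith
    · nlinarith [norm_nonneg m]
  · have hS : 0 ≤ ‖a * m‖ := norm_nonneg _
    set S := ‖a * m‖
    simp only [kinetic_mul_def] at e1 e2 e3
    have f1 : |m.1| ≤ S + 1 := by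
      have : m.1 = (a.1 + m.1) - a.1 := by ring
      rw [this]; exact (abs_sub _ _).trans (add_le_add e1 (b1.trans ha))
    have f3 : ‖m.2.2‖ ≤ S + 1 := by
      have : m.2.2 = (a.2.2 + m.2.2) - a.2.2 := by abel
      rw [this]; exact (norm_sub_le _ _).trans (add_le_add e3 (b3.trans ha))
    have f2 : ‖m.2.1‖ ≤ 2 * S + 2 := by
      have : m.2.1 = (a.2.1 + m.2.1 + m.1 • a.2.2) - a.2.1 - m.1 • a.2.2 := by abel
      rw [this]
      refine (norm_sub_le _ _).trans ((add_le_add (norm_sub_le _ _) le_rfl).trans ?_)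
      rw [norm_smul, Real.norm_eq_abs]
      have := mul_le_mul f1 (b3.trans ha) (norm_nonneg _) ((abs_nonneg _).trans f1)
      linarith
    rw [Prod.norm_def, Prod.norm_def]
    exact max_le (by rw [Real.norm_eq_abs]; linarith) (max_le f2 (by linarith))

theorem exists_right_le : ∃ C : ℝ, 0 ≤ C ∧ ∀ a : Pt d,
    ∫⁻ m, ‖A (m * a) - A m‖ₑ ≤ ENNReal.ofReal (C * min 1 (knorm a)) := by
  obtain ⟨C, hC, h⟩ := hA.exists_lintegral_comp_sub_le
  refine ⟨C, hC, fun a => h _ _ (measurePreserving_mul_right volume a) (knorm_nonneg a) ?_⟩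
  intro ha m
  obtain ⟨b1, b2, b3⟩ := bounds_of_knorm_le (le_refl (knorm a))
  have h0 := knorm_nonneg a
  replace b1 := b1.trans (pow_le_of_le_one h0 ha two_ne_zero)
  replace b2 := b2.trans (pow_le_of_le_one h0 ha three_ne_zero)
  set N := knorm a
  have c3 : ‖m.2.2‖ ≤ ‖m‖ := (norm_snd_le m.2).trans (norm_snd_le m)
  have e1 : |(m * a).1| ≤ ‖m * a‖ := norm_fst_le (m * a)
  have e2 : ‖(m * a).2.1‖ ≤ ‖m * a‖ := (norm_fst_le (m * a).2).trans (norm_snd_le (m * a))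
  have e3 : ‖(m * a).2.2‖ ≤ ‖m * a‖ := (norm_snd_le (m * a).2).trans (norm_snd_le (m * a))
  constructor
  · rw [Prod.norm_def, Prod.norm_def]
    simp only [kinetic_mul_def, Prod.fst_sub, Prod.snd_sub, add_sub_cancel_left]
    refine max_le ?_ (max_le ?_ ?_)
    · rw [Real.norm_eq_abs]; nlinarith [norm_nonneg m]
    · have : m.2.1 + a.2.1 + a.1 • m.2.2 - m.2.1 = a.2.1 + a.1 • m.2.2 := by abel
      rw [this]
      refine (norm_add_le _ _).trans ?_
      rw [norm_smul, Real.norm_eq_abs]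
      have := mul_le_mul b1 c3 (norm_nonneg _) h0
      nlinarith
    · nlinarith [norm_nonneg m]
  · have hS : 0 ≤ ‖m * a‖ := norm_nonneg _
    set S := ‖m * a‖
    simp only [kinetic_mul_def] at e1 e2 e3
    have f1 : |m.1| ≤ S + 1 := by
      have : m.1 = (m.1 + a.1) - a.1 := by ring
      rw [this]; exact (abs_sub _ _).trans (add_le_add e1 (b1.trans ha))
    have f3 : ‖m.2.2‖ ≤ S + 1 := by
      have : m.2.2 = (m.2.2 + a.2.2) - a.2.2 := by abel
      rw [this]; exact (norm_sub_le _ _).trans (add_le_add e3 (b3.trans ha))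
    have f2 : ‖m.2.1‖ ≤ 2 * S + 2 := by
      have : m.2.1 = (m.2.1 + a.2.1 + a.1 • m.2.2) - a.2.1 - a.1 • m.2.2 := by abel
      rw [this]
      refine (norm_sub_le _ _).trans ((add_le_add (norm_sub_le _ _) le_rfl).trans ?_)
      rw [norm_smul, Real.norm_eq_abs]
      have := mul_le_mul (b1.trans ha) f3 (norm_nonneg _) zero_le_one
      linarith
    rw [Prod.norm_def, Prod.norm_def]
    exact max_le (by rw [Real.norm_eq_abs]; linarith) (max_le f2 (by linarith))

theorem norm_mul_ctr_sub (m : Pt d) (h : V d) : ‖m * ctr h - m‖ = ‖h‖ := by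
  have : m * ctr h - m = (0, h, 0) := by
    rw [mul_ctr]; simp [Prod.ext_iff]
  rw [this, Prod.norm_def, Prod.norm_def]
  simp

theorem exists_ctr_le : ∃ C : ℝ, 0 ≤ C ∧ ∀ h : V d,
    ∫⁻ m, ‖A (m * ctr h) - A m‖ₑ ≤ ENNReal.ofReal (C * min 1 ‖h‖) := by
  obtain ⟨C, hC, H⟩ := hA.exists_lintegral_comp_sub_le
  refine ⟨C, hC, fun h => H _ _ (measurePreserving_mul_right volume _) (norm_nonneg h) ?_⟩
  intro h1 m
  have e := hA.norm_mul_ctr_sub m h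
  refine ⟨by rw [e]; nlinarith [norm_nonneg m, norm_nonneg h], ?_⟩
  have : m = m * ctr h - (m * ctr h - m) := by abel
  have h2 := norm_sub_le (m * ctr h) (m * ctr h - m)
  rw [← this, e] at h2
  linarith [norm_nonneg (m * ctr h)]

end IsTestKernel

end TestKernel

section FracKernel

variable {d : ℕ}

theorem integrable_secDiff_mul_fracWeight (hd : 1 ≤ d) {u : Pt d → ℝ} (hu : Continuous u)
    {C : ℝ} {z : Pt d} (hle : ∀ h, |secDiff u h z| ≤ C * min 1 ‖h‖) :
    Integrable (fun h => secDiff u h z * fracWeight d h) := by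
  have hc : Continuous fun h => secDiff u h z :=
    (continuous_secDiff hu).comp (by fun_prop : Continuous fun h : V d => (h, z))
  have hC : ∀ h : V d, |secDiff u h z| ≤ |C| * fracModulus h := fun h =>
    (hle h).trans (mul_le_mul (le_abs_self C) (min_one_norm_le_fracModulus h) (by positivity)
      (abs_nonneg C))
  refine Integrable.mono' ((integrable_fracModulus_mul_fracWeight hd).const_mul |C|)
    (hc.measurable.mul measurable_fracWeight).aestronglyMeasurable
    (Filter.Eventually.of_forall fun h => ?_)
  rw [norm_mul, Real.norm_eq_abs, Real.norm_of_nonneg (fracWeight_nonneg h), ← mul_assoc]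
  exact mul_le_mul_of_nonneg_right (hC h) (fracWeight_nonneg h)

theorem abs_fracDx_le (hd : 1 ≤ d) {u : Pt d → ℝ} {C : ℝ} (hC : 0 ≤ C) {z : Pt d}
    (hle : ∀ h, |secDiff u h z| ≤ C * min 1 ‖h‖) : |fracDx u z| ≤ C * fracMass d := by
  rw [fracDx_eq, fracMass, ← integral_const_mul, ← Real.norm_eq_abs]
  refine norm_integral_le_of_norm_le ((integrable_fracModulus_mul_fracWeight hd).const_mul C)
    (Filter.Eventually.of_forall fun h => ?_)
  rw [norm_mul, Real.norm_eq_abs, Real.norm_of_nonneg (fracWeight_nonneg h), ← mul_assoc]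
  exact mul_le_mul_of_nonneg_right ((hle h).trans
    (mul_le_mul_of_nonneg_left (min_one_norm_le_fracModulus h) hC)) (fracWeight_nonneg h)

theorem stronglyMeasurable_fracDx {u : Pt d → ℝ} (hu : Continuous u) :
    StronglyMeasurable (fracDx u) := by
  have h1 : StronglyMeasurable
      (Function.uncurry fun (z : Pt d) (h : V d) => secDiff u h z * fracWeight d h) := by
    refine Measurable.stronglyMeasurable (Measurable.mul ?_ ?_)
    · exact ((continuous_secDiff hu).comp continuous_swap).measurable
    · exact measurable_fracWeight.comp measurable_snd
  exact h1.integral_prod_right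

theorem lintegral_enorm_integral_fracWeight_le (hd : 1 ≤ d) {u : V d → Pt d → ℝ}
    {g : Pt d → ℝ≥0∞}
    (hu : Continuous (fun q : V d × Pt d => u q.1 q.2)) (hg : Measurable g) (hgt : ∀ m, g m ≠ ⊤)
    {C : ℝ} (hC : 0 ≤ C) (hle : ∀ h, ∫⁻ m, ‖u h m‖ₑ * g m ≤ ENNReal.ofReal (C * fracModulus h)) :
    ∫⁻ m, ‖∫ h, u h m * fracWeight d h‖ₑ * g m ≤ ENNReal.ofReal (C * fracMass d) := by
  refine le_trans (lintegral_mono fun m => ?_) (lintegral_enorm_fracIntegral_le hd hu hg hC hle)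
  rw [lintegral_mul_const' _ _ (hgt m)]
  gcongr
  exact enorm_integral_le_lintegral_enorm _

namespace IsTestKernel

variable {A : Pt d → ℝ} {L R : ℝ} (hA : IsTestKernel A L R)
include hA

theorem exists_abs_secDiff_le : ∃ C : ℝ, 0 ≤ C ∧ ∀ h m, |secDiff A h m| ≤ C * min 1 ‖h‖ := by
  have hL := hA.lip_nonneg
  have hR := hA.radius_nonneg
  refine ⟨4 * (L * (2 * R + 1)) + 2 * L, by positivity, fun h m => ?_⟩
  rw [secDiff_eq]
  rcases le_total ‖h‖ 1 with h1 | h1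
  · rw [min_eq_right h1]
    have e1 := hA.lip (m * ctr h) m
    have e2 := hA.lip (m * ctr (-h)) m
    rw [hA.norm_mul_ctr_sub] at e1 e2
    rw [norm_neg] at e2
    have : 0 ≤ 4 * (L * (2 * R + 1)) * ‖h‖ := by positivity
    rw [_root_.abs_le] at e1 e2 ⊢
    constructor <;> linarith
  · rw [min_eq_left h1]
    have e1 := hA.abs_le m
    have e2 := hA.abs_le (m * ctr h)
    have e3 := hA.abs_le (m * ctr (-h))
    rw [_root_.abs_le] at e1 e2 e3 ⊢
    constructor <;> linarith

theorem exists_lintegral_secDiff_le : ∃ C : ℝ, 0 ≤ C ∧ ∀ h : V d,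
    ∫⁻ m, ‖secDiff A h m‖ₑ ≤ ENNReal.ofReal (C * min 1 ‖h‖) := by
  obtain ⟨C, hC, H⟩ := hA.exists_ctr_le
  refine ⟨2 * C, by positivity, fun h => ?_⟩
  have hm : ∀ k : V d, Measurable fun m => ‖A (m * ctr k) - A m‖ₑ := fun k =>
    ((hA.continuous.comp (continuous_mul_const _)).sub hA.continuous).measurable.enorm
  calc ∫⁻ m, ‖secDiff A h m‖ₑ
      ≤ ∫⁻ m, (‖A (m * ctr h) - A m‖ₑ + ‖A (m * ctr (-h)) - A m‖ₑ) := by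
        refine lintegral_mono fun m => ?_
        rw [secDiff_eq, ← enorm_neg]
        refine le_trans (le_of_eq ?_) (enorm_add_le _ _)
        congr 1; ring
    _ = (∫⁻ m, ‖A (m * ctr h) - A m‖ₑ) + ∫⁻ m, ‖A (m * ctr (-h)) - A m‖ₑ :=
        lintegral_add_left (hm h) _
    _ ≤ ENNReal.ofReal (C * min 1 ‖h‖) + ENNReal.ofReal (C * min 1 ‖h‖) := by
        gcongr
        · exact H h
        · simpa using H (-h)
    _ = _ := by
        rw [← ENNReal.ofReal_add (by positivity) (by positivity)]
        congr 1; ring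

theorem integral_secDiff (h : V d) : ∫ m, secDiff A h m = 0 := by
  have e : secDiff A h = fun z => 2 * A z - A (z * ctr h) - A (z * ctr (-h)) :=
    funext fun z => secDiff_eq A h z
  have h1 := integral_mul_right_eq_self (μ := (volume : Measure (Pt d))) A (ctr h)
  have h2 := integral_mul_right_eq_self (μ := (volume : Measure (Pt d))) A (ctr (-h))
  have i0 : Integrable fun z => 2 * A z - A (z * ctr h) :=
    (hA.integrable.const_mul 2).sub (hA.integrable.comp_mul_right _)
  rw [e, integral_sub i0 (hA.integrable.comp_mul_right _),
    integral_sub (hA.integrable.const_mul 2) (hA.integrable.comp_mul_right _),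
    integral_const_mul, h1, h2]
  ring

theorem exists_lintegral_secDiff_comp_sub_le {T : Pt d → Pt d → Pt d}
    (hT : ∀ a, Continuous (T a)) (hc : ∀ a m h, T a (m * ctr h) = T a m * ctr h)
    {C : ℝ} (hC : 0 ≤ C)
    (H : ∀ a, ∫⁻ m, ‖A (T a m) - A m‖ₑ ≤ ENNReal.ofReal (C * min 1 (knorm a)))
    (hp : ∀ a, MeasurePreserving (T a)) :
    ∃ C' : ℝ, 0 ≤ C' ∧ ∀ a h, ∫⁻ m, ‖secDiff A h (T a m) - secDiff A h m‖ₑ ≤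
      ENNReal.ofReal (C' * knorm a ^ (1 / 2 : ℝ) * fracModulus h) := by
  obtain ⟨C₁, hC₁, H₁⟩ := hA.exists_lintegral_secDiff_le
  refine ⟨4 * C + 2 * C₁, by positivity, fun a h => ?_⟩
  have hN := knorm_nonneg a
  set D : Pt d → ℝ := fun m => A (T a m) - A m with hD
  have hDc : Continuous D := (hA.continuous.comp (hT a)).sub hA.continuous
  have hDm : ∀ k : V d, ∫⁻ m, ‖D (m * ctr k)‖ₑ ≤ ENNReal.ofReal (C * min 1 (knorm a)) := by
    intro k
    rw [lintegral_mul_right_eq_self (fun m => ‖D m‖ₑ)]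
    exact H a
  have hS : Continuous (secDiff A h) :=
    (continuous_secDiff hA.continuous).comp (by fun_prop : Continuous fun z : Pt d => (h, z))
  have e1 : ∫⁻ m, ‖secDiff A h (T a m) - secDiff A h m‖ₑ ≤
      ENNReal.ofReal (4 * C * min 1 (knorm a)) := by
    calc ∫⁻ m, ‖secDiff A h (T a m) - secDiff A h m‖ₑ
        ≤ ∫⁻ m, (2 * ‖D m‖ₑ + (‖D (m * ctr h)‖ₑ + ‖D (m * ctr (-h))‖ₑ)) := by
          refine lintegral_mono fun m => ?_
          have : secDiff A h (T a m) - secDiff A h m =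
              2 * D m - (D (m * ctr h) + D (m * ctr (-h))) := by
            simp only [secDiff_eq, hD, hc]; ring
          rw [this]
          refine enorm_sub_le.trans (add_le_add (le_of_eq ?_) (enorm_add_le _ _))
          rw [enorm_mul]
          congr 1
          rw [Real.enorm_eq_ofReal (by norm_num)]; norm_num
      _ = 2 * (∫⁻ m, ‖D m‖ₑ) + ((∫⁻ m, ‖D (m * ctr h)‖ₑ) + ∫⁻ m, ‖D (m * ctr (-h))‖ₑ) := by
          rw [lintegral_add_left (hDc.measurable.enorm.const_mul 2),
            lintegral_const_mul _ hDc.measurable.enorm, lintegral_add_left]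
          exact (hDc.comp (continuous_mul_const _)).measurable.enorm
      _ ≤ 2 * ENNReal.ofReal (C * min 1 (knorm a)) + (ENNReal.ofReal (C * min 1 (knorm a)) +
            ENNReal.ofReal (C * min 1 (knorm a))) := by
          gcongr
          · exact H a
          · exact hDm h
          · exact hDm (-h)
      _ = _ := by
          rw [← two_mul, ← add_mul, show (2 : ℝ≥0∞) + 2 = ENNReal.ofReal 4 by
            rw [show (4 : ℝ) = 2 + 2 by norm_num, ENNReal.ofReal_add] <;> norm_num,
            ← ENNReal.ofReal_mul (by norm_num), mul_assoc]
  have e2 : ∫⁻ m, ‖secDiff A h (T a m) - secDiff A h m‖ₑ ≤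
      ENNReal.ofReal (2 * C₁ * min 1 ‖h‖) := by
    calc ∫⁻ m, ‖secDiff A h (T a m) - secDiff A h m‖ₑ
        ≤ ∫⁻ m, (‖secDiff A h (T a m)‖ₑ + ‖secDiff A h m‖ₑ) :=
          lintegral_mono fun m => enorm_sub_le
      _ = (∫⁻ m, ‖secDiff A h m‖ₑ) + ∫⁻ m, ‖secDiff A h m‖ₑ := by
          rw [lintegral_add_right _ hS.measurable.enorm,
            (hp a).lintegral_comp hS.measurable.enorm]
      _ ≤ ENNReal.ofReal (C₁ * min 1 ‖h‖) + ENNReal.ofReal (C₁ * min 1 ‖h‖) :=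
          add_le_add (H₁ h) (H₁ h)
      _ = _ := by
          rw [← ENNReal.ofReal_add (by positivity) (by positivity)]
          congr 1; ring
  set X := ∫⁻ m, ‖secDiff A h (T a m) - secDiff A h m‖ₑ
  set M : ℝ := 4 * C + 2 * C₁
  have hM : 0 ≤ M := by positivity
  have hh : (0 : ℝ) ≤ min 1 ‖h‖ := by positivity
  have f1 : X ≤ ENNReal.ofReal (M * knorm a) := e1.trans (ENNReal.ofReal_le_ofReal
    (mul_le_mul (by simp only [M]; linarith) (min_le_right _ _) (by positivity) hM))
  have f2 : X ≤ ENNReal.ofReal (M * min 1 ‖h‖) := e2.trans (ENNReal.ofReal_le_ofReal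
    (mul_le_mul_of_nonneg_right (by simp only [M]; linarith) hh))
  rcases le_total (knorm a) (min 1 ‖h‖) with hle | hle
  · refine f1.trans (ENNReal.ofReal_le_ofReal ?_)
    rw [mul_assoc]
    refine mul_le_mul_of_nonneg_left ?_ hM
    calc knorm a = knorm a ^ (1 / 2 : ℝ) * knorm a ^ (1 / 2 : ℝ) := by
          rw [← Real.sqrt_eq_rpow, Real.mul_self_sqrt hN]
      _ ≤ knorm a ^ (1 / 2 : ℝ) * (min 1 ‖h‖) ^ (1 / 2 : ℝ) := by gcongr
      _ ≤ _ := by gcongr; exact sqrt_min_one_norm_le_fracModulus h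
  · refine f2.trans (ENNReal.ofReal_le_ofReal ?_)
    rw [mul_assoc]
    refine mul_le_mul_of_nonneg_left ?_ hM
    calc min 1 ‖h‖ = (min 1 ‖h‖) ^ (1 / 2 : ℝ) * (min 1 ‖h‖) ^ (1 / 2 : ℝ) := by
          rw [← Real.sqrt_eq_rpow, Real.mul_self_sqrt hh]
      _ ≤ knorm a ^ (1 / 2 : ℝ) * (min 1 ‖h‖) ^ (1 / 2 : ℝ) := by gcongr
      _ ≤ _ := by gcongr; exact sqrt_min_one_norm_le_fracModulus h

theorem exists_lintegral_secDiff_mul_knorm_le : ∃ C : ℝ, 0 ≤ C ∧ ∀ h,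
    ∫⁻ m, ‖secDiff A h m‖ₑ * ENNReal.ofReal (knorm m ^ (1 / 2 : ℝ)) ≤
      ENNReal.ofReal (C * fracModulus h) := by
  obtain ⟨C, hC, H⟩ := hA.exists_lintegral_secDiff_le
  have hcont : Continuous fun m : Pt d => knorm m ^ (1 / 2 : ℝ) :=
    continuous_knorm.rpow_const fun _ => Or.inr (by norm_num)
  obtain ⟨M₀, hM₀⟩ := ((isCompact_closedBall (0 : Pt d) (R + 1)).image hcont).bddAbove
  have hM : ∀ m : Pt d, ‖m‖ ≤ R + 1 → knorm m ^ (1 / 2 : ℝ) ≤ M₀ := fun m hm =>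
    hM₀ ⟨m, by simpa using hm, rfl⟩
  have hR := hA.radius_nonneg
  have hM0 : 0 ≤ M₀ := le_trans (Real.rpow_nonneg (knorm_nonneg 0) _)
    (hM 0 (by rw [norm_zero]; positivity))
  have key : ∀ h : V d, ∃ B : ℝ, 0 ≤ B ∧ B * min 1 ‖h‖ ≤ (M₀ + 1) * fracModulus h ∧
      ∀ m, secDiff A h m ≠ 0 → knorm m ^ (1 / 2 : ℝ) ≤ B := by
    intro h
    have hsupp : ∀ m, secDiff A h m ≠ 0 → ∃ k : V d, (k = 0 ∨ ‖k‖ = ‖h‖) ∧ ‖m * ctr k‖ ≤ R := by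
      intro m hm
      by_contra! hk
      refine hm ?_
      have z : ∀ k : V d, (k = 0 ∨ ‖k‖ = ‖h‖) → A (m * ctr k) = 0 := fun k hk' => by
        by_contra hc
        exact absurd (hA.supp _ hc) (not_le.mpr (hk k hk'))
      have z0 := z 0 (Or.inl rfl)
      rw [show m * ctr (0 : V d) = m by rw [mul_ctr]; simp] at z0
      rw [secDiff_eq, z0, z h (Or.inr rfl), z (-h) (Or.inr (norm_neg h))]
      ring
    have hB : ∀ k : V d, (k = 0 ∨ ‖k‖ = ‖h‖) → ‖k‖ ≤ ‖h‖ := by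
      rintro k (rfl | hk)
      · simp
      · exact hk.le
    rcases le_total ‖h‖ 1 with h1 | h1
    · refine ⟨M₀, hM0, ?_, fun m hm => ?_⟩
      · refine mul_le_mul (by linarith) (min_one_norm_le_fracModulus h) (by positivity)
          (by positivity)
      · obtain ⟨k, hk, hk2⟩ := hsupp m hm
        refine hM m ?_
        have h2 := norm_sub_le (m * ctr k) (m * ctr k - m)
        rw [show m * ctr k - (m * ctr k - m) = m by abel, hA.norm_mul_ctr_sub] at h2
        linarith [hB k hk]
    · refine ⟨(M₀ + 1) * ‖h‖ ^ (1 / 6 : ℝ), by positivity, ?_, fun m hm => ?_⟩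
      · rw [min_eq_left h1, mul_one]
        gcongr
        refine le_trans (le_min ?_ le_rfl) (min_norm_rpow_le_fracModulus h)
        exact Real.rpow_le_self_of_one_le h1 (by norm_num)
      · obtain ⟨k, hk, hk2⟩ := hsupp m hm
        have e1 : knorm m ≤ knorm (m * ctr k) + knorm (ctr k) := by
          have := knorm_mul_le (m * ctr k) (ctr k)⁻¹
          rwa [mul_inv_cancel_right, knorm_inv] at this
        calc knorm m ^ (1 / 2 : ℝ) ≤ (knorm (m * ctr k) + knorm (ctr k)) ^ (1 / 2 : ℝ) :=
              Real.rpow_le_rpow (knorm_nonneg _) e1 (by norm_num)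
          _ ≤ knorm (m * ctr k) ^ (1 / 2 : ℝ) + knorm (ctr k) ^ (1 / 2 : ℝ) :=
              Real.rpow_add_le_add_rpow (knorm_nonneg _) (knorm_nonneg _) (by norm_num)
                (by norm_num)
          _ ≤ M₀ * ‖h‖ ^ (1 / 6 : ℝ) + ‖h‖ ^ (1 / 6 : ℝ) := by
              refine add_le_add ?_ ?_
              · refine (hM _ (by linarith)).trans (le_mul_of_one_le_right hM0 ?_)
                exact Real.one_le_rpow h1 (by norm_num)
              · rw [knorm_ctr, ← Real.rpow_mul (norm_nonneg _)]
                norm_num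
                gcongr
                exact hB k hk
          _ = _ := by ring
  refine ⟨C * (M₀ + 1), by positivity, fun h => ?_⟩
  obtain ⟨B, hB, hB1, hB2⟩ := key h
  calc ∫⁻ m, ‖secDiff A h m‖ₑ * ENNReal.ofReal (knorm m ^ (1 / 2 : ℝ))
      ≤ ∫⁻ m, ‖secDiff A h m‖ₑ * ENNReal.ofReal B := by
        refine lintegral_mono fun m => ?_
        by_cases hm : secDiff A h m = 0
        · simp [hm]
        · gcongr
          exact hB2 m hm
    _ = (∫⁻ m, ‖secDiff A h m‖ₑ) * ENNReal.ofReal B := lintegral_mul_const' _ _ ofReal_ne_top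
    _ ≤ ENNReal.ofReal (C * min 1 ‖h‖) * ENNReal.ofReal B := by gcongr; exact H h
    _ = ENNReal.ofReal (C * (B * min 1 ‖h‖)) := by
        rw [← ENNReal.ofReal_mul (by positivity)]; congr 1; ring
    _ ≤ _ := by
        rw [mul_assoc]
        exact ENNReal.ofReal_le_ofReal (mul_le_mul_of_nonneg_left hB1 hC)

end IsTestKernel

end FracKernel

section FracKernelScaling

variable {d : ℕ}

/-- Cancellation, moment and `L¹`-Hölder bounds for a kernel at unit scale. -/
structure IsUnitKernel (K : Pt d → ℝ) (C : ℝ) : Prop where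
  integrable : Integrable K
  lintegral_le : ∫⁻ m, ‖K m‖ₑ ≤ ENNReal.ofReal C
  integral_eq_zero : ∫ m, K m = 0
  moment_le : ∫⁻ m, ‖K m‖ₑ * ENNReal.ofReal (knorm m ^ (1 / 2 : ℝ)) ≤ ENNReal.ofReal C
  left_le : ∀ a, ∫⁻ m, ‖K (a * m) - K m‖ₑ ≤ ENNReal.ofReal (C * knorm a ^ (1 / 2 : ℝ))
  right_le : ∀ a, ∫⁻ m, ‖K (m * a) - K m‖ₑ ≤ ENNReal.ofReal (C * knorm a ^ (1 / 2 : ℝ))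

theorem fracMass_nonneg : 0 ≤ fracMass d :=
  integral_nonneg fun h => mul_nonneg (fracModulus_nonneg h) (fracWeight_nonneg h)

namespace IsTestKernel

variable {A : Pt d → ℝ} {L R : ℝ} (hA : IsTestKernel A L R)
include hA

theorem integrable_secDiff_mul (hd : 1 ≤ d) (m : Pt d) :
    Integrable (fun h => secDiff A h m * fracWeight d h) := by
  obtain ⟨C, hC, H⟩ := hA.exists_abs_secDiff_le
  exact integrable_secDiff_mul_fracWeight hd hA.continuous fun h => H h m

theorem exists_abs_fracDx_le (hd : 1 ≤ d) : ∃ C : ℝ, 0 ≤ C ∧ ∀ m, |fracDx A m| ≤ C := by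
  obtain ⟨C, hC, H⟩ := hA.exists_abs_secDiff_le
  exact ⟨_, mul_nonneg hC fracMass_nonneg, fun m => abs_fracDx_le hd hC fun h => H h m⟩

theorem integrable_secDiff_prod (hd : 1 ≤ d) :
    Integrable (fun q : Pt d × V d => secDiff A q.2 q.1 * fracWeight d q.2) := by
  obtain ⟨C, hC, H⟩ := hA.exists_lintegral_secDiff_le
  have hc : Continuous fun q : Pt d × V d => secDiff A q.2 q.1 :=
    (continuous_secDiff hA.continuous).comp continuous_swap
  have hm : Measurable fun q : Pt d × V d => secDiff A q.2 q.1 * fracWeight d q.2 :=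
    hc.measurable.mul (measurable_fracWeight.comp measurable_snd)
  refine ⟨hm.aestronglyMeasurable, ?_⟩
  rw [HasFiniteIntegral]
  have e := lintegral_prod (μ := (volume : Measure (Pt d))) (ν := (volume : Measure (V d))) _
    hm.enorm.aemeasurable
  refine lt_of_eq_of_lt e (lt_of_le_of_lt ?_ (ofReal_lt_top (r := C * fracMass d)))
  have := lintegral_enorm_fracIntegral_le hd (u := secDiff A) (g := fun _ => 1)
    (continuous_secDiff hA.continuous) measurable_const hC fun h => by
      simp only [mul_one]
      exact (H h).trans (ENNReal.ofReal_le_ofReal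
        (mul_le_mul_of_nonneg_left (min_one_norm_le_fracModulus h) hC))
  simpa using this

theorem integral_fracDx (hd : 1 ≤ d) : ∫ m, fracDx A m = 0 := by
  have h := integral_integral_swap (μ := (volume : Measure (Pt d))) (ν := (volume : Measure (V d)))
    (f := fun m h => secDiff A h m * fracWeight d h) (hA.integrable_secDiff_prod hd)
  refine h.trans ?_
  simp_rw [integral_mul_const, hA.integral_secDiff, zero_mul, integral_zero]

theorem exists_fracDx_comp_sub_le (hd : 1 ≤ d) {T : Pt d → Pt d → Pt d}
    (hT : ∀ a, Continuous (T a)) (hc : ∀ a m h, T a (m * ctr h) = T a m * ctr h)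
    (H : ∃ C : ℝ, 0 ≤ C ∧ ∀ a, ∫⁻ m, ‖A (T a m) - A m‖ₑ ≤ ENNReal.ofReal (C * min 1 (knorm a)))
    (hp : ∀ a, MeasurePreserving (T a)) :
    ∃ C : ℝ, 0 ≤ C ∧ ∀ a, ∫⁻ m, ‖fracDx A (T a m) - fracDx A m‖ₑ ≤
      ENNReal.ofReal (C * knorm a ^ (1 / 2 : ℝ)) := by
  obtain ⟨C₀, hC₀, H₀⟩ := H
  obtain ⟨C, hC, H⟩ := hA.exists_lintegral_secDiff_comp_sub_le hT hc hC₀ H₀ hp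
  refine ⟨C * fracMass d, mul_nonneg hC fracMass_nonneg, fun a => ?_⟩
  have hN := Real.rpow_nonneg (knorm_nonneg a) (1 / 2)
  have hcont := continuous_secDiff hA.continuous
  have hcT : Continuous fun q : V d × Pt d => secDiff A q.1 (T a q.2) :=
    hcont.comp (continuous_fst.prodMk ((hT a).comp continuous_snd))
  have := lintegral_enorm_integral_fracWeight_le hd (g := fun _ => 1)
    (u := fun h m => secDiff A h (T a m) - secDiff A h m) (hcT.sub hcont)
    measurable_const (by simp) (mul_nonneg hC hN) fun h => by simpa only [mul_one] using H a h
  simp only [mul_one] at this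
  have e : C * fracMass d * knorm a ^ (1 / 2 : ℝ) = C * knorm a ^ (1 / 2 : ℝ) * fracMass d := by
    ring
  rw [e]
  refine le_trans (le_of_eq (lintegral_congr fun m => ?_)) this
  rw [fracDx_eq, fracDx_eq, ← integral_sub (hA.integrable_secDiff_mul hd _)
    (hA.integrable_secDiff_mul hd _)]
  simp only [sub_mul]

theorem exists_isUnitKernel_fracDx (hd : 1 ≤ d) :
    ∃ C : ℝ, 0 < C ∧ IsUnitKernel (fracDx A) C ∧ ∀ m, |fracDx A m| ≤ C := by
  obtain ⟨C₁, hC₁, H₁⟩ := hA.exists_abs_fracDx_le hd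
  obtain ⟨C₂, hC₂, H₂⟩ := hA.exists_lintegral_secDiff_le
  obtain ⟨C₃, hC₃, H₃⟩ := hA.exists_lintegral_secDiff_mul_knorm_le
  obtain ⟨C₄, hC₄, H₄⟩ := hA.exists_fracDx_comp_sub_le hd (T := fun a m => a * m)
    (fun a => continuous_const_mul a) (fun a m h => (mul_assoc a m _).symm) hA.exists_left_le
    (fun a => measurePreserving_mul_left volume a)
  obtain ⟨C₅, hC₅, H₅⟩ := hA.exists_fracDx_comp_sub_le hd (T := fun a m => m * a)
    (fun a => continuous_mul_const a)
    (fun a m h => by rw [mul_assoc, ctr_mul, mul_assoc]) hA.exists_right_le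
    (fun a => measurePreserving_mul_right volume a)
  have hF : 0 ≤ fracMass d := fracMass_nonneg
  have hK₁ : ∫⁻ m, ‖fracDx A m‖ₑ ≤ ENNReal.ofReal (C₂ * fracMass d) := by
    have := lintegral_enorm_integral_fracWeight_le hd (u := secDiff A) (g := fun _ => 1)
      (continuous_secDiff hA.continuous) measurable_const (by simp) hC₂ fun h => by
        simp only [mul_one]
        exact (H₂ h).trans (ENNReal.ofReal_le_ofReal
          (mul_le_mul_of_nonneg_left (min_one_norm_le_fracModulus h) hC₂))
    simp only [mul_one] at this
    exact this
  have hK₂ : ∫⁻ m, ‖fracDx A m‖ₑ * ENNReal.ofReal (knorm m ^ (1 / 2 : ℝ)) ≤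
      ENNReal.ofReal (C₃ * fracMass d) :=
    lintegral_enorm_integral_fracWeight_le hd (u := secDiff A)
      (continuous_secDiff hA.continuous)
      (ENNReal.measurable_ofReal.comp (continuous_knorm.measurable.pow_const _)) (by simp) hC₃ H₃
  set C : ℝ := C₁ + C₂ * fracMass d + C₃ * fracMass d + C₄ + C₅ + 1 with hC
  have n2 : 0 ≤ C₂ * fracMass d := by positivity
  have n3 : 0 ≤ C₃ * fracMass d := by positivity
  refine ⟨C, by positivity, ⟨?_, ?_, hA.integral_fracDx hd, ?_, ?_, ?_⟩, fun m => ?_⟩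
  · exact ⟨(stronglyMeasurable_fracDx hA.continuous).aestronglyMeasurable,
      hK₁.trans_lt ofReal_lt_top⟩
  · exact hK₁.trans (ENNReal.ofReal_le_ofReal (by linarith))
  · exact hK₂.trans (ENNReal.ofReal_le_ofReal (by linarith))
  · exact fun a => (H₄ a).trans (ENNReal.ofReal_le_ofReal
      (mul_le_mul_of_nonneg_right (by linarith) (Real.rpow_nonneg (knorm_nonneg a) _)))
  · exact fun a => (H₅ a).trans (ENNReal.ofReal_le_ofReal
      (mul_le_mul_of_nonneg_right (by linarith) (Real.rpow_nonneg (knorm_nonneg a) _)))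
  · exact (H₁ m).trans (by linarith)

end IsTestKernel

/-- The `L¹`-normalised dilate of a kernel. -/
def dilKernel (r : ℝ) (K : Pt d → ℝ) (m : Pt d) : ℝ := r ^ (-(4 * (d : ℝ) + 2)) * K (dil r⁻¹ m)

theorem lintegral_dilKernel {r : ℝ} (hr : 0 < r) (g : Pt d → ℝ≥0∞) :
    ∫⁻ m, ENNReal.ofReal (r ^ (-(4 * (d : ℝ) + 2))) * g (dil r⁻¹ m) = ∫⁻ m, g m := by
  rw [lintegral_const_mul' _ _ ofReal_ne_top, lintegral_dil (inv_pos.mpr hr), ← mul_assoc,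
    ← ENNReal.ofReal_mul (by positivity), Real.inv_rpow hr.le,
    mul_inv_cancel₀ (by positivity), ENNReal.ofReal_one, one_mul]

theorem integral_dilKernel {r : ℝ} (hr : 0 < r) (K : Pt d → ℝ) :
    ∫ m, dilKernel r K m = ∫ m, K m := by
  unfold dilKernel
  rw [integral_const_mul, integral_dil (inv_pos.mpr hr), ← mul_assoc, Real.inv_rpow hr.le,
    mul_inv_cancel₀ (by positivity), one_mul]

theorem integrable_dilKernel {r : ℝ} (hr : 0 < r) {K : Pt d → ℝ} (hK : Integrable K) :
    Integrable (dilKernel r K) :=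
  (integrable_comp_dil (inv_pos.mpr hr) hK).const_mul _

theorem enorm_dilKernel {r : ℝ} (hr : 0 < r) (K : Pt d → ℝ) (m : Pt d) :
    ‖dilKernel r K m‖ₑ = ENNReal.ofReal (r ^ (-(4 * (d : ℝ) + 2))) * ‖K (dil r⁻¹ m)‖ₑ := by
  rw [dilKernel, enorm_mul, Real.enorm_eq_ofReal (by positivity)]

theorem lintegral_enorm_dilKernel {r : ℝ} (hr : 0 < r) (K : Pt d → ℝ) :
    ∫⁻ m, ‖dilKernel r K m‖ₑ = ∫⁻ m, ‖K m‖ₑ := by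
  simp_rw [enorm_dilKernel hr]
  exact lintegral_dilKernel hr fun m => ‖K m‖ₑ

namespace IsUnitKernel

variable {K : Pt d → ℝ} {C : ℝ} (hK : IsUnitKernel K C)
include hK

theorem isDyadicKernel : IsDyadicKernel volume knorm (1 / 2) C (fun j : ℤ => dilKernel (2 ^ j) K) := by
  have hr : ∀ j : ℤ, (0 : ℝ) < 2 ^ j := fun j => by positivity
  have hd : ∀ (j : ℤ) (h : Pt d), knorm (dil (2 ^ j : ℝ)⁻¹ h) = knorm h / 2 ^ j := fun j h => by
    rw [knorm_dil (inv_pos.mpr (hr j)), div_eq_inv_mul]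
  refine ⟨fun j => integrable_dilKernel (hr j) hK.integrable, fun j => ?_, fun j => ?_,
    fun j => ?_, fun j h => ?_, fun j h => ?_⟩
  · rw [lintegral_enorm_dilKernel (hr j)]; exact hK.lintegral_le
  · rw [integral_dilKernel (hr j)]; exact hK.integral_eq_zero
  · have e : ∀ m : Pt d, ‖dilKernel (2 ^ j) K m‖ₑ * ENNReal.ofReal (knorm m ^ (1 / 2 : ℝ)) =
        (ENNReal.ofReal ((2 ^ j : ℝ) ^ (-(4 * (d : ℝ) + 2))) *
          (fun n => ‖K n‖ₑ * ENNReal.ofReal (knorm n ^ (1 / 2 : ℝ))) (dil (2 ^ j : ℝ)⁻¹ m)) *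
          ENNReal.ofReal ((2 ^ j : ℝ) ^ (1 / 2 : ℝ)) := by
      intro m
      have : knorm m ^ (1 / 2 : ℝ) =
          knorm (dil (2 ^ j : ℝ)⁻¹ m) ^ (1 / 2 : ℝ) * (2 ^ j : ℝ) ^ (1 / 2 : ℝ) := by
        rw [← Real.mul_rpow (knorm_nonneg _) (hr j).le, hd, div_mul_cancel₀ _ (hr j).ne']
      rw [this, ENNReal.ofReal_mul (Real.rpow_nonneg (knorm_nonneg _) _), enorm_dilKernel (hr j)]
      ring
    rw [lintegral_congr e, lintegral_mul_const' _ _ ofReal_ne_top, lintegral_dilKernel (hr j)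
      (fun n => ‖K n‖ₑ * ENNReal.ofReal (knorm n ^ (1 / 2 : ℝ)))]
    refine le_trans (mul_le_mul_left hK.moment_le _) (le_of_eq ?_)
    rw [← ENNReal.ofReal_mul' (by positivity)]
  · have e : ∀ m : Pt d, ‖dilKernel (2 ^ j) K (h * m) - dilKernel (2 ^ j) K m‖ₑ =
        ENNReal.ofReal ((2 ^ j : ℝ) ^ (-(4 * (d : ℝ) + 2))) *
          (fun n => ‖K (dil (2 ^ j : ℝ)⁻¹ h * n) - K n‖ₑ) (dil (2 ^ j : ℝ)⁻¹ m) := by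
      intro m
      rw [dilKernel, dilKernel, ← mul_sub, enorm_mul, Real.enorm_eq_ofReal (by positivity), dil_mul]
    rw [lintegral_congr e, lintegral_dilKernel (hr j)
      (fun n => ‖K (dil (2 ^ j : ℝ)⁻¹ h * n) - K n‖ₑ), ← hd]
    exact hK.left_le _
  · have e : ∀ m : Pt d, ‖dilKernel (2 ^ j) K (m * h) - dilKernel (2 ^ j) K m‖ₑ =
        ENNReal.ofReal ((2 ^ j : ℝ) ^ (-(4 * (d : ℝ) + 2))) *
          (fun n => ‖K (n * dil (2 ^ j : ℝ)⁻¹ h) - K n‖ₑ) (dil (2 ^ j : ℝ)⁻¹ m) := by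
      intro m
      rw [dilKernel, dilKernel, ← mul_sub, enorm_mul, Real.enorm_eq_ofReal (by positivity), dil_mul]
    rw [lintegral_congr e, lintegral_dilKernel (hr j)
      (fun n => ‖K (n * dil (2 ^ j : ℝ)⁻¹ h) - K n‖ₑ), ← hd]
    exact hK.right_le _

theorem isFractionalKernel (hb : ∀ m, |K m| ≤ C) :
    IsFractionalKernel volume (4 * (d : ℝ) + 2) C
      (fun (j : ℤ) m => 2 ^ j * dilKernel (2 ^ j) K m) := by
  have hr : ∀ j : ℤ, (0 : ℝ) < 2 ^ j := fun j => by positivity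
  refine ⟨fun j => ((integrable_dilKernel (hr j) hK.integrable).const_mul _).aestronglyMeasurable,
    fun j => ?_, fun j m => ?_⟩
  · simp_rw [enorm_mul]
    rw [lintegral_const_mul' _ _ enorm_ne_top, lintegral_enorm_dilKernel (hr j),
      Real.enorm_eq_ofReal (hr j).le, ENNReal.ofReal_mul' (hr j).le, mul_comm]
    gcongr
    exact hK.lintegral_le
  · rw [← ofReal_norm]
    refine ENNReal.ofReal_le_ofReal ?_
    rw [dilKernel, norm_mul, norm_mul, Real.norm_of_nonneg (hr j).le,
      Real.norm_of_nonneg (by positivity), ← mul_assoc, mul_comm, Real.norm_eq_abs,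
      sub_eq_add_neg, Real.rpow_add (hr j), Real.rpow_one]
    exact mul_le_mul_of_nonneg_right (hb _) (by positivity)

end IsUnitKernel

end FracKernelScaling

section FracConvolution

variable {d : ℕ}

/-- Absolute convergence of the integral defining `fracDx u z`. -/
def FracIntegrable (u : Pt d → ℝ) (z : Pt d) : Prop :=
  Integrable fun h => secDiff u h z * fracWeight d h

namespace FracIntegrable

variable {u v : Pt d → ℝ} {z : Pt d}

theorem secDiff_add (u v : Pt d → ℝ) (h : V d) (z : Pt d) :
    secDiff (fun z => u z + v z) h z = secDiff u h z + secDiff v h z := by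
  simp only [secDiff]; ring

theorem add (hu : FracIntegrable u z) (hv : FracIntegrable v z) :
    FracIntegrable (fun z => u z + v z) z := by
  have := Integrable.add hu hv
  refine this.congr (Filter.Eventually.of_forall fun h => ?_)
  simp only [Pi.add_apply, secDiff_add]; ring

theorem fracDx_add (hu : FracIntegrable u z) (hv : FracIntegrable v z) :
    fracDx (fun z => u z + v z) z = fracDx u z + fracDx v z := by
  simp only [fracDx_eq, secDiff_add, add_mul]
  exact integral_add hu hv

theorem fracDx_sub (hu : FracIntegrable u z) (hv : FracIntegrable v z) :
    fracDx (fun z => u z - v z) z = fracDx u z - fracDx v z := by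
  have e : ∀ h, secDiff (fun z => u z - v z) h z = secDiff u h z - secDiff v h z := fun h => by
    simp only [secDiff]; ring
  simp only [fracDx_eq, e, sub_mul]
  exact integral_sub hu hv

theorem zero : FracIntegrable (fun _ : Pt d => (0 : ℝ)) z := by
  simp [FracIntegrable, secDiff]

theorem fracDx_zero : fracDx (fun _ : Pt d => (0 : ℝ)) z = 0 := by
  simp [fracDx_eq, secDiff]

theorem const_mul (hu : FracIntegrable u z) (c : ℝ) : FracIntegrable (fun z => c * u z) z := by
  refine (Integrable.const_mul hu c).congr (Filter.Eventually.of_forall fun h => ?_)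
  simp only [secDiff]; ring

theorem sum {ι : Type*} (s : Finset ι) {u : ι → Pt d → ℝ} (hu : ∀ i ∈ s, FracIntegrable (u i) z) :
    FracIntegrable (fun z => ∑ i ∈ s, u i z) z ∧
      fracDx (fun z => ∑ i ∈ s, u i z) z = ∑ i ∈ s, fracDx (u i) z := by
  classical
  induction s using Finset.induction_on with
  | empty => simpa using ⟨zero, fracDx_zero⟩
  | insert a s ha ih =>
    have h1 := hu a (Finset.mem_insert_self _ _)
    have h2 := ih fun i hi => hu i (Finset.mem_insert_of_mem hi)
    simp only [Finset.sum_insert ha]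
    exact ⟨h1.add h2.1, by rw [fracDx_add h1 h2.1, h2.2]⟩

end FracIntegrable

theorem fracDx_const_mul (c : ℝ) (u : Pt d → ℝ) (z : Pt d) :
    fracDx (fun z => c * u z) z = c * fracDx u z := by
  simp only [fracDx_eq]
  rw [← integral_const_mul]
  refine integral_congr_ae (Filter.Eventually.of_forall fun h => ?_)
  simp only [secDiff]; ring

theorem fracDx_comp_dil {r : ℝ} (hr : 0 < r) (u : Pt d → ℝ) (z : Pt d) :
    fracDx (fun z => u (dil r z)) z = r * fracDx u (dil r z) := by
  have h := Measure.integral_comp_smul_of_nonneg (volume : Measure (V d))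
    (fun h => secDiff u h (dil r z) * fracWeight d h) (r ^ 3) (hR := by positivity)
  rw [finrank_euclideanSpace, Fintype.card_fin, smul_eq_mul] at h
  have h' : fracDx u (dil r z) = (r ^ 3) ^ d *
      ∫ h, secDiff u (r ^ 3 • h) (dil r z) * fracWeight d (r ^ 3 • h) := by
    rw [h, ← mul_assoc, mul_inv_cancel₀ (by positivity), one_mul, fracDx_eq]
  rw [h', ← mul_assoc, ← integral_const_mul, fracDx_eq]
  refine integral_congr_ae (Filter.Eventually.of_forall fun h => ?_)
  have e1 : secDiff (fun z => u (dil r z)) h z = secDiff u (r ^ 3 • h) (dil r z) := by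
    simp only [secDiff, dil, smul_add, smul_sub]
  have e2 : fracWeight d h = r * (r ^ 3) ^ d * fracWeight d (r ^ 3 • h) := by
    rw [fracWeight, fracWeight, norm_smul, Real.norm_of_nonneg (by positivity),
      Real.mul_rpow (by positivity) (norm_nonneg _), ← mul_assoc]
    have : r * (r ^ 3) ^ d * (r ^ 3) ^ (-(d : ℝ) - 1 / 3) = 1 := by
      rw [← pow_mul, ← Real.rpow_natCast, ← Real.rpow_natCast, ← Real.rpow_mul hr.le]
      nth_rewrite 1 [← Real.rpow_one r]
      rw [← Real.rpow_add hr, ← Real.rpow_add hr]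
      have : (1 : ℝ) + ((3 * d : ℕ) : ℝ) + ((3 : ℕ) : ℝ) * (-(d : ℝ) - 1 / 3) = 0 := by
        push_cast; ring
      rw [this, Real.rpow_zero]
    rw [this, one_mul]
  simp only [e1, e2]; ring

theorem fracDx_dilKernel {r : ℝ} (hr : 0 < r) (K : Pt d → ℝ) (z : Pt d) :
    fracDx (dilKernel r K) z = r⁻¹ * dilKernel r (fracDx K) z := by
  have := fracDx_const_mul (r ^ (-(4 * (d : ℝ) + 2))) (fun z => K (dil r⁻¹ z)) z
  rw [show dilKernel r K = fun z => r ^ (-(4 * (d : ℝ) + 2)) * K (dil r⁻¹ z) from rfl, this,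
    fracDx_comp_dil (inv_pos.mpr hr), dilKernel]
  ring

theorem rconv_dilKernel {r : ℝ} (hr : 0 < r) (K S : Pt d → ℝ) (z : Pt d) :
    rconv volume (dilKernel r K) S z = ∫ m, K m * S (z * dil r m) := by
  rw [← integral_dilKernel hr]
  refine integral_congr_ae (Filter.Eventually.of_forall fun m => ?_)
  simp only [dilKernel]
  rw [dil_dil_inv hr.ne', mul_assoc]

theorem norm_dil_le {r : ℝ} (hr : 0 ≤ r) (m : Pt d) : ‖dil r m‖ ≤ (r + r ^ 2 + r ^ 3) * ‖m‖ := by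
  have c1 : |m.1| ≤ ‖m‖ := norm_fst_le m
  have c2 : ‖m.2.1‖ ≤ ‖m‖ := (norm_fst_le m.2).trans (norm_snd_le m)
  have c3 : ‖m.2.2‖ ≤ ‖m‖ := (norm_snd_le m.2).trans (norm_snd_le m)
  have hm := norm_nonneg m
  rw [dil, Prod.norm_def, Prod.norm_def]
  refine max_le ?_ (max_le ?_ ?_)
  · simp only [norm_mul, norm_pow, Real.norm_eq_abs, abs_of_nonneg hr]
    exact mul_le_mul (by nlinarith [pow_nonneg hr 3]) c1 (abs_nonneg _) (by positivity)
  · simp only [norm_smul, norm_pow, Real.norm_eq_abs, abs_of_nonneg hr]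
    exact mul_le_mul (by nlinarith [pow_nonneg hr 2]) c2 (norm_nonneg _) (by positivity)
  · simp only [norm_smul, Real.norm_eq_abs, abs_of_nonneg hr]
    exact mul_le_mul (by nlinarith [pow_nonneg hr 2, pow_nonneg hr 3]) c3 (norm_nonneg _)
      (by positivity)

theorem dil_sub (r : ℝ) (m n : Pt d) : dil r m - dil r n = dil r (m - n) := by
  simp only [dil, Prod.mk_sub_mk, Prod.fst_sub, Prod.snd_sub, smul_sub, mul_sub]

theorem IsTestKernel.const_mul_comp_dil {A : Pt d → ℝ} {L R : ℝ} (hA : IsTestKernel A L R) (c : ℝ)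
    {r : ℝ} (hr : 0 < r) :
    IsTestKernel (fun m => c * A (dil r m)) (|c| * (L * (r + r ^ 2 + r ^ 3)))
      ((r⁻¹ + r⁻¹ ^ 2 + r⁻¹ ^ 3) * R) where
  lip_nonneg := by have := hA.lip_nonneg; positivity
  radius_nonneg := by have := hA.radius_nonneg; positivity
  lip m n := by
    rw [← mul_sub, abs_mul, mul_assoc]
    refine mul_le_mul_of_nonneg_left ((hA.lip _ _).trans ?_) (abs_nonneg c)
    rw [dil_sub, mul_assoc]
    exact mul_le_mul_of_nonneg_left (norm_dil_le hr.le _) hA.lip_nonneg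
  supp m hm := by
    have h1 := hA.supp _ (right_ne_zero_of_mul hm)
    have h2 := norm_dil_le (inv_pos.mpr hr).le (dil r m)
    rw [dil_inv_dil hr.ne'] at h2
    exact h2.trans (mul_le_mul_of_nonneg_left h1 (by positivity))

theorem IsTestKernel.dilKernel {A : Pt d → ℝ} {L R : ℝ} (hA : IsTestKernel A L R)
    {r : ℝ} (hr : 0 < r) : ∃ L' R', IsTestKernel (dilKernel r A) L' R' :=
  ⟨_, _, hA.const_mul_comp_dil _ (inv_pos.mpr hr)⟩

section BoundedFunction

variable {S : Pt d → ℝ} {M : ℝ} (hS : Continuous S) (hM : ∀ z, |S z| ≤ M)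
include hS hM

theorem integrable_mul_comp_mul {K : Pt d → ℝ} (hK : Integrable K) (z : Pt d) :
    Integrable fun m => K m * S (z * m) :=
  hK.mul_bdd (hS.comp (continuous_const_mul z)).aestronglyMeasurable
    (Filter.Eventually.of_forall fun _ => hM _)

theorem secDiff_rconv {A : Pt d → ℝ} {L R : ℝ} (hA : IsTestKernel A L R) (h : V d) (z : Pt d) :
    secDiff (rconv volume A S) h z = ∫ m, secDiff A h m * S (z * m) := by
  have key : ∀ k : V d, rconv volume A S (z * ctr k) = ∫ m, A (m * ctr (-k)) * S (z * m) := by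
    intro k
    rw [← integral_mul_right_eq_self (fun m => A (m * ctr (-k)) * S (z * m)) (ctr k)]
    refine integral_congr_ae (Filter.Eventually.of_forall fun m => ?_)
    beta_reduce
    rw [← ctr_inv, mul_inv_cancel_right, mul_assoc, ctr_mul]
  have i : ∀ k : V d, Integrable fun m => A (m * ctr k) * S (z * m) := fun k =>
    integrable_mul_comp_mul hS hM (hA.integrable.comp_mul_right _) z
  have i0 : Integrable fun m => A m * S (z * m) := integrable_mul_comp_mul hS hM hA.integrable z
  have i1 : Integrable fun m => 2 * (A m * S (z * m)) - A (m * ctr h) * S (z * m) :=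
    (i0.const_mul 2).sub (i h)
  rw [secDiff_eq, key, key, neg_neg, rconv, sub_right_comm]
  simp only [secDiff_eq, sub_mul, mul_assoc]
  rw [integral_sub i1 (i _), integral_sub (i0.const_mul 2) (i _), integral_const_mul]

theorem integrable_secDiff_mul_comp_mul (hd : 1 ≤ d) {A : Pt d → ℝ} {L R : ℝ}
    (hA : IsTestKernel A L R) (z : Pt d) :
    Integrable (fun q : Pt d × V d => secDiff A q.2 q.1 * S (z * q.1) * fracWeight d q.2) := by
  have h := (hA.integrable_secDiff_prod hd).mul_bdd
    (g := fun q : Pt d × V d => S (z * q.1)) (c := M)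
    ((hS.comp (continuous_const_mul z)).comp continuous_fst).aestronglyMeasurable
    (Filter.Eventually.of_forall fun _ => hM _)
  refine h.congr (Filter.Eventually.of_forall fun q => ?_)
  beta_reduce; ring

theorem fracIntegrable_rconv (hd : 1 ≤ d) {A : Pt d → ℝ} {L R : ℝ}
    (hA : IsTestKernel A L R) (z : Pt d) : FracIntegrable (rconv volume A S) z := by
  have := (integrable_secDiff_mul_comp_mul hS hM hd hA z).integral_prod_right
  refine this.congr (Filter.Eventually.of_forall fun h => ?_)
  beta_reduce
  rw [secDiff_rconv hS hM hA, ← integral_mul_const]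

theorem fracDx_rconv (hd : 1 ≤ d) {A : Pt d → ℝ} {L R : ℝ}
    (hA : IsTestKernel A L R) (z : Pt d) :
    fracDx (rconv volume A S) z = rconv volume (fracDx A) S z := by
  have h := integral_integral_swap (μ := (volume : Measure (Pt d))) (ν := (volume : Measure (V d)))
    (f := fun m h => secDiff A h m * S (z * m) * fracWeight d h)
    (integrable_secDiff_mul_comp_mul hS hM hd hA z)
  rw [fracDx_eq, rconv]
  simp only [secDiff_rconv hS hM hA, ← integral_mul_const]
  rw [← h]
  refine integral_congr_ae (Filter.Eventually.of_forall fun m => ?_)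
  beta_reduce
  rw [fracDx_eq, ← integral_mul_const]
  refine integral_congr_ae (Filter.Eventually.of_forall fun m => ?_)
  beta_reduce; ring

theorem fracDx_rconv_dilKernel (hd : 1 ≤ d) {A : Pt d → ℝ} {L R : ℝ}
    (hA : IsTestKernel A L R) {r : ℝ} (hr : 0 < r) (z : Pt d) :
    FracIntegrable (rconv volume (dilKernel r A) S) z ∧
    fracDx (rconv volume (dilKernel r A) S) z =
      r⁻¹ * rconv volume (dilKernel r (fracDx A)) S z := by
  obtain ⟨L', R', h⟩ := hA.dilKernel hr
  refine ⟨fracIntegrable_rconv hS hM hd h z, ?_⟩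
  rw [fracDx_rconv hS hM hd h, rconv, rconv, ← integral_const_mul]
  refine integral_congr_ae (Filter.Eventually.of_forall fun m => ?_)
  beta_reduce
  rw [fracDx_dilKernel hr, mul_assoc]

theorem abs_rconv_dilKernel_le {K : Pt d → ℝ} (hK : Integrable K) {r : ℝ} (hr : 0 < r)
    (z : Pt d) : |rconv volume (dilKernel r K) S z| ≤ (∫ m, |K m|) * M := by
  rw [rconv_dilKernel hr, ← Real.norm_eq_abs, ← integral_mul_const]
  refine norm_integral_le_of_norm_le (hK.abs.mul_const M) (Filter.Eventually.of_forall fun m => ?_)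
  rw [norm_mul, Real.norm_eq_abs, Real.norm_eq_abs]
  exact mul_le_mul_of_nonneg_left (hM _) (abs_nonneg _)

theorem tendsto_fracDx_rconv_dilKernel_atTop (hd : 1 ≤ d) {A : Pt d → ℝ} {L R : ℝ}
    (hA : IsTestKernel A L R) (z : Pt d) :
    Filter.Tendsto (fun n : ℕ => fracDx (rconv volume (dilKernel ((2 : ℝ) ^ (n : ℤ)) A) S) z)
      Filter.atTop (nhds 0) := by
  obtain ⟨C, hC, hK, -⟩ := hA.exists_isUnitKernel_fracDx hd
  set B : ℝ := (∫ m, |fracDx A m|) * M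
  have h0 : Filter.Tendsto (fun n : ℕ => ((1 / 2 : ℝ) ^ n) * B) Filter.atTop (nhds 0) := by
    have := (tendsto_pow_atTop_nhds_zero_of_lt_one (r := (1 / 2 : ℝ)) (by norm_num)
      (by norm_num)).mul_const B
    rwa [zero_mul] at this
  refine squeeze_zero_norm (fun n => ?_) h0
  have hr : (0 : ℝ) < 2 ^ (n : ℤ) := by positivity
  rw [(fracDx_rconv_dilKernel hS hM hd hA hr z).2, norm_mul, Real.norm_eq_abs, Real.norm_eq_abs,
    abs_of_pos (inv_pos.mpr hr), zpow_natCast, ← inv_pow, inv_eq_one_div, ← zpow_natCast 2]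
  exact mul_le_mul_of_nonneg_left (abs_rconv_dilKernel_le hS hM hK.integrable hr z) (by positivity)

end BoundedFunction

end FracConvolution

section Approximation

variable {d : ℕ} {f : Pt d → ℝ} {M L : ℝ}

theorem abs_secDiff_le_of_lipschitz (hM : ∀ z, |f z| ≤ M) (hL : ∀ m n, |f m - f n| ≤ L * ‖m - n‖)
    (h : V d) (z : Pt d) : |secDiff f h z| ≤ (4 * M + 2 * L) * min 1 ‖h‖ := by
  have n : ∀ k : V d, ‖z * ctr k - z‖ = ‖k‖ := fun k => by
    have : z * ctr k - z = (0, k, 0) := by rw [mul_ctr]; simp [Prod.ext_iff]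
    rw [this, Prod.norm_def, Prod.norm_def]; simp
  have hM0 : 0 ≤ M := (abs_nonneg _).trans (hM z)
  have e1 := hL (z * ctr h) z
  have e2 := hL (z * ctr (-h)) z
  rw [n] at e1 e2
  rw [norm_neg] at e2
  rw [secDiff_eq]
  rcases le_total ‖h‖ 1 with h1 | h1
  · rw [min_eq_right h1]
    have : 0 ≤ 4 * M * ‖h‖ := by positivity
    rw [abs_le] at e1 e2 ⊢
    constructor <;> linarith
  · rw [min_eq_left h1]
    have hL0 : 0 ≤ L := by
      by_contra hc
      have := (abs_nonneg _).trans e1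
      nlinarith
    have f1 := hM z
    have f2 := hM (z * ctr h)
    have f3 := hM (z * ctr (-h))
    rw [abs_le] at f1 f2 f3 ⊢
    constructor <;> linarith

theorem secDiff_rconv_dilKernel (hf : Continuous f) (hM : ∀ z, |f z| ≤ M) {φ : Pt d → ℝ}
    (hφ : Integrable φ) {r : ℝ} (hr : 0 < r) (h : V d) (z : Pt d) :
    secDiff (rconv volume (dilKernel r φ) f) h z = ∫ m, φ m * secDiff f h (z * dil r m) := by
  have i : ∀ z : Pt d, Integrable fun m => φ m * f (z * dil r m) := fun z =>
    hφ.mul_bdd (hf.comp (by fun_prop)).aestronglyMeasurable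
      (Filter.Eventually.of_forall fun m => hM _)
  have e : ∀ m, φ m * secDiff f h (z * dil r m) = 2 * (φ m * f (z * dil r m)) -
      φ m * f (z * ctr h * dil r m) - φ m * f (z * ctr (-h) * dil r m) := fun m => by
    rw [secDiff_eq, mul_assoc z, mul_assoc z, ← ctr_mul, ← ctr_mul, mul_assoc, ctr_mul, mul_assoc,
      ctr_mul, ← mul_assoc, ← mul_assoc, mul_sub, mul_sub]
    ring
  have i1 : Integrable fun m => 2 * (φ m * f (z * dil r m)) - φ m * f (z * ctr h * dil r m) :=
    ((i z).const_mul 2).sub (i _)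
  rw [secDiff_eq, rconv_dilKernel hr, rconv_dilKernel hr, rconv_dilKernel hr]
  simp only [e]
  rw [integral_sub i1 (i _), integral_sub ((i z).const_mul 2) (i _), integral_const_mul]

theorem tendsto_rconv_dilKernel_nhds_zero (hf : Continuous f) (hM : ∀ z, |f z| ≤ M) {φ : Pt d → ℝ}
    (hφ : Integrable φ) (hφ1 : ∫ m, φ m = 1) {r : ℕ → ℝ} (hr : ∀ n, 0 < r n)
    (hr0 : Filter.Tendsto r Filter.atTop (nhds 0)) (z : Pt d) :
    Filter.Tendsto (fun n => rconv volume (dilKernel (r n) φ) f z) Filter.atTop (nhds (f z)) := by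
  simp only [rconv_dilKernel (hr _)]
  have e : f z = ∫ m, φ m * f z := by rw [integral_mul_const, hφ1, one_mul]
  rw [e]
  refine tendsto_integral_of_dominated_convergence (fun m => |φ m| * M) (fun n => ?_)
    (hφ.abs.mul_const M) (fun n => Filter.Eventually.of_forall fun m => ?_)
    (Filter.Eventually.of_forall fun m => ?_)
  · exact hφ.1.mul (hf.comp (by fun_prop)).aestronglyMeasurable
  · rw [norm_mul, Real.norm_eq_abs, Real.norm_eq_abs]
    exact mul_le_mul_of_nonneg_left (hM _) (abs_nonneg _)
  · have hc : Continuous fun s : ℝ => φ m * f (z * dil s m) := by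
      refine continuous_const.mul (hf.comp (continuous_const.mul ?_))
      unfold dil; fun_prop
    have := (hc.tendsto 0).comp hr0
    have e0 : z * dil 0 m = z := by simp [dil, kinetic_mul_def]
    rwa [e0] at this

theorem tendsto_fracDx_rconv_dilKernel_nhds_zero (hd : 1 ≤ d) (hf : Continuous f)
    (hM : ∀ z, |f z| ≤ M) (hL : ∀ m n, |f m - f n| ≤ L * ‖m - n‖) {φ : Pt d → ℝ}
    (hφ : Integrable φ) (hφ1 : ∫ m, φ m = 1) {r : ℕ → ℝ} (hr : ∀ n, 0 < r n)
    (hr0 : Filter.Tendsto r Filter.atTop (nhds 0)) (z : Pt d) :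
    Filter.Tendsto (fun n => fracDx (rconv volume (dilKernel (r n) φ) f) z) Filter.atTop
      (nhds (fracDx f z)) := by
  set B : ℝ := (∫ m, |φ m|) * |4 * M + 2 * L| with hB
  have key : ∀ (n : ℕ) (h : V d), |secDiff (rconv volume (dilKernel (r n) φ) f) h z| ≤
      B * fracModulus h := by
    intro n h
    rw [secDiff_rconv_dilKernel hf hM hφ (hr n), ← Real.norm_eq_abs, hB, mul_assoc,
      ← integral_mul_const]
    refine norm_integral_le_of_norm_le (hφ.abs.mul_const _)
      (Filter.Eventually.of_forall fun m => ?_)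
    rw [norm_mul, Real.norm_eq_abs, Real.norm_eq_abs]
    refine mul_le_mul_of_nonneg_left ((abs_secDiff_le_of_lipschitz hM hL h _).trans ?_)
      (abs_nonneg _)
    exact mul_le_mul (le_abs_self _) (min_one_norm_le_fracModulus h) (by positivity)
      (abs_nonneg _)
  have hcont : ∀ (n : ℕ), Continuous fun h : V d =>
      secDiff (rconv volume (dilKernel (r n) φ) f) h z := by
    intro n
    simp only [secDiff_rconv_dilKernel hf hM hφ (hr n)]
    have : Continuous fun h : V d => ∫ m, φ m * secDiff f h (z * dil (r n) m) := by
      refine continuous_of_dominated (bound := fun m => |φ m| * (|4 * M + 2 * L| * 1))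
        (fun h => ?_) (fun h => Filter.Eventually.of_forall fun m => ?_)
        (hφ.abs.mul_const _) (Filter.Eventually.of_forall fun m => ?_)
      · refine hφ.1.mul (Continuous.aestronglyMeasurable ?_)
        exact (continuous_secDiff hf).comp (continuous_const.prodMk (by fun_prop))
      · rw [norm_mul, Real.norm_eq_abs, Real.norm_eq_abs]
        refine mul_le_mul_of_nonneg_left ((abs_secDiff_le_of_lipschitz hM hL h _).trans ?_)
          (abs_nonneg _)
        exact mul_le_mul (le_abs_self _) (min_le_left _ _) (by positivity) (abs_nonneg _)
      · exact continuous_const.mul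
          ((continuous_secDiff hf).comp (continuous_id.prodMk continuous_const))
    exact this
  simp only [fracDx_eq]
  refine tendsto_integral_of_dominated_convergence (fun h => B * (fracModulus h * fracWeight d h))
    (fun n => ((hcont n).measurable.mul measurable_fracWeight).aestronglyMeasurable)
    ((integrable_fracModulus_mul_fracWeight hd).const_mul B)
    (fun n => Filter.Eventually.of_forall fun h => ?_) (Filter.Eventually.of_forall fun h => ?_)
  · rw [norm_mul, Real.norm_eq_abs, Real.norm_of_nonneg (fracWeight_nonneg h), ← mul_assoc]
    exact mul_le_mul_of_nonneg_right (key n h) (fracWeight_nonneg h)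
  · have t := fun z => tendsto_rconv_dilKernel_nhds_zero hf hM hφ hφ1 hr hr0 z
    exact ((((t z).const_mul 2).sub (t _)).sub (t _)).mul_const _

end Approximation

section TransportIdentity

open scoped ContDiff

variable {d : ℕ}

/-- Unit vector in the `i`-th spatial direction. -/
def spaceDir (i : Fin d) : Pt d := (0, EuclideanSpace.single i 1, 0)

/-- Unit vector in the `i`-th velocity direction. -/
def velDir (i : Fin d) : Pt d := (0, 0, EuclideanSpace.single i 1)

/-- Direction of free transport `∂_t + v·∇_x` at a point. -/
def transDir (m : Pt d) : Pt d := (1, m.2.2, 0)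

/-- Generator of the kinetic dilations. -/
def eulerDir (m : Pt d) : Pt d := (2 * m.1, (3 : ℝ) • m.2.1, m.2.2)

theorem sum_smul_single (w : V d) : ∑ i, w i • EuclideanSpace.single i (1 : ℝ) = w := by
  ext j
  simp [Finset.sum_apply, Pi.single_apply]

theorem sum_smul_spaceDir (w : V d) : ∑ i, w i • spaceDir i = ((0, w, 0) : Pt d) := by
  have h := sum_smul_single w
  refine Prod.ext ?_ (Prod.ext ?_ ?_)
  · simp [spaceDir, Prod.fst_sum]
  · simpa [spaceDir, Prod.fst_sum, Prod.snd_sum] using h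
  · simp [spaceDir, Prod.snd_sum]

theorem sum_smul_velDir (w : V d) : ∑ i, w i • velDir i = ((0, 0, w) : Pt d) := by
  have h := sum_smul_single w
  refine Prod.ext ?_ (Prod.ext ?_ ?_)
  · simp [velDir, Prod.fst_sum]
  · simp [velDir, Prod.fst_sum, Prod.snd_sum]
  · simpa [velDir, Prod.snd_sum] using h

theorem transDir_eq (m : Pt d) : transDir m = (1, 0, 0) + ∑ i, m.2.2 i • spaceDir i := by
  rw [sum_smul_spaceDir]; simp [transDir]

theorem eulerDir_eq (m : Pt d) : eulerDir m = (2 * m.1) • transDir m +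
    ∑ i, m.2.2 i • velDir i + ∑ i, (3 * m.2.1 i - 2 * m.1 * m.2.2 i) • spaceDir i := by
  have h : ∑ i, (3 * m.2.1 i - 2 * m.1 * m.2.2 i) • spaceDir i =
      ((0, (3 : ℝ) • m.2.1 - (2 * m.1) • m.2.2, 0) : Pt d) := by
    rw [← sum_smul_spaceDir]; simp
  rw [h, sum_smul_velDir]
  simp [eulerDir, transDir]

variable {c g : Pt d → ℝ}

theorem integral_mul_fderiv_eq_neg (hc : ContDiff ℝ 1 c) (hcs : HasCompactSupport c)
    (hg : ContDiff ℝ 1 g) (v : Pt d) :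
    ∫ m, c m * fderiv ℝ g m v = - ∫ m, fderiv ℝ c m v * g m := by
  have hc' : Continuous fun m => fderiv ℝ c m v :=
    (hc.continuous_fderiv one_ne_zero).clm_apply continuous_const
  have hg' : Continuous fun m => fderiv ℝ g m v :=
    (hg.continuous_fderiv one_ne_zero).clm_apply continuous_const
  refine integral_mul_fderiv_eq_neg_fderiv_mul_of_integrable ?_ ?_ ?_
    (fun m _ => hc.differentiable one_ne_zero m) (fun m _ => hg.differentiable one_ne_zero m)
  · exact (hc'.mul hg.continuous).integrable_of_hasCompactSupport
      ((hcs.fderiv_apply ℝ v).mul_right)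
  · exact (hc.continuous.mul hg').integrable_of_hasCompactSupport hcs.mul_right
  · exact (hc.continuous.mul hg.continuous).integrable_of_hasCompactSupport hcs.mul_right

theorem contDiff_transDir {n : WithTop ℕ∞} : ContDiff ℝ n (transDir : Pt d → Pt d) := by
  unfold transDir; fun_prop

theorem contDiff_coord {n : WithTop ℕ∞} (i : Fin d) : ContDiff ℝ n fun v : V d => v i :=
  (EuclideanSpace.proj (𝕜 := ℝ) i).contDiff

theorem hasCompactSupport_fderiv_apply (hcs : HasCompactSupport c) (X : Pt d → Pt d) :
    HasCompactSupport fun m => fderiv ℝ c m (X m) := by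
  refine (hcs.fderiv ℝ).mono fun m hm => ?_
  contrapose! hm
  simp only [Function.mem_support, not_not] at hm ⊢
  simp [hm]

theorem integral_mul_transport_eq_neg (hc : ContDiff ℝ 1 c) (hcs : HasCompactSupport c)
    (hg : ContDiff ℝ 1 g) :
    ∫ m, c m * fderiv ℝ g m (transDir m) = - ∫ m, fderiv ℝ c m (transDir m) * g m := by
  have hc' : ∀ v, Continuous fun m => fderiv ℝ c m v := fun v =>
    (hc.continuous_fderiv one_ne_zero).clm_apply continuous_const
  have hg' : ∀ v, Continuous fun m => fderiv ℝ g m v := fun v =>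
    (hg.continuous_fderiv one_ne_zero).clm_apply continuous_const
  have hwc : ∀ i : Fin d, ContDiff ℝ 1 fun m : Pt d => m.2.2 i * c m := fun i =>
    ((contDiff_coord i).comp (contDiff_snd.comp contDiff_snd)).mul hc
  have hcsw : ∀ i : Fin d, HasCompactSupport fun m : Pt d => m.2.2 i * c m := fun i =>
    hcs.mul_left
  have hdw : ∀ (i : Fin d) m, fderiv ℝ (fun m : Pt d => m.2.2 i * c m) m (spaceDir i) =
      m.2.2 i * fderiv ℝ c m (spaceDir i) := by
    intro i m
    have h1 : HasFDerivAt (fun m : Pt d => m.2.2 i)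
        ((EuclideanSpace.proj (𝕜 := ℝ) i).comp
          ((ContinuousLinearMap.snd ℝ (V d) (V d)).comp
            (ContinuousLinearMap.snd ℝ ℝ (V d × V d)))) m :=
      ((EuclideanSpace.proj (𝕜 := ℝ) i).comp
          ((ContinuousLinearMap.snd ℝ (V d) (V d)).comp
            (ContinuousLinearMap.snd ℝ ℝ (V d × V d)))).hasFDerivAt
    have h2 : HasFDerivAt (fun m : Pt d => m.2.2 i * c m) _ m :=
      h1.mul (hc.differentiable one_ne_zero m).hasFDerivAt
    rw [h2.fderiv]
    simp [spaceDir]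
  have e1 : ∀ m, c m * fderiv ℝ g m (transDir m) = c m * fderiv ℝ g m (1, 0, 0) +
      ∑ i, m.2.2 i * c m * fderiv ℝ g m (spaceDir i) := fun m => by
    rw [transDir_eq, map_add, map_sum, mul_add, Finset.mul_sum]
    simp only [map_smul, smul_eq_mul]
    exact congrArg _ (Finset.sum_congr rfl fun i _ => by ring)
  have e2 : ∀ m, fderiv ℝ c m (transDir m) * g m = fderiv ℝ c m (1, 0, 0) * g m +
      ∑ i, fderiv ℝ (fun m : Pt d => m.2.2 i * c m) m (spaceDir i) * g m := fun m => by
    rw [transDir_eq, map_add, map_sum, add_mul, Finset.sum_mul]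
    simp only [map_smul, smul_eq_mul, hdw]
  have i1 : ∀ i : Fin d, Integrable fun m : Pt d => m.2.2 i * c m * fderiv ℝ g m (spaceDir i) :=
    fun i => ((hwc i).continuous.mul (hg' _)).integrable_of_hasCompactSupport (hcsw i).mul_right
  have i2 : ∀ i : Fin d, Integrable fun m : Pt d =>
      fderiv ℝ (fun m : Pt d => m.2.2 i * c m) m (spaceDir i) * g m :=
    fun i => ((((hwc i).continuous_fderiv one_ne_zero).clm_apply continuous_const).mul
      hg.continuous).integrable_of_hasCompactSupport ((hcsw i).fderiv_apply ℝ _).mul_right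
  have i3 : Integrable fun m : Pt d => c m * fderiv ℝ g m (1, 0, 0) :=
    (hc.continuous.mul (hg' _)).integrable_of_hasCompactSupport hcs.mul_right
  have i4 : Integrable fun m : Pt d => fderiv ℝ c m (1, 0, 0) * g m :=
    ((hc' _).mul hg.continuous).integrable_of_hasCompactSupport (hcs.fderiv_apply ℝ _).mul_right
  simp only [e1, e2]
  rw [integral_add i3
      (integrable_finsetSum _ fun i _ => i1 i),
    integral_add i4 (integrable_finsetSum _ fun i _ => i2 i),
    integral_finsetSum _ fun i _ => i1 i, integral_finsetSum _ fun i _ => i2 i,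
    integral_mul_fderiv_eq_neg hc hcs hg, neg_add, ← Finset.sum_neg_distrib]
  exact congrArg _ (Finset.sum_congr rfl fun i _ =>
    integral_mul_fderiv_eq_neg (hwc i) (hcsw i) hg _)

theorem contDiff_fderiv_apply {X : Pt d → Pt d} (hc : ContDiff ℝ ∞ c) (hX : ContDiff ℝ ∞ X) :
    ContDiff ℝ ∞ fun m => fderiv ℝ c m (X m) :=
  (hc.fderiv_right (by simp)).clm_apply hX

/-- Commutator of transport and velocity derivatives. -/
theorem fderiv_velDir_transport_sub (hc : ContDiff ℝ ∞ c) (i : Fin d) (m : Pt d) :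
    fderiv ℝ (fun m => fderiv ℝ c m (transDir m)) m (velDir i) -
      fderiv ℝ (fun m => fderiv ℝ c m (velDir i)) m (transDir m) = fderiv ℝ c m (spaceDir i) := by
  have hd : DifferentiableAt ℝ (fderiv ℝ c) m :=
    ((hc.fderiv_right (m := ∞) (by simp)).differentiable (by simp)) m
  have hsymm : IsSymmSndFDerivAt ℝ c m :=
    hc.contDiffAt.isSymmSndFDerivAt (by
    rw [minSmoothness_of_isRCLikeNormedField]; exact WithTop.coe_le_coe.mpr le_top)
  have hX : HasFDerivAt (transDir : Pt d → Pt d) (fderiv ℝ transDir m) m :=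
    ((contDiff_transDir (n := 1)).differentiable one_ne_zero m).hasFDerivAt
  have hX' : fderiv ℝ (transDir : Pt d → Pt d) m (velDir i) = spaceDir i := by
    have h : HasFDerivAt (transDir : Pt d → Pt d)
        ((0 : Pt d →L[ℝ] ℝ).prod (((ContinuousLinearMap.snd ℝ (V d) (V d)).comp
          (ContinuousLinearMap.snd ℝ ℝ (V d × V d))).prod 0)) m :=
      (hasFDerivAt_const (1 : ℝ) m).prodMk
        (((ContinuousLinearMap.snd ℝ (V d) (V d)).comp
          (ContinuousLinearMap.snd ℝ ℝ (V d × V d))).hasFDerivAt.prodMk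
        (hasFDerivAt_const (0 : V d) m))
    rw [h.fderiv]
    simp [velDir, spaceDir]
  rw [(hd.hasFDerivAt.clm_apply hX).fderiv,
    (hd.hasFDerivAt.clm_apply (hasFDerivAt_const (velDir i) m)).fderiv]
  simp only [add_apply, ContinuousLinearMap.comp_apply,
    ContinuousLinearMap.flip_apply, hX', zero_apply, map_zero,
    zero_add]
  rw [hsymm (velDir i) (transDir m)]
  ring

theorem integral_mul_fderiv_spaceDir (hc : ContDiff ℝ ∞ c) (hcs : HasCompactSupport c)
    (hg : ContDiff ℝ 1 g) (i : Fin d) :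
    ∫ m, c m * fderiv ℝ g m (spaceDir i) =
      (∫ m, fderiv ℝ c m (transDir m) * fderiv ℝ g m (velDir i)) -
        ∫ m, fderiv ℝ c m (velDir i) * fderiv ℝ g m (transDir m) := by
  have h1 := contDiff_fderiv_apply hc (contDiff_transDir (d := d))
  have h2 := contDiff_fderiv_apply hc (contDiff_const (c := velDir i))
  have s1 := hasCompactSupport_fderiv_apply hcs transDir
  have s2 := hasCompactSupport_fderiv_apply hcs fun _ => velDir i
  have h1' := contDiff_fderiv_apply h1 (contDiff_const (c := velDir i))
  have h2' := contDiff_fderiv_apply h2 (contDiff_transDir (d := d))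
  rw [integral_mul_fderiv_eq_neg (hc.of_le (by simp)) hcs hg,
    integral_mul_fderiv_eq_neg (h1.of_le (by simp)) s1 hg,
    integral_mul_transport_eq_neg (h2.of_le (by simp)) s2 hg]
  simp only [← fderiv_velDir_transport_sub hc i, sub_mul]
  rw [integral_sub]
  · ring
  · exact (h1'.continuous.mul hg.continuous).integrable_of_hasCompactSupport
      (hasCompactSupport_fderiv_apply s1 _).mul_right
  · exact (h2'.continuous.mul hg.continuous).integrable_of_hasCompactSupport
      (hasCompactSupport_fderiv_apply s2 _).mul_right

theorem exists_integral_mul_euler_eq {φ : Pt d → ℝ} (hφ : ContDiff ℝ ∞ φ)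
    (hφs : HasCompactSupport φ) : ∃ (A B : Fin d → Pt d → ℝ) (a : Pt d → ℝ),
    (∀ i, ContDiff ℝ ∞ (A i) ∧ HasCompactSupport (A i)) ∧
    (∀ i, ContDiff ℝ ∞ (B i) ∧ HasCompactSupport (B i)) ∧
    (ContDiff ℝ ∞ a ∧ HasCompactSupport a) ∧
    ∀ (g : Pt d → ℝ) (T : Fin d → Pt d → ℝ) (T₁ : Pt d → ℝ), ContDiff ℝ 1 g →
      (∀ i, ContDiff ℝ 1 (T i)) → Continuous T₁ →
      (∀ m, fderiv ℝ g m (transDir m) = (∑ i, fderiv ℝ (T i) m (velDir i)) + T₁ m) →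
      ∫ m, φ m * fderiv ℝ g m (eulerDir m) = (∑ i, ∫ m, A i m * T i m) +
        (∑ i, ∫ m, B i m * fderiv ℝ g m (velDir i)) + ∫ m, a m * T₁ m := by
  have hs : ContDiff ℝ ∞ fun m : Pt d => m.1 := contDiff_fst
  have hy : ∀ i : Fin d, ContDiff ℝ ∞ fun m : Pt d => m.2.1 i := fun i =>
    (contDiff_coord i).comp (contDiff_fst.comp contDiff_snd)
  have hw : ∀ i : Fin d, ContDiff ℝ ∞ fun m : Pt d => m.2.2 i := fun i =>
    (contDiff_coord i).comp (contDiff_snd.comp contDiff_snd)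
  set b : Fin d → Pt d → ℝ := fun i m => (3 * m.2.1 i - 2 * m.1 * m.2.2 i) * φ m with hb
  have hbc : ∀ i, ContDiff ℝ ∞ (b i) := fun i =>
    ((contDiff_const.mul (hy i)).sub ((contDiff_const.mul hs).mul (hw i))).mul hφ
  have hbs : ∀ i, HasCompactSupport (b i) := fun i => hφs.mul_left
  set B : Fin d → Pt d → ℝ := fun i m => m.2.2 i * φ m + fderiv ℝ (b i) m (transDir m) with hB
  have hB1 : ∀ i, ContDiff ℝ ∞ fun m => fderiv ℝ (b i) m (transDir m) := fun i =>
    contDiff_fderiv_apply (hbc i) contDiff_transDir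
  have hB1s : ∀ i, HasCompactSupport fun m => fderiv ℝ (b i) m (transDir m) := fun i =>
    hasCompactSupport_fderiv_apply (hbs i) _
  have hD : ∀ i, ContDiff ℝ ∞ fun m => fderiv ℝ (b i) m (velDir i) := fun i =>
    contDiff_fderiv_apply (hbc i) contDiff_const
  have hDs : ∀ i, HasCompactSupport fun m => fderiv ℝ (b i) m (velDir i) := fun i =>
    hasCompactSupport_fderiv_apply (hbs i) _
  set a : Pt d → ℝ := fun m => 2 * m.1 * φ m - ∑ i, fderiv ℝ (b i) m (velDir i) with ha
  have hac : ContDiff ℝ ∞ a :=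
    ((contDiff_const.mul hs).mul hφ).sub (ContDiff.sum fun i _ => hD i)
  have has : HasCompactSupport a := by
    refine HasCompactSupport.of_support_subset_isCompact hφs fun m hm => ?_
    by_contra h
    have h0 : φ m = 0 := image_eq_zero_of_notMem_tsupport h
    have h1 : ∀ i, fderiv ℝ (b i) m = 0 := fun i => by
      by_contra h'
      have : m ∈ tsupport (b i) := support_fderiv_subset ℝ h'
      exact h (closure_mono (Function.support_mul_subset_right _ _) this)
    exact hm (by simp [ha, h0, h1])
  refine ⟨fun i m => -fderiv ℝ a m (velDir i), B, a, fun i => ⟨?_, ?_⟩, fun i => ⟨?_, ?_⟩,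
    ⟨hac, has⟩, ?_⟩
  · exact (contDiff_fderiv_apply hac contDiff_const).neg
  · exact (hasCompactSupport_fderiv_apply has _).neg
  · exact ((hw i).mul hφ).add (hB1 i)
  · exact hφs.mul_left.add (hB1s i)
  intro g T T₁ hg hT hT₁ hgT
  have cg : ∀ X : Pt d → Pt d, Continuous X → Continuous fun m => fderiv ℝ g m (X m) :=
    fun X hX => (hg.continuous_fderiv one_ne_zero).clm_apply hX
  have cY := cg transDir (contDiff_transDir (n := 1)).continuous
  have i1 : Integrable fun m => 2 * m.1 * φ m * fderiv ℝ g m (transDir m) :=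
    (((contDiff_const.mul hs).mul hφ).continuous.mul cY).integrable_of_hasCompactSupport
      hφs.mul_left.mul_right
  have i2 : ∀ i, Integrable fun m : Pt d => m.2.2 i * φ m * fderiv ℝ g m (velDir i) := fun i =>
    (((hw i).mul hφ).continuous.mul (cg _ continuous_const)).integrable_of_hasCompactSupport
      hφs.mul_left.mul_right
  have i3 : ∀ i, Integrable fun m : Pt d => b i m * fderiv ℝ g m (spaceDir i) := fun i =>
    ((hbc i).continuous.mul (cg _ continuous_const)).integrable_of_hasCompactSupport
      (hbs i).mul_right
  have i4 : ∀ i, Integrable fun m : Pt d =>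
      fderiv ℝ (b i) m (transDir m) * fderiv ℝ g m (velDir i) := fun i =>
    ((hB1 i).continuous.mul (cg _ continuous_const)).integrable_of_hasCompactSupport
      (hB1s i).mul_right
  have i5 : ∀ i, Integrable fun m : Pt d =>
      fderiv ℝ (b i) m (velDir i) * fderiv ℝ g m (transDir m) := fun i =>
    ((hD i).continuous.mul cY).integrable_of_hasCompactSupport (hDs i).mul_right
  have i6 : ∀ i, Integrable fun m : Pt d => a m * fderiv ℝ (T i) m (velDir i) := fun i =>
    (hac.continuous.mul (((hT i).continuous_fderiv one_ne_zero).clm_apply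
      continuous_const)).integrable_of_hasCompactSupport has.mul_right
  have i7 : Integrable fun m : Pt d => a m * T₁ m :=
    (hac.continuous.mul hT₁).integrable_of_hasCompactSupport has.mul_right
  have eL : ∀ m, φ m * fderiv ℝ g m (eulerDir m) =
      2 * m.1 * φ m * fderiv ℝ g m (transDir m) +
      (∑ i, m.2.2 i * φ m * fderiv ℝ g m (velDir i)) +
      ∑ i, b i m * fderiv ℝ g m (spaceDir i) := fun m => by
    rw [eulerDir_eq, map_add, map_add, map_sum, map_sum, mul_add, mul_add, Finset.mul_sum,
      Finset.mul_sum]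
    simp only [map_smul, smul_eq_mul, hb]
    refine congrArg₂ _ (congrArg₂ _ (by ring) ?_) ?_ <;>
      exact Finset.sum_congr rfl fun i _ => by ring
  have j1 : Integrable fun m => 2 * m.1 * φ m * fderiv ℝ g m (transDir m) +
      (∑ i, m.2.2 i * φ m * fderiv ℝ g m (velDir i)) :=
    i1.add (integrable_finsetSum _ fun i _ => i2 i)
  have j2 : Integrable fun m => ∑ i, b i m * fderiv ℝ g m (spaceDir i) :=
    integrable_finsetSum _ fun i _ => i3 i
  have eB : ∀ i, ∫ m, B i m * fderiv ℝ g m (velDir i) =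
      (∫ m : Pt d, m.2.2 i * φ m * fderiv ℝ g m (velDir i)) +
      ∫ m, fderiv ℝ (b i) m (transDir m) * fderiv ℝ g m (velDir i) := fun i => by
    simp only [hB, add_mul]
    exact integral_add (i2 i) (i4 i)
  have eA : ∀ i, ∫ m, -fderiv ℝ a m (velDir i) * T i m =
      ∫ m, a m * fderiv ℝ (T i) m (velDir i) := fun i => by
    rw [integral_mul_fderiv_eq_neg (hac.of_le (by simp)) has (hT i)]
    simp only [neg_mul, integral_neg]
  have eY1 : ∫ m, a m * fderiv ℝ g m (transDir m) =
      (∑ i, ∫ m, a m * fderiv ℝ (T i) m (velDir i)) + ∫ m, a m * T₁ m := by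
    simp only [hgT, mul_add, Finset.mul_sum]
    rw [integral_add (integrable_finsetSum _ fun i _ => i6 i) i7,
      integral_finsetSum _ fun i _ => i6 i]
  have eY2 : ∫ m, a m * fderiv ℝ g m (transDir m) =
      (∫ m, 2 * m.1 * φ m * fderiv ℝ g m (transDir m)) -
      ∑ i, ∫ m, fderiv ℝ (b i) m (velDir i) * fderiv ℝ g m (transDir m) := by
    simp only [ha, sub_mul, Finset.sum_mul]
    rw [integral_sub i1 (integrable_finsetSum _ fun i _ => i5 i),
      integral_finsetSum _ fun i _ => i5 i]
  simp only [eL]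
  rw [integral_add j1 j2, integral_add i1 (integrable_finsetSum _ fun i _ => i2 i),
    integral_finsetSum _ fun i _ => i2 i, integral_finsetSum _ fun i _ => i3 i]
  simp only [eA, eB]
  simp only [integral_mul_fderiv_spaceDir (hbc _) (hbs _) hg, Finset.sum_add_distrib,
    Finset.sum_sub_distrib]
  linarith

theorem exists_isTestKernel (hc : ContDiff ℝ ∞ c) (hcs : HasCompactSupport c) :
    ∃ L R, IsTestKernel c L R := by
  obtain ⟨L, hL⟩ := (hc.of_le (m := 1) (by simp)).lipschitzWith_of_hasCompactSupport hcs
    one_ne_zero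
  obtain ⟨R, hR, h⟩ := hcs.isCompact.isBounded.exists_pos_norm_le
  refine ⟨L, R, L.2, hR.le, fun m n => ?_, fun m hm => h m (subset_tsupport _ hm)⟩
  have := hL.dist_le_mul m n
  rwa [Real.dist_eq, dist_eq_norm] at this

end TransportIdentity

section DyadicDifference

open scoped ContDiff

variable {d : ℕ}

theorem integrable_uncurry_of_continuousOn {h : ℝ → Pt d → ℝ} {R : ℝ}
    (hc : ContinuousOn (Function.uncurry h) (Set.Icc 1 2 ×ˢ Set.univ))
    (hs : ∀ ρ ∈ Set.Icc (1 : ℝ) 2, ∀ m, h ρ m ≠ 0 → ‖m‖ ≤ R) :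
    Integrable (Function.uncurry h) ((volume.restrict (Set.Ioc 1 2)).prod volume) := by
  have hK : IntegrableOn (Function.uncurry h)
      (Set.Icc (1 : ℝ) 2 ×ˢ Metric.closedBall (0 : Pt d) R) (volume.prod volume) :=
    (hc.mono (Set.prod_mono_right (Set.subset_univ _))).integrableOn_compact
      (isCompact_Icc.prod (isCompact_closedBall _ _))
  have hI : IntegrableOn (Function.uncurry h) (Set.Icc (1 : ℝ) 2 ×ˢ (Set.univ : Set (Pt d)))
      (volume.prod volume) := by
    refine hK.of_forall_sdiff_eq_zero (measurableSet_Icc.prod MeasurableSet.univ) ?_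
    rintro ⟨ρ, m⟩ ⟨h1, h2⟩
    by_contra h0
    exact h2 ⟨h1.1, mem_closedBall_zero_iff.mpr (hs ρ h1.1 m h0)⟩
  have := hI.mono_set (Set.prod_mono_left (t := Set.univ) (Set.Ioc_subset_Icc_self (a := (1 : ℝ)) (b := 2)))
  rwa [IntegrableOn, ← Measure.prod_restrict, Measure.restrict_univ] at this

section Swap

variable {h : ℝ → Pt d → ℝ} {R : ℝ}
  (hc : ContinuousOn (Function.uncurry h) (Set.Icc 1 2 ×ˢ Set.univ))
  (hs : ∀ ρ ∈ Set.Icc (1 : ℝ) 2, ∀ m, h ρ m ≠ 0 → ‖m‖ ≤ R)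
include hc hs

theorem intervalIntegrable_integral_of_continuousOn :
    IntervalIntegrable (fun ρ => ∫ m, h ρ m) volume 1 2 := by
  rw [intervalIntegrable_iff_integrableOn_Ioc_of_le one_le_two]
  exact (integrable_uncurry_of_continuousOn hc hs).integral_prod_left

theorem intervalIntegral_integral_swap_of_continuousOn :
    ∫ ρ in (1 : ℝ)..2, ∫ m, h ρ m = ∫ m, ∫ ρ in (1 : ℝ)..2, h ρ m := by
  simp only [intervalIntegral.integral_of_le one_le_two]
  exact integral_integral_swap (integrable_uncurry_of_continuousOn hc hs)

end Swap

/-- Average of the dilates of a kernel over one dyadic block of scales. -/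
def dilAvg (k : ℕ) (A : Pt d → ℝ) (m : Pt d) : ℝ :=
  ∫ ρ in (1 : ℝ)..2, ρ ^ k * dilKernel ρ A m

variable {A : Pt d → ℝ} {L R : ℝ} (hA : IsTestKernel A L R)
include hA

theorem continuousOn_dilKernel (k : ℕ) :
    ContinuousOn (Function.uncurry fun (ρ : ℝ) m => ρ ^ k * dilKernel ρ A m)
      (Set.Icc 1 2 ×ˢ Set.univ) := by
  have hρ : ∀ x ∈ Set.Icc (1 : ℝ) 2 ×ˢ (Set.univ : Set (Pt d)), x.1 ≠ 0 := fun x hx =>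
    (zero_lt_one.trans_le hx.1.1).ne'
  have hinv : ContinuousOn (fun x : ℝ × Pt d => x.1⁻¹) (Set.Icc (1 : ℝ) 2 ×ˢ Set.univ) :=
    continuousOn_fst.inv₀ hρ
  simp only [Function.uncurry_def, dilKernel]
  refine (continuousOn_fst.pow k).mul ((continuousOn_fst.rpow_const fun x hx =>
    Or.inl (hρ x hx)).mul (hA.continuous.comp_continuousOn ?_))
  unfold dil
  fun_prop

theorem dilKernel_lip_supp_of_mem (k : ℕ) {ρ : ℝ} (hρ : ρ ∈ Set.Icc (1 : ℝ) 2) :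
    (∀ m n, |ρ ^ k * dilKernel ρ A m - ρ ^ k * dilKernel ρ A n| ≤ 2 ^ k * (L * 3) * ‖m - n‖) ∧
      ∀ m, ρ ^ k * dilKernel ρ A m ≠ 0 → ‖m‖ ≤ 14 * R := by
  have h0 : 0 < ρ := zero_lt_one.trans_le hρ.1
  have hT := hA.const_mul_comp_dil (ρ ^ k * ρ ^ (-(4 * (d : ℝ) + 2))) (inv_pos.mpr h0)
  have e : ∀ m, ρ ^ k * dilKernel ρ A m = ρ ^ k * ρ ^ (-(4 * (d : ℝ) + 2)) * A (dil ρ⁻¹ m) :=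
    fun m => by rw [dilKernel, mul_assoc]
  have hi : ρ⁻¹ ≤ 1 := inv_le_one_of_one_le₀ hρ.1
  have hi0 : 0 ≤ ρ⁻¹ := by positivity
  have hL := hA.lip_nonneg
  have hR := hA.radius_nonneg
  refine ⟨fun m n => ?_, fun m hm => ?_⟩
  · rw [e, e]
    refine (hT.lip m n).trans (mul_le_mul_of_nonneg_right ?_ (norm_nonneg _))
    have h1 : |ρ ^ k * ρ ^ (-(4 * (d : ℝ) + 2))| ≤ 2 ^ k := by
      rw [abs_of_nonneg (by positivity)]
      have h2 : ρ ^ (-(4 * (d : ℝ) + 2)) ≤ 1 :=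
        Real.rpow_le_one_of_one_le_of_nonpos hρ.1 (by have : (0 : ℝ) ≤ d := by positivity
                                                      linarith)
      calc _ ≤ ρ ^ k * 1 := mul_le_mul_of_nonneg_left h2 (by positivity)
        _ ≤ 2 ^ k := by rw [mul_one]; exact pow_le_pow_left₀ h0.le hρ.2 k
    have h3 : ρ⁻¹ + ρ⁻¹ ^ 2 + ρ⁻¹ ^ 3 ≤ 3 := by
      have := pow_le_one₀ hi0 hi (n := 2)
      have := pow_le_one₀ hi0 hi (n := 3)
      linarith
    exact mul_le_mul h1 (mul_le_mul_of_nonneg_left h3 hL) (by positivity) (by positivity)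
  · rw [e] at hm
    refine (hT.supp m hm).trans (mul_le_mul_of_nonneg_right ?_ hR)
    rw [inv_inv]
    have := pow_le_pow_left₀ h0.le hρ.2 2
    have := pow_le_pow_left₀ h0.le hρ.2 3
    linarith [hρ.2]

theorem intervalIntegrable_dilKernel (k : ℕ) (m : Pt d) :
    IntervalIntegrable (fun ρ : ℝ => ρ ^ k * dilKernel ρ A m) volume 1 2 := by
  refine ContinuousOn.intervalIntegrable ?_
  rw [Set.uIcc_of_le one_le_two]
  exact (continuousOn_dilKernel hA k).comp (f := fun ρ : ℝ => (ρ, m)) (by fun_prop)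
    fun ρ hρ => ⟨hρ, trivial⟩

theorem isTestKernel_dilAvg (k : ℕ) : IsTestKernel (dilAvg k A) (2 ^ k * (L * 3)) (14 * R) where
  lip_nonneg := by have := hA.lip_nonneg; positivity
  radius_nonneg := by have := hA.radius_nonneg; positivity
  lip m n := by
    rw [dilAvg, dilAvg, ← intervalIntegral.integral_sub
      (intervalIntegrable_dilKernel hA k m) (intervalIntegrable_dilKernel hA k n)]
    have hb : ∀ ρ ∈ Set.uIoc (1 : ℝ) 2,
        ‖ρ ^ k * dilKernel ρ A m - ρ ^ k * dilKernel ρ A n‖ ≤ 2 ^ k * (L * 3) * ‖m - n‖ := ?_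
    · refine (intervalIntegral.norm_integral_le_of_norm_le_const hb).trans (le_of_eq ?_)
      norm_num
    intro ρ hρ
    rw [Set.uIoc_of_le one_le_two] at hρ
    exact (dilKernel_lip_supp_of_mem hA k (Set.Ioc_subset_Icc_self hρ)).1 m n
  supp m hm := by
    by_contra hR
    refine hm ?_
    have e : Set.EqOn (fun ρ : ℝ => ρ ^ k * dilKernel ρ A m) (fun _ => 0) (Set.uIcc 1 2) := by
      intro ρ hρ
      rw [Set.uIcc_of_le one_le_two] at hρ
      by_contra h
      exact hR ((dilKernel_lip_supp_of_mem hA k hρ).2 m h)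
    rw [dilAvg, intervalIntegral.integral_congr e]
    simp

section Average

variable {S : Pt d → ℝ} (hS : Continuous S)
include hS

theorem intervalIntegral_rconv_dilKernel (k : ℕ) {r : ℝ} (hr : 0 < r) (z : Pt d) :
    IntervalIntegrable (fun ρ : ℝ => ρ ^ k * ∫ m, A m * S (z * dil (r * ρ) m)) volume 1 2 ∧
    ∫ ρ in (1 : ℝ)..2, ρ ^ k * ∫ m, A m * S (z * dil (r * ρ) m) =
      rconv volume (dilKernel r (dilAvg k A)) S z := by
  set h : ℝ → Pt d → ℝ := fun ρ m => ρ ^ k * dilKernel ρ A m * S (z * dil r m) with hh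
  have hc : ContinuousOn (Function.uncurry h) (Set.Icc 1 2 ×ˢ Set.univ) := by
    refine (continuousOn_dilKernel hA k).mul (Continuous.continuousOn ?_)
    exact hS.comp (continuous_const.mul ((continuous_dil r).comp continuous_snd))
  have hs : ∀ ρ ∈ Set.Icc (1 : ℝ) 2, ∀ m, h ρ m ≠ 0 → ‖m‖ ≤ 14 * R := fun ρ hρ m hm =>
    (dilKernel_lip_supp_of_mem hA k hρ).2 m (left_ne_zero_of_mul hm)
  have e : Set.EqOn (fun ρ : ℝ => ρ ^ k * ∫ m, A m * S (z * dil (r * ρ) m))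
      (fun ρ => ∫ m, h ρ m) (Set.uIcc 1 2) := by
    intro ρ hρ
    rw [Set.uIcc_of_le one_le_two] at hρ
    have h0 : 0 < ρ := zero_lt_one.trans_le hρ.1
    simp only [hh, mul_assoc, integral_const_mul]
    congr 1
    have h1 := integral_dil (inv_pos.mpr h0) fun m => A m * S (z * dil (r * ρ) m)
    simp only [dil_dil, mul_assoc, mul_inv_cancel₀ h0.ne', mul_one] at h1
    simp only [dilKernel, mul_assoc, integral_const_mul, h1]
    rw [← mul_assoc, ← Real.mul_rpow h0.le (by positivity), mul_inv_cancel₀ h0.ne', Real.one_rpow,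
      one_mul]
  refine ⟨?_, ?_⟩
  · refine IntervalIntegrable.congr (fun ρ hρ => ?_)
      (intervalIntegrable_integral_of_continuousOn hc hs)
    exact (e (Set.uIoc_subset_uIcc hρ)).symm
  · rw [intervalIntegral.integral_congr e, intervalIntegral_integral_swap_of_continuousOn hc hs,
      rconv_dilKernel hr]
    simp only [hh, intervalIntegral.integral_mul_const, dilAvg]

end Average

end DyadicDifference

section TransportDifference

open scoped ContDiff

variable {d : ℕ}

/-- Differential of `m ↦ z * dil r m`. -/
def transDilCLM (z : Pt d) (r : ℝ) : Pt d →L[ℝ] Pt d :=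
  ((r ^ 2) • ContinuousLinearMap.fst ℝ ℝ (V d × V d)).prod
    (((r ^ 3) • ((ContinuousLinearMap.fst ℝ (V d) (V d)).comp
        (ContinuousLinearMap.snd ℝ ℝ (V d × V d))) +
      ((r ^ 2) • ContinuousLinearMap.fst ℝ ℝ (V d × V d)).smulRight z.2.2).prod
    (r • ((ContinuousLinearMap.snd ℝ (V d) (V d)).comp
        (ContinuousLinearMap.snd ℝ ℝ (V d × V d)))))

theorem transDilCLM_apply (z : Pt d) (r : ℝ) (h : Pt d) :
    transDilCLM z r h = (r ^ 2 * h.1, r ^ 3 • h.2.1 + (r ^ 2 * h.1) • z.2.2, r • h.2.2) := by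
  simp [transDilCLM]

theorem mul_dil_eq (z : Pt d) (r : ℝ) (m : Pt d) : z * dil r m = z + transDilCLM z r m := by
  rw [transDilCLM_apply, kinetic_mul_def, dil]
  simp only [Prod.ext_iff, Prod.fst_add, Prod.snd_add, add_assoc, and_self]

theorem hasFDerivAt_mul_dil (z : Pt d) (r : ℝ) (m : Pt d) :
    HasFDerivAt (fun m => z * dil r m) (transDilCLM z r) m := by
  simp only [mul_dil_eq]
  exact (transDilCLM z r).hasFDerivAt.const_add z

theorem contDiff_mul_dil (z : Pt d) (r : ℝ) : ContDiff ℝ 1 fun m => z * dil r m := by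
  simp only [mul_dil_eq]
  exact contDiff_const.add (transDilCLM z r).contDiff

/-- Velocity of the curve `r ↦ z * dil r m`. -/
def dilVelocity (z m : Pt d) (r : ℝ) : Pt d :=
  (2 * r * m.1, (3 * r ^ 2) • m.2.1 + (2 * r * m.1) • z.2.2, m.2.2)

theorem hasDerivAt_mul_dil (z m : Pt d) (r : ℝ) :
    HasDerivAt (fun r => z * dil r m) (dilVelocity z m r) r := by
  have h2 : HasDerivAt (fun r : ℝ => r ^ 2 * m.1) (2 * r * m.1) r := by
    simpa using (hasDerivAt_pow 2 r).mul_const m.1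
  have h3 : HasDerivAt (fun r : ℝ => r ^ 3 • m.2.1) ((3 * r ^ 2) • m.2.1) r := by
    simpa using (hasDerivAt_pow 3 r).smul_const m.2.1
  have h1 : HasDerivAt (fun r : ℝ => r • m.2.2) m.2.2 r := by
    simpa using (hasDerivAt_id r).smul_const m.2.2
  simp only [kinetic_mul_def, dil, dilVelocity]
  exact (h2.const_add _).prodMk (((h3.const_add _).add (h2.smul_const z.2.2)).prodMk
    (h1.const_add _))

variable {f : Pt d → ℝ} (hf : ContDiff ℝ 1 f)
include hf

theorem fderiv_comp_mul_dil (z : Pt d) (r : ℝ) (m h : Pt d) :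
    fderiv ℝ (fun m => f (z * dil r m)) m h = fderiv ℝ f (z * dil r m) (transDilCLM z r h) := by
  have h1 : HasFDerivAt (fun m => f (z * dil r m)) _ m :=
    (hf.differentiable one_ne_zero (z * dil r m)).hasFDerivAt.comp m (hasFDerivAt_mul_dil z r m)
  rw [h1.fderiv]; rfl

theorem fderiv_comp_mul_dil_transDir (z : Pt d) (r : ℝ) (m : Pt d) :
    fderiv ℝ (fun m => f (z * dil r m)) m (transDir m) =
      r ^ 2 * fderiv ℝ f (z * dil r m) (transDir (z * dil r m)) := by
  rw [fderiv_comp_mul_dil hf, ← smul_eq_mul (r ^ 2), ← map_smul]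
  congr 1
  simp only [transDilCLM_apply, transDir, kinetic_mul_def, dil, Prod.smul_mk, smul_add, smul_smul,
    smul_eq_mul, mul_one, smul_zero]
  refine Prod.ext rfl (Prod.ext ?_ rfl)
  change r ^ 3 • m.2.2 + r ^ 2 • z.2.2 = r ^ 2 • z.2.2 + (r ^ 2 * r) • m.2.2
  rw [add_comm, pow_succ r 2]

theorem fderiv_comp_mul_dil_velDir (z : Pt d) (r : ℝ) (m : Pt d) (i : Fin d) :
    fderiv ℝ (fun m => f (z * dil r m)) m (velDir i) =
      r * fderiv ℝ f (z * dil r m) (velDir i) := by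
  rw [fderiv_comp_mul_dil hf, ← smul_eq_mul r, ← map_smul]
  congr 1
  simp [transDilCLM_apply, velDir]

theorem fderiv_comp_mul_dil_eulerDir (z : Pt d) (r : ℝ) (m : Pt d) :
    fderiv ℝ (fun m => f (z * dil r m)) m (eulerDir m) =
      r * fderiv ℝ f (z * dil r m) (dilVelocity z m r) := by
  rw [fderiv_comp_mul_dil hf, ← smul_eq_mul r, ← map_smul]
  congr 1
  simp only [transDilCLM_apply, eulerDir, dilVelocity, Prod.smul_mk, smul_add, smul_smul,
    smul_eq_mul, Prod.mk.injEq, and_true]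
  refine ⟨by ring, ?_⟩
  congr 2 <;> ring

theorem continuous_fderiv_dilVelocity (z : Pt d) (r : ℝ) : Continuous fun x : ℝ × Pt d =>
    fderiv ℝ f (z * dil (r * x.1) x.2) (dilVelocity z x.2 (r * x.1)) := by
  refine ((hf.continuous_fderiv one_ne_zero).comp ?_).clm_apply ?_
  · exact continuous_const.mul (by unfold dil; fun_prop)
  · unfold dilVelocity; fun_prop

theorem sub_eq_intervalIntegral_fderiv (z m : Pt d) (r : ℝ) :
    f (z * dil (r * 2) m) - f (z * dil r m) =
      ∫ ρ in (1 : ℝ)..2, r * fderiv ℝ f (z * dil (r * ρ) m) (dilVelocity z m (r * ρ)) := by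
  have h : ∀ ρ : ℝ, HasDerivAt (fun ρ => f (z * dil (r * ρ) m))
      (r * fderiv ℝ f (z * dil (r * ρ) m) (dilVelocity z m (r * ρ))) ρ := fun ρ => by
    have h1 : HasDerivAt (fun ρ : ℝ => r * ρ) r ρ := by
      simpa using (hasDerivAt_id ρ).const_mul r
    have h2 := (hasDerivAt_mul_dil z m (r * ρ)).scomp ρ h1
    have h3 := (hf.differentiable one_ne_zero (z * dil (r * ρ) m)).hasFDerivAt.comp_hasDerivAt ρ h2
    rwa [map_smul, smul_eq_mul] at h3
  rw [intervalIntegral.integral_eq_sub_of_hasDerivAt (fun ρ _ => h ρ), mul_one]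
  refine Continuous.intervalIntegrable ?_ _ _
  exact continuous_const.mul
    ((continuous_fderiv_dilVelocity hf z r).comp (f := fun ρ : ℝ => (ρ, m)) (by fun_prop))

theorem rconv_dilKernel_two_mul_sub {φ : Pt d → ℝ} (hφ : Continuous φ) (hφs : HasCompactSupport φ)
    {r : ℝ} (hr : 0 < r) (z : Pt d) :
    rconv volume (dilKernel (r * 2) φ) f z - rconv volume (dilKernel r φ) f z =
      ∫ ρ in (1 : ℝ)..2, r * ∫ m, φ m *
        fderiv ℝ f (z * dil (r * ρ) m) (dilVelocity z m (r * ρ)) := by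
  obtain ⟨R, hR, hRφ⟩ := hφs.isCompact.isBounded.exists_pos_norm_le
  have i : ∀ s : ℝ, Integrable fun m => φ m * f (z * dil s m) := fun s =>
    (hφ.mul (hf.continuous.comp (contDiff_mul_dil z s).continuous)).integrable_of_hasCompactSupport
      hφs.mul_right
  set h : ℝ → Pt d → ℝ := fun ρ m => r * (φ m *
    fderiv ℝ f (z * dil (r * ρ) m) (dilVelocity z m (r * ρ))) with hh
  have hc : ContinuousOn (Function.uncurry h) (Set.Icc 1 2 ×ˢ Set.univ) :=
    (continuous_const.mul ((hφ.comp continuous_snd).mul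
      (continuous_fderiv_dilVelocity hf z r))).continuousOn
  have hs : ∀ ρ ∈ Set.Icc (1 : ℝ) 2, ∀ m, h ρ m ≠ 0 → ‖m‖ ≤ R := fun ρ hρ m hm =>
    hRφ m (subset_tsupport _ (left_ne_zero_of_mul (right_ne_zero_of_mul hm)))
  rw [rconv_dilKernel (by positivity), rconv_dilKernel hr, ← integral_sub (i _) (i _)]
  simp only [← integral_const_mul]
  rw [intervalIntegral_integral_swap_of_continuousOn hc hs]
  refine integral_congr_ae (Filter.Eventually.of_forall fun m => ?_)
  beta_reduce
  rw [← mul_sub, sub_eq_intervalIntegral_fderiv hf, ← intervalIntegral.integral_const_mul]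
  simp only [hh]
  congr 1
  funext ρ
  ring

end TransportDifference

section Telescope

open scoped ContDiff

variable {d : ℕ}

theorem exists_rconv_dilKernel_two_mul_sub_eq {φ : Pt d → ℝ} (hφ : ContDiff ℝ ∞ φ)
    (hφs : HasCompactSupport φ) : ∃ (A B : Fin d → Pt d → ℝ) (a : Pt d → ℝ),
    (∀ i, ∃ L R, IsTestKernel (A i) L R) ∧ (∀ i, ∃ L R, IsTestKernel (B i) L R) ∧
    (∃ L R, IsTestKernel a L R) ∧
    ∀ (f : Pt d → ℝ) (T : Fin d → Pt d → ℝ) (T₁ : Pt d → ℝ), ContDiff ℝ 1 f →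
      (∀ i, ContDiff ℝ 1 (T i)) → Continuous T₁ →
      (∀ m, fderiv ℝ f m (transDir m) = (∑ i, fderiv ℝ (T i) m (velDir i)) + T₁ m) →
      ∀ r : ℝ, 0 < r → ∀ z,
      rconv volume (dilKernel (r * 2) φ) f z - rconv volume (dilKernel r φ) f z =
        (∑ i, r * rconv volume (dilKernel r (A i)) (T i) z) +
        (∑ i, r * rconv volume (dilKernel r (B i)) (fun m => fderiv ℝ f m (velDir i)) z) +
        r ^ 2 * rconv volume (dilKernel r a) T₁ z := by
  obtain ⟨A, B, a, hA, hB, ha, H⟩ := exists_integral_mul_euler_eq hφ hφs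
  choose LA RA tA using fun i => exists_isTestKernel (hA i).1 (hA i).2
  choose LB RB tB using fun i => exists_isTestKernel (hB i).1 (hB i).2
  obtain ⟨La, Ra, ta⟩ := exists_isTestKernel ha.1 ha.2
  refine ⟨fun i => dilAvg 0 (A i), fun i => dilAvg 0 (B i), dilAvg 1 a,
    fun i => ⟨_, _, isTestKernel_dilAvg (tA i) 0⟩, fun i => ⟨_, _, isTestKernel_dilAvg (tB i) 0⟩,
    ⟨_, _, isTestKernel_dilAvg ta 1⟩, ?_⟩
  intro f T T₁ hf hT hT₁ hfT r hr z
  have hDf : ∀ i : Fin d, Continuous fun m => fderiv ℝ f m (velDir i) := fun i =>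
    (hf.continuous_fderiv one_ne_zero).clm_apply continuous_const
  have key : ∀ s : ℝ, 0 < s →
      ∫ m, φ m * fderiv ℝ f (z * dil s m) (dilVelocity z m s) =
        (∑ i, ∫ m, A i m * T i (z * dil s m)) +
        (∑ i, ∫ m, B i m * fderiv ℝ f (z * dil s m) (velDir i)) +
        s * ∫ m, a m * T₁ (z * dil s m) := by
    intro s hs
    have hm := contDiff_mul_dil z s
    have h := H (fun m => f (z * dil s m)) (fun i m => s * T i (z * dil s m))
      (fun m => s ^ 2 * T₁ (z * dil s m)) (hf.comp hm)
      (fun i => contDiff_const.mul ((hT i).comp hm))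
      (continuous_const.mul (hT₁.comp hm.continuous)) (fun m => by
        rw [fderiv_comp_mul_dil_transDir hf, hfT, mul_add, Finset.mul_sum]
        refine congrArg (· + _) (Finset.sum_congr rfl fun i _ => ?_)
        have hTi : DifferentiableAt ℝ (fun m => T i (z * dil s m)) m :=
          ((hT i).comp hm).differentiable one_ne_zero m
        rw [fderiv_const_mul hTi]
        change _ = s * fderiv ℝ (fun m => T i (z * dil s m)) m (velDir i)
        rw [fderiv_comp_mul_dil_velDir (hT i)]
        ring)
    simp only [fderiv_comp_mul_dil_eulerDir hf, fderiv_comp_mul_dil_velDir hf,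
      mul_left_comm _ s, mul_left_comm _ (s ^ 2), integral_const_mul, ← Finset.mul_sum] at h
    refine mul_left_cancel₀ hs.ne' (h.trans ?_)
    ring
  have qA := fun i => intervalIntegral_rconv_dilKernel (tA i) (hT i).continuous 0 hr z
  have qB := fun i => intervalIntegral_rconv_dilKernel (tB i) (hDf i) 0 hr z
  have qa := intervalIntegral_rconv_dilKernel ta hT₁ 1 hr z
  simp only [pow_zero, one_mul, pow_one] at qA qB qa
  have e : Set.EqOn (fun ρ : ℝ => r * ∫ m, φ m *
        fderiv ℝ f (z * dil (r * ρ) m) (dilVelocity z m (r * ρ)))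
      (fun ρ => (∑ i, r * ∫ m, A i m * T i (z * dil (r * ρ) m)) +
        (∑ i, r * ∫ m, B i m * fderiv ℝ f (z * dil (r * ρ) m) (velDir i)) +
        r ^ 2 * (ρ * ∫ m, a m * T₁ (z * dil (r * ρ) m))) (Set.uIcc 1 2) := by
    intro ρ hρ
    rw [Set.uIcc_of_le one_le_two] at hρ
    have h0 : 0 < ρ := zero_lt_one.trans_le hρ.1
    beta_reduce
    rw [key _ (by positivity), ← Finset.mul_sum, ← Finset.mul_sum]
    ring
  have iA := IntervalIntegrable.sum Finset.univ fun i _ => (qA i).1.const_mul r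
  have iB := IntervalIntegrable.sum Finset.univ fun i _ => (qB i).1.const_mul r
  rw [rconv_dilKernel_two_mul_sub hf hφ.continuous hφs hr, intervalIntegral.integral_congr e]
  rw [intervalIntegral.integral_add, intervalIntegral.integral_add,
    intervalIntegral.integral_finsetSum, intervalIntegral.integral_finsetSum]
  · simp only [intervalIntegral.integral_const_mul, (qA _).2, (qB _).2, qa.2]
  · exact fun i _ => (qB i).1.const_mul r
  · exact fun i _ => (qA i).1.const_mul r
  · simpa only [Finset.sum_fn] using iA
  · simpa only [Finset.sum_fn] using iB
  · simpa only [Finset.sum_fn] using iA.add iB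
  · exact qa.1.const_mul _

end Telescope

section Assembly

open scoped ContDiff

variable {d : ℕ}

theorem sum_rconv_eq {ι : Type*} (s : Finset ι) {K : ι → Pt d → ℝ} (hK : ∀ j, Integrable (K j))
    {S : Pt d → ℝ} {M : ℝ} (hS : Continuous S) (hM : ∀ z, |S z| ≤ M) (z : Pt d) :
    ∑ j ∈ s, rconv volume (K j) S z = rconv volume (fun m => ∑ j ∈ s, K j m) S z := by
  simp only [rconv, Finset.sum_mul]
  exact (integral_finsetSum s fun j _ => integrable_mul_comp_mul hS hM (hK j) z).symm

theorem exists_eLpNorm_sum_rconv_dilKernel_le (hd : 1 ≤ d) {p : ℝ} (hp : 1 < p)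
    {A : Pt d → ℝ} (hA : ∃ L R, IsTestKernel A L R) :
    ∃ C : ℝ, 0 < C ∧ ∀ (s : Finset ℤ) (S : Pt d → ℝ) (M : ℝ), Continuous S → (∀ z, |S z| ≤ M) →
      MemLp S (ENNReal.ofReal p) volume →
      AEStronglyMeasurable
        (fun z => ∑ j ∈ s, rconv volume (dilKernel ((2 : ℝ) ^ j) (fracDx A)) S z) volume ∧
      eLpNorm (fun z => ∑ j ∈ s, rconv volume (dilKernel ((2 : ℝ) ^ j) (fracDx A)) S z)
        (ENNReal.ofReal p) volume ≤ ENNReal.ofReal C * eLpNorm S (ENNReal.ofReal p) volume := by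
  obtain ⟨L, R, hA⟩ := hA
  obtain ⟨C₁, hC₁, hK, -⟩ := hA.exists_isUnitKernel_fracDx hd
  obtain ⟨c, hc⟩ := isGauge_knorm d
  obtain ⟨C, hC, h⟩ := exists_eLpNorm_rconv_sum_le hc (ε := 1 / 2) (by norm_num) hC₁ hp
  refine ⟨C, hC, fun s S M hS hM hSp => ?_⟩
  have hi : ∀ j : ℤ, Integrable (dilKernel ((2 : ℝ) ^ j) (fracDx A)) := fun j =>
    integrable_dilKernel (by positivity) hK.integrable
  simp only [sum_rconv_eq s hi hS hM]
  exact ⟨aestronglyMeasurable_rconv (integrable_finsetSum s fun j _ => hi j).aestronglyMeasurable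
    hSp.aestronglyMeasurable, h _ hK.isDyadicKernel s S hSp⟩

theorem exists_eLpNorm_sum_zpow_mul_rconv_dilKernel_le (hd : 1 ≤ d) {p q : ℝ} (hp : 0 < p)
    (hq : 1 < q) (hpq : 1 / q = 1 / p + 1 / (4 * (d : ℝ) + 2))
    {A : Pt d → ℝ} (hA : ∃ L R, IsTestKernel A L R) :
    ∃ C : ℝ, 0 < C ∧ ∀ (s : Finset ℤ) (S : Pt d → ℝ) (M : ℝ), Continuous S → (∀ z, |S z| ≤ M) →
      MemLp S (ENNReal.ofReal q) volume →
      AEStronglyMeasurable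
        (fun z => ∑ j ∈ s, (2 : ℝ) ^ j * rconv volume (dilKernel ((2 : ℝ) ^ j) (fracDx A)) S z)
        volume ∧
      eLpNorm (fun z => ∑ j ∈ s, (2 : ℝ) ^ j *
          rconv volume (dilKernel ((2 : ℝ) ^ j) (fracDx A)) S z)
        (ENNReal.ofReal p) volume ≤ ENNReal.ofReal C * eLpNorm S (ENNReal.ofReal q) volume := by
  obtain ⟨L, R, hA⟩ := hA
  obtain ⟨C₁, hC₁, hK, hb⟩ := hA.exists_isUnitKernel_fracDx hd
  have hQ : (1 : ℝ) < 4 * d + 2 := by linarith [(Nat.cast_nonneg d : (0 : ℝ) ≤ d)]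
  obtain ⟨C, hC, h⟩ := exists_eLpNorm_rconv_fractional_le (μ := (volume : Measure (Pt d)))
    hQ hC₁ hq hp hpq
  refine ⟨C, hC, fun s S M hS hM hSp => ?_⟩
  have hi : ∀ j : ℤ, Integrable fun m => (2 : ℝ) ^ j * dilKernel ((2 : ℝ) ^ j) (fracDx A) m :=
    fun j => (integrable_dilKernel (by positivity) hK.integrable).const_mul _
  have e : ∀ (j : ℤ) (z : Pt d),
      (2 : ℝ) ^ j * rconv volume (dilKernel ((2 : ℝ) ^ j) (fracDx A)) S z =
        rconv volume (fun m => (2 : ℝ) ^ j * dilKernel ((2 : ℝ) ^ j) (fracDx A) m) S z := by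
    intro j z
    simp only [rconv, mul_assoc, integral_const_mul]
  simp only [e, sum_rconv_eq s hi hS hM]
  exact ⟨aestronglyMeasurable_rconv (integrable_finsetSum s fun j _ => hi j).aestronglyMeasurable
    hSp.aestronglyMeasurable, h _ (hK.isFractionalKernel hb) s S hSp⟩

/-- Applying `fracDx` to a decomposition of a difference of mollifications. -/
theorem fracDx_rconv_dilKernel_sub_eq (hd : 1 ≤ d) {φ : Pt d → ℝ} {A B : Fin d → Pt d → ℝ}
    {a : Pt d → ℝ} (hφ : ∃ L R, IsTestKernel φ L R) (hA : ∀ i, ∃ L R, IsTestKernel (A i) L R)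
    (hB : ∀ i, ∃ L R, IsTestKernel (B i) L R) (ha : ∃ L R, IsTestKernel a L R)
    {f T₁ : Pt d → ℝ} {T D : Fin d → Pt d → ℝ} {Mf M₁ : ℝ} {MT MD : Fin d → ℝ}
    (hf : Continuous f) (hfM : ∀ z, |f z| ≤ Mf) (hT : ∀ i, Continuous (T i))
    (hTM : ∀ i z, |T i z| ≤ MT i) (hD : ∀ i, Continuous (D i)) (hDM : ∀ i z, |D i z| ≤ MD i)
    (hT₁ : Continuous T₁) (hT₁M : ∀ z, |T₁ z| ≤ M₁) {r r' : ℝ} (hr : 0 < r) (hr' : 0 < r')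
    (h : ∀ z, rconv volume (dilKernel r' φ) f z - rconv volume (dilKernel r φ) f z =
      (∑ i, r * rconv volume (dilKernel r (A i)) (T i) z) +
        (∑ i, r * rconv volume (dilKernel r (B i)) (D i) z) +
        r ^ 2 * rconv volume (dilKernel r a) T₁ z) (z : Pt d) :
    fracDx (rconv volume (dilKernel r' φ) f) z - fracDx (rconv volume (dilKernel r φ) f) z =
      (∑ i, rconv volume (dilKernel r (fracDx (A i))) (T i) z) +
        (∑ i, rconv volume (dilKernel r (fracDx (B i))) (D i) z) +
        r * rconv volume (dilKernel r (fracDx a)) T₁ z := by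
  obtain ⟨_, _, hφ⟩ := hφ
  obtain ⟨_, _, ha⟩ := ha
  choose _ _ hA using hA
  choose _ _ hB using hB
  have gA := fun i => fracDx_rconv_dilKernel (hT i) (hTM i) hd (hA i) hr z
  have gB := fun i => fracDx_rconv_dilKernel (hD i) (hDM i) hd (hB i) hr z
  have ga := fracDx_rconv_dilKernel hT₁ hT₁M hd ha hr z
  have g1 := fracDx_rconv_dilKernel hf hfM hd hφ hr z
  have g2 := fracDx_rconv_dilKernel hf hfM hd hφ hr' z
  have sA := FracIntegrable.sum Finset.univ
    (u := fun i z => r * rconv volume (dilKernel r (A i)) (T i) z)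
    fun i _ => (gA i).1.const_mul r
  have sB := FracIntegrable.sum Finset.univ
    (u := fun i z => r * rconv volume (dilKernel r (B i)) (D i) z)
    fun i _ => (gB i).1.const_mul r
  have sa := ga.1.const_mul (r ^ 2)
  rw [← FracIntegrable.fracDx_sub g2.1 g1.1, funext h,
    FracIntegrable.fracDx_add (sA.1.add sB.1) sa, FracIntegrable.fracDx_add sA.1 sB.1, sA.2, sB.2,
    fracDx_const_mul, ga.2]
  simp only [fracDx_const_mul, (gA _).2, (gB _).2, ← mul_assoc, mul_inv_cancel₀ hr.ne', one_mul]
  congr 2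
  field_simp

theorem exists_finset_sum_sub_eq (N : ℕ) : ∃ s : Finset ℤ, ∀ u : ℤ → ℝ,
    ∑ j ∈ s, (u (j + 1) - u j) = u N - u (-(N : ℤ)) := by
  refine ⟨(Finset.range (2 * N)).image fun k : ℕ => (k : ℤ) - N, fun u => ?_⟩
  rw [Finset.sum_image (by intro a _ b _ h; simpa using h)]
  have := Finset.sum_range_sub (fun k : ℕ => u ((k : ℤ) - N)) (2 * N)
  convert this using 2
  · rename_i k _
    push_cast
    ring_nf
  · push_cast
    ring_nf
  · simp

theorem eLpNorm_fracDx_le_of_tendsto {p : ℝ≥0∞} {f : Pt d → ℝ} {F : ℤ → Pt d → ℝ} {C : ℝ≥0∞}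
    (h0 : ∀ z, Filter.Tendsto (fun n : ℕ => F (n : ℤ) z) Filter.atTop (nhds 0))
    (h1 : ∀ z, Filter.Tendsto (fun n : ℕ => F (-(n : ℤ)) z) Filter.atTop (nhds (fracDx f z)))
    (hb : ∀ s : Finset ℤ, AEStronglyMeasurable (fun z => ∑ j ∈ s, (F (j + 1) z - F j z)) volume ∧
      eLpNorm (fun z => ∑ j ∈ s, (F (j + 1) z - F j z)) p volume ≤ C) :
    eLpNorm (fracDx f) p volume ≤ C := by
  choose s hs using exists_finset_sum_sub_eq
  rw [← eLpNorm_neg]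
  refine Lp.eLpNorm_le_of_ae_tendsto (u := Filter.atTop)
    (f := fun N z => ∑ j ∈ s N, (F (j + 1) z - F j z))
    (Filter.Eventually.of_forall fun N => (hb _).2) (fun N => (hb _).1) (ae_of_all _ fun z => ?_)
  simp only [hs _ fun j => F j z]
  simpa using (h0 z).sub (h1 z)

end Assembly

section MainEstimate

open scoped ContDiff

variable {d : ℕ}

theorem eLpNorm_fintype_sum_le_ofReal_mul {ι : Type*} [Fintype ι] {p : ℝ≥0∞} (hp : 1 ≤ p)
    {g : ι → Pt d → ℝ} {C : ι → ℝ} (hC : ∀ i, 0 ≤ C i) {X : ℝ≥0∞}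
    (hg : ∀ i, AEStronglyMeasurable (g i) volume ∧
      eLpNorm (g i) p volume ≤ ENNReal.ofReal (C i) * X) :
    AEStronglyMeasurable (fun z => ∑ i, g i z) volume ∧
      eLpNorm (fun z => ∑ i, g i z) p volume ≤ ENNReal.ofReal (∑ i, C i) * X := by
  have e : (fun z => ∑ i, g i z) = ∑ i, g i := by ext z; simp
  rw [e]
  refine ⟨Finset.aestronglyMeasurable_sum _ fun i _ => (hg i).1, ?_⟩
  refine (eLpNorm_sum_le (fun i _ => (hg i).1) hp).trans ?_
  rw [ENNReal.ofReal_sum_of_nonneg fun i _ => hC i, Finset.sum_mul]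
  exact Finset.sum_le_sum fun i _ => (hg i).2

theorem abs_apply_le_norm (w : V d) (i : Fin d) : ‖w i‖ ≤ ‖w‖ := PiLp.norm_apply_le w i

theorem exists_smooth_mollifier (d : ℕ) : ∃ φ : Pt d → ℝ, ContDiff ℝ ∞ φ ∧ HasCompactSupport φ ∧
    Integrable φ ∧ ∫ m, φ m = 1 := by
  let b : ContDiffBump (0 : Pt d) := ⟨1, 2, one_pos, one_lt_two⟩
  have h1 : ContDiff ℝ ∞ (b.normed volume) := b.contDiff_normed
  have h2 : HasCompactSupport (b.normed volume) := b.hasCompactSupport_normed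
  exact ⟨b.normed volume, h1, h2, h1.continuous.integrable_of_hasCompactSupport h2,
    b.integral_normed⟩

theorem SchwartzMap.abs_sub_le_seminorm_mul (f : SchwartzMap (Pt d) ℝ) (m n : Pt d) :
    |f m - f n| ≤ SchwartzMap.seminorm ℝ 0 0 (SchwartzMap.fderivCLM ℝ (Pt d) ℝ f) * ‖m - n‖ := by
  have h := Convex.norm_image_sub_le_of_norm_fderiv_le (𝕜 := ℝ) (f := ⇑f) (s := Set.univ)
    (C := SchwartzMap.seminorm ℝ 0 0 (SchwartzMap.fderivCLM ℝ (Pt d) ℝ f))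
    (fun x _ => f.differentiableAt)
    (fun x _ => SchwartzMap.norm_le_seminorm ℝ (SchwartzMap.fderivCLM ℝ (Pt d) ℝ f) x)
    convex_univ (Set.mem_univ n) (Set.mem_univ m)
  simpa using h

theorem hasFDerivAt_schwartz_coord (S : SchwartzMap (Pt d) (V d)) (i : Fin d) (m : Pt d) :
    HasFDerivAt (fun m => S m i)
      ((EuclideanSpace.proj i : V d →L[ℝ] ℝ).comp (fderiv ℝ S m)) m :=
  (EuclideanSpace.proj i : V d →L[ℝ] ℝ).hasFDerivAt.comp m S.differentiableAt.hasFDerivAt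

end MainEstimate

/-- **Theorem 4.2: sharp transfer of regularity in Sobolev spaces (Bouchut–Hörmander).**
Let `Q = 4d+2`, `p ∈ (Q/(Q−1), ∞)` and `1/q = 1/p + 1/Q`. There is `C = C(d,p) > 0` such
that for every Schwartz `f` with `(∂_t + v·∇_x) f = ∇_v · S₀ + S₁`, `S₀, S₁` Schwartz,
`‖𝔇_x f‖_{L^p} ≤ C (‖S₀‖_{L^p} + ‖∇_v f‖_{L^p} + ‖S₁‖_{L^q})`. -/
theorem statement18 (d : ℕ) (hd : 1 ≤ d) (p q : ℝ)
    (hp : (4 * (d : ℝ) + 2) / (4 * (d : ℝ) + 1) < p)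
    (hq : 1 / q = 1 / p + 1 / (4 * (d : ℝ) + 2)) :
    ∃ C : ℝ, 0 < C ∧
      ∀ (f : SchwartzMap (Pt d) ℝ) (S0 : SchwartzMap (Pt d) (V d))
        (S1 : SchwartzMap (Pt d) ℝ),
        (∀ z : Pt d, fderiv ℝ (⇑f) z (1, z.2.2, 0) =
          (∑ i : Fin d, fderiv ℝ (⇑S0) z (0, 0, EuclideanSpace.single i 1) i) + S1 z) →
        eLpNorm (fracDx (⇑f)) (ENNReal.ofReal p) volume ≤
          ENNReal.ofReal C *
            (eLpNorm (⇑S0) (ENNReal.ofReal p) volume +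
              eLpNorm (gradV (⇑f)) (ENNReal.ofReal p) volume +
              eLpNorm (⇑S1) (ENNReal.ofReal q) volume) := by
  have hd0 : (0 : ℝ) ≤ d := Nat.cast_nonneg d
  have hp1 : 1 < p := by
    refine lt_trans ?_ hp
    rw [lt_div_iff₀ (by positivity)]
    linarith
  have hp0 : 0 < p := by linarith
  have hq1 : 1 < q := by
    have hq0 : 0 < q := by
      rw [← one_div_pos, hq]
      positivity
    rw [div_lt_iff₀ (by positivity)] at hp
    rw [← inv_lt_one₀ hq0, ← one_div, hq, div_add_div _ _ hp0.ne' (by positivity),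
      div_lt_one (by positivity)]
    linarith
  have hp' : 1 ≤ ENNReal.ofReal p := by
    rw [← ENNReal.ofReal_one]
    exact ENNReal.ofReal_le_ofReal hp1.le
  obtain ⟨φ, hφ, hφs, hφi, hφ1⟩ := exists_smooth_mollifier d
  obtain ⟨A, B, a, hA, hB, ha, hdec⟩ := exists_rconv_dilKernel_two_mul_sub_eq hφ hφs
  choose CA hCA hAb using fun i => exists_eLpNorm_sum_rconv_dilKernel_le hd hp1 (hA i)
  choose CB hCB hBb using fun i => exists_eLpNorm_sum_rconv_dilKernel_le hd hp1 (hB i)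
  obtain ⟨Ca, hCa, hab⟩ := exists_eLpNorm_sum_zpow_mul_rconv_dilKernel_le hd hp0 hq1 hq ha
  have hA0 : 0 ≤ ∑ i, CA i := Finset.sum_nonneg fun i _ => (hCA i).le
  have hB0 : 0 ≤ ∑ i, CB i := Finset.sum_nonneg fun i _ => (hCB i).le
  refine ⟨(∑ i, CA i) + (∑ i, CB i) + Ca, by positivity, fun f S0 S1 hpde => ?_⟩
  have hfM : ∀ z, |f z| ≤ _ := SchwartzMap.norm_le_seminorm ℝ f
  have hT : ∀ i, ContDiff ℝ 1 fun m => S0 m i := fun i =>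
    (EuclideanSpace.proj i : V d →L[ℝ] ℝ).contDiff.comp (S0.smooth 1)
  have hTM : ∀ (i : Fin d) z, |S0 z i| ≤ SchwartzMap.seminorm ℝ 0 0 S0 := fun i z =>
    (abs_apply_le_norm (S0 z) i).trans (SchwartzMap.norm_le_seminorm ℝ S0 z)
  have hTp : ∀ i, MemLp (fun m => S0 m i) (ENNReal.ofReal p) volume := fun i =>
    (S0.memLp (ENNReal.ofReal p) volume).mono (hT i).continuous.aestronglyMeasurable
      (ae_of_all _ fun m => abs_apply_le_norm (S0 m) i)
  have hTn : ∀ i, eLpNorm (fun m => S0 m i) (ENNReal.ofReal p) volume ≤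
      eLpNorm (⇑S0) (ENNReal.ofReal p) volume := fun i =>
    eLpNorm_mono fun m => abs_apply_le_norm (S0 m) i
  have hDe : ∀ i, (fun m => fderiv ℝ (⇑f) m (velDir i)) =
      ⇑(LineDeriv.lineDerivOp (velDir i : Pt d) f : SchwartzMap (Pt d) ℝ) := fun i =>
    funext fun m => (SchwartzMap.lineDerivOp_apply_eq_fderiv _ _ _).symm
  have hD : ∀ i, Continuous fun m => fderiv ℝ (⇑f) m (velDir i) := fun i => by
    rw [hDe]
    exact SchwartzMap.continuous _
  have hDM : ∀ i m, |fderiv ℝ (⇑f) m (velDir i)| ≤ SchwartzMap.seminorm ℝ 0 0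
      (LineDeriv.lineDerivOp (velDir i : Pt d) f : SchwartzMap (Pt d) ℝ) := fun i m => by
    rw [← SchwartzMap.lineDerivOp_apply_eq_fderiv]
    exact SchwartzMap.norm_le_seminorm ℝ (LineDeriv.lineDerivOp (velDir i : Pt d) f : SchwartzMap (Pt d) ℝ) m
  have hDp : ∀ i, MemLp (fun m => fderiv ℝ (⇑f) m (velDir i)) (ENNReal.ofReal p) volume := by
    intro i
    rw [hDe]
    exact SchwartzMap.memLp _ _ _
  have hDn : ∀ i, eLpNorm (fun m => fderiv ℝ (⇑f) m (velDir i)) (ENNReal.ofReal p) volume ≤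
      eLpNorm (gradV (⇑f)) (ENNReal.ofReal p) volume := fun i =>
    eLpNorm_mono fun m => abs_apply_le_norm (gradV (⇑f) m) i
  have hS1M : ∀ z, |S1 z| ≤ _ := SchwartzMap.norm_le_seminorm ℝ S1
  have hpde' : ∀ m, fderiv ℝ (⇑f) m (transDir m) =
      (∑ i, fderiv ℝ (fun m => S0 m i) m (velDir i)) + S1 m := fun m => by
    have h : ∀ i, fderiv ℝ (fun m => S0 m i) m = _ := fun i =>
      (hasFDerivAt_schwartz_coord S0 i m).fderiv
    simp only [h]
    exact hpde m
  have hφk := exists_isTestKernel hφ hφs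
  have hstep : ∀ (j : ℤ) (z : Pt d), _ := fun j z =>
    fracDx_rconv_dilKernel_sub_eq hd hφk hA hB ha f.continuous hfM (fun i => (hT i).continuous)
      hTM hD hDM S1.continuous hS1M (r := (2 : ℝ) ^ j) (r' := (2 : ℝ) ^ j * 2) (by positivity)
      (by positivity) (hdec f _ _ (f.smooth 1) hT S1.continuous hpde' _ (by positivity)) z
  refine eLpNorm_fracDx_le_of_tendsto
    (F := fun j => fracDx (rconv volume (dilKernel ((2 : ℝ) ^ j) φ) f)) (fun z => ?_)
    (fun z => ?_) fun s => ?_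
  · obtain ⟨_, _, hk⟩ := hφk
    exact tendsto_fracDx_rconv_dilKernel_atTop f.continuous hfM hd hk z
  · refine tendsto_fracDx_rconv_dilKernel_nhds_zero hd f.continuous hfM
      f.abs_sub_le_seminorm_mul hφi hφ1 (fun n => by positivity) ?_ z
    simp only [zpow_neg, zpow_natCast, ← inv_pow]
    exact tendsto_pow_atTop_nhds_zero_of_lt_one (by norm_num) (by norm_num)
  · have e : ∀ z, ∑ j ∈ s, (fracDx (rconv volume (dilKernel ((2 : ℝ) ^ (j + 1)) φ) f) z -
        fracDx (rconv volume (dilKernel ((2 : ℝ) ^ j) φ) f) z) =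
        (∑ i, ∑ j ∈ s, rconv volume (dilKernel ((2 : ℝ) ^ j) (fracDx (A i))) (fun m => S0 m i) z) +
        (∑ i, ∑ j ∈ s, rconv volume (dilKernel ((2 : ℝ) ^ j) (fracDx (B i)))
          (fun m => fderiv ℝ (⇑f) m (velDir i)) z) +
        ∑ j ∈ s, (2 : ℝ) ^ j * rconv volume (dilKernel ((2 : ℝ) ^ j) (fracDx a)) S1 z := by
      intro z
      rw [Finset.sum_comm (s := Finset.univ), Finset.sum_comm (s := Finset.univ),
        ← Finset.sum_add_distrib, ← Finset.sum_add_distrib]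
      refine Finset.sum_congr rfl fun j _ => ?_
      rw [zpow_add_one₀ two_ne_zero]
      exact hstep j z
    simp only [e]
    obtain ⟨mA, bA⟩ := eLpNorm_fintype_sum_le_ofReal_mul hp' (fun i => (hCA i).le) fun i =>
      let h := hAb i s _ _ (hT i).continuous (hTM i) (hTp i)
      ⟨h.1, h.2.trans (mul_le_mul_right (hTn i) _)⟩
    obtain ⟨mB, bB⟩ := eLpNorm_fintype_sum_le_ofReal_mul hp' (fun i => (hCB i).le) fun i =>
      let h := hBb i s _ _ (hD i) (hDM i) (hDp i)
      ⟨h.1, h.2.trans (mul_le_mul_right (hDn i) _)⟩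
    obtain ⟨ma, ba⟩ := hab s _ _ S1.continuous hS1M (S1.memLp _ volume)
    refine ⟨(mA.add mB).add ma, ?_⟩
    refine (eLpNorm_add_le (mA.add mB) ma hp').trans ?_
    refine (add_le_add (eLpNorm_add_le mA mB hp') le_rfl).trans ?_
    refine (add_le_add (add_le_add bA bB) ba).trans ?_
    simp only [mul_add]
    gcongr <;> linarith
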